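/- Superposition principle (direct part): Let Ω ⊂ ℝ^d be the closure of a bounded domain and let t ↦ ρ_t ∈ C_w([0,1];M⁺(Ω)) be a measure solution of ∂_t ρ_t + div(v ρ_t) = g ρ_t in X_Ω := (0,1)×Ω, for measurable maps v : X_Ω → ℝ^d and g : X_Ω → ℝ satisfying ∫₀¹∫_Ω (|v(t,x)|² + |g(t,x)|²) dρ_t(x) dt < ∞. Then there exists a measure σ ∈ M⁺₁(𝒮_Ω) concentrated on H_Ω^{v,g} such that ρ_t = ρ_t^σ for all t ∈ [0,1], i.e. ∫_Ω φ(x) dρ_t(x) = ∫_{𝒮_Ω} h(t)φ(γ(t)) dσ(γ,h) for all φ ∈ C(Ω) and all t ∈ [0,1]. -/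

import Mathlib

open MeasureTheory Set Filter Topology
open scoped ENNReal NNReal

noncomputable section

namespace Paper

abbrev Euc (d : ℕ) : Type := EuclideanSpace ℝ (Fin d)

abbrev XX (d : ℕ) : Type := ℝ × Euc d

variable {d : ℕ}

/-- `Ω` is the closure of a bounded domain (a nonempty bounded open connected set). -/
def IsClosureOfBoundedDomain (Ω : Set (Euc d)) : Prop :=
  ∃ U : Set (Euc d), IsOpen U ∧ U.Nonempty ∧ IsConnected U ∧
    Bornology.IsBounded U ∧ Ω = closure U

/-- `Ω` is the closure of a bounded convex domain. -/
def IsClosureOfBoundedConvexDomain (Ω : Set (Euc d)) : Prop :=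
  ∃ U : Set (Euc d), IsOpen U ∧ U.Nonempty ∧ Convex ℝ U ∧
    Bornology.IsBounded U ∧ Ω = closure U

/-- clamping of `ℝ` onto `[0,1]`. -/
def clamp (t : ℝ) : ℝ := max 0 (min 1 t)

/-- `t ↦ ρ t` is a narrowly continuous curve (on `[0,1]`) of finite positive
measures concentrated on `Ω`, i.e. an element of `C_w([0,1]; M⁺(Ω))`. -/
def NarrowCurve (Ω : Set (Euc d)) (ρ : ℝ → Measure (Euc d)) : Prop :=
  (∀ t ∈ Icc (0:ℝ) 1, ρ t Ωᶜ = 0 ∧ ρ t Set.univ ≠ ⊤) ∧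
  (∀ φ : Euc d → ℝ, Continuous φ →
      ContinuousOn (fun t => ∫ x, φ x ∂(ρ t)) (Icc (0:ℝ) 1))

/-- Test functions for the continuity equation on `X_Ω = (0,1) × Ω` (no-flux form:
compact support in time, free at the spatial boundary). -/
def IsTest (φ : XX d → ℝ) : Prop :=
  ContDiff ℝ (⊤ : ℕ∞) φ ∧ HasCompactSupport φ ∧
    tsupport φ ⊆ Ioo (0:ℝ) 1 ×ˢ (Set.univ : Set (Euc d))

/-- Distributional solution of `∂ₜ ρ + div (v ρ) = g ρ`. -/
def SolvesCE (ρ : ℝ → Measure (Euc d)) (v : XX d → Euc d) (g : XX d → ℝ) : Prop :=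
  ∀ φ : XX d → ℝ, IsTest φ →
    (∫ t in Ioo (0:ℝ) 1,
      ∫ x, (fderiv ℝ φ (t, x) (1, v (t, x)) + φ (t, x) * g (t, x)) ∂(ρ t)) = 0

/-- The Hellinger–Kantorovich energy `∫₀¹ ∫ (|v|² + g²) dρ_t dt`. -/
def EnergyVG (ρ : ℝ → Measure (Euc d)) (v : XX d → Euc d) (g : XX d → ℝ) : ℝ≥0∞ :=
  ∫⁻ t in Ioo (0:ℝ) 1, ∫⁻ x, ENNReal.ofReal (‖v (t, x)‖ ^ 2 + g (t, x) ^ 2) ∂(ρ t)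

/-- The class `D_{v,g}` of finite-energy narrowly continuous solutions. -/
def Dvg (Ω : Set (Euc d)) (v : XX d → Euc d) (g : XX d → ℝ)
    (ρ : ℝ → Measure (Euc d)) : Prop :=
  NarrowCurve Ω ρ ∧ SolvesCE ρ v g ∧ EnergyVG ρ v g < ⊤

/-- total variation `‖ρ‖_{M(X_Ω)}` of `ρ = dt ⊗ ρ_t`. -/
def TVcurve (ρ : ℝ → Measure (Euc d)) : ℝ≥0∞ :=
  ∫⁻ t in Ioo (0:ℝ) 1, ρ t Set.univ

/-- The cone `𝒞_V = {h δ_γ : h ≥ 0, γ ∈ V}` of weighted Dirac masses. -/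
def coneSet (V : Set (Euc d)) : Set (Measure (Euc d)) :=
  {μ | ∃ (a : ℝ) (x : Euc d), 0 ≤ a ∧ x ∈ V ∧ μ = ENNReal.ofReal a • Measure.dirac x}

/-- The space `𝒮_V` of narrowly continuous curves `[0,1] → 𝒞_V`
(extended to `ℝ` by clamping). -/
structure SCurve (V : Set (Euc d)) where
  toFun : ℝ → Measure (Euc d)
  clamped : ∀ t, toFun t = toFun (clamp t)
  cone : ∀ t, toFun t ∈ coneSet V
  narrow : ∀ φ : Euc d → ℝ, Continuous φ → Continuous fun t => ∫ x, φ x ∂(toFun t)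

/-- The flat distance `D_F` between measures. -/
def flatDist (μ ν : Measure (Euc d)) : ℝ :=
  sSup {r : ℝ | ∃ φ : Euc d → ℝ, Continuous φ ∧ (∀ x, |φ x| ≤ 1) ∧ LipschitzWith 1 φ ∧
        r = (∫ x, φ x ∂μ) - ∫ x, φ x ∂ν}

/-- The supremum distance `D` on `𝒮_V`. -/
def Ddist {V : Set (Euc d)} (η₁ η₂ : SCurve V) : ℝ :=
  sSup {r : ℝ | ∃ t ∈ Icc (0:ℝ) 1, r = flatDist (η₁.toFun t) (η₂.toFun t)}

/-- The topology of `(𝒮_V, D)`, generated by the open `D`-balls. -/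
def Stop (V : Set (Euc d)) : TopologicalSpace (SCurve V) :=
  TopologicalSpace.generateFrom
    {s | ∃ (η₀ : SCurve V) (ε : ℝ), 0 < ε ∧ s = {η | Ddist η₀ η < ε}}

/-- The Borel σ-algebra of `(𝒮_V, D)`. -/
def Sborel (V : Set (Euc d)) : MeasurableSpace (SCurve V) := @borel _ (Stop V)

instance (V : Set (Euc d)) : MeasurableSpace (SCurve V) := Sborel V

/-- `‖h‖_∞` for a curve `ρ_t = h(t) δ_{γ(t)} ∈ 𝒮_V`. -/
def supMass {V : Set (Euc d)} (η : SCurve V) : ℝ≥0∞ :=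
  ⨆ t ∈ Icc (0:ℝ) 1, η.toFun t Set.univ

/-- `AC²[0,1]`: absolutely continuous on `[0,1]` with a.e. derivative in `L²`. -/
def AC2 {F : Type*} [NormedAddCommGroup F] [NormedSpace ℝ F] (f : ℝ → F) : Prop :=
  ∃ f' : ℝ → F, IntegrableOn f' (Icc (0:ℝ) 1) ∧
    IntegrableOn (fun t => ‖f' t‖ ^ 2) (Icc (0:ℝ) 1) ∧
    ∀ t ∈ Icc (0:ℝ) 1, f t = f 0 + ∫ s in (0:ℝ)..t, f' s

/-- `(γ, h)` represents the curve `η ∈ 𝒮_V`, i.e. `η_t = h(t) δ_{γ(t)}` on `[0,1]`. -/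
def Represents {V : Set (Euc d)} (η : SCurve V) (γ : ℝ → Euc d) (h : ℝ → ℝ) : Prop :=
  ∀ t ∈ Icc (0:ℝ) 1, 0 ≤ h t ∧ γ t ∈ V ∧
    η.toFun t = ENNReal.ofReal (h t) • Measure.dirac (γ t)

/-- The set `H_V ⊆ 𝒮_V` of curves `h(t)δ_{γ(t)}` with `h, √h ∈ AC²[0,1]`,
`√h γ ∈ AC²([0,1];ℝ^d)`. -/
def MemH (V : Set (Euc d)) (η : SCurve V) : Prop :=
  ∃ (γ : ℝ → Euc d) (h : ℝ → ℝ), Represents η γ h ∧ AC2 h ∧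
    AC2 (fun t => Real.sqrt (h t)) ∧ AC2 (fun t => Real.sqrt (h t) • γ t)

/-- The set `H_V^{v,g}`: curves in `H_V` solving the characteristic system
`γ' = v(t,γ)` a.e. on `{h>0}` and `h' = g(t,γ) h` a.e. on `(0,1)`. -/
def MemHvg (V : Set (Euc d)) (v : XX d → Euc d) (g : XX d → ℝ) (η : SCurve V) : Prop :=
  ∃ (γ : ℝ → Euc d) (h : ℝ → ℝ), Represents η γ h ∧ AC2 h ∧
    AC2 (fun t => Real.sqrt (h t)) ∧ AC2 (fun t => Real.sqrt (h t) • γ t) ∧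
    (∀ᵐ t ∂(volume.restrict {t | t ∈ Ioo (0:ℝ) 1 ∧ 0 < h t}),
        HasDerivAt γ (v (t, γ t)) t) ∧
    (∀ᵐ t ∂(volume.restrict (Ioo (0:ℝ) 1)),
        HasDerivAt h (g (t, γ t) * h t) t)

/-- The set `𝒮*_V` of curves whose positivity set `{h > 0}` is `[0,1] ∩ (-∞, τ)`. -/
def MemSstar {V : Set (Euc d)} (η : SCurve V) : Prop :=
  ∃ τ : ℝ, {t | t ∈ Icc (0:ℝ) 1 ∧ η.toFun t Set.univ ≠ 0} = Icc (0:ℝ) 1 ∩ Iio τ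

/-- The vanishing time `τ(γ,h) = min { t ∈ [0,1] : h(t) = 0 }` (`∞` if none). -/
def tauS {V : Set (Euc d)} (η : SCurve V) : ℝ≥0∞ :=
  sInf {c : ℝ≥0∞ | ∃ t ∈ Icc (0:ℝ) 1, η.toFun t Set.univ = 0 ∧ c = ENNReal.ofReal t}


open Classical in
/-- The integrand `Ψ_δ(t,x,y)`. -/
def Psi (δ : ℝ) (t : ℝ) (x : Euc d) (y : ℝ) : ℝ≥0∞ :=
  if 0 < t then ENNReal.ofReal ((‖x‖ ^ 2 + δ ^ 2 * y ^ 2) / (2 * t))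
  else if t = 0 ∧ x = 0 ∧ y = 0 then 0 else ⊤

/-- `u` is a density of the signed measure `σ` with respect to `lam`. -/
def IsDensityS (σ : SignedMeasure (XX d)) (lam : Measure (XX d)) (u : XX d → ℝ) : Prop :=
  ∀ s : Set (XX d), MeasurableSet s → σ s = ∫ x in s, u x ∂lam

/-- `w` is a density of the vector measure `m` with respect to `lam`. -/
def IsDensityV (m : VectorMeasure (XX d) (Euc d)) (lam : Measure (XX d))
    (w : XX d → Euc d) : Prop :=
  ∀ s : Set (XX d), MeasurableSet s → m s = ∫ x in s, w x ∂lam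

/-- `r` is a density of the positive measure `P` with respect to `lam`. -/
def IsDensityP (P : Measure (XX d)) (lam : Measure (XX d)) (r : XX d → ℝ) : Prop :=
  ∀ s : Set (XX d), MeasurableSet s → P s = ∫⁻ x in s, ENNReal.ofReal (r x) ∂lam

/-- `(P, m, μ)` is a measure solution of `∂ₜ ρ + div m = μ` (with `P` positive). -/
def SolvesCEMeas (P : Measure (XX d)) (m : VectorMeasure (XX d) (Euc d))
    (μ : SignedMeasure (XX d)) : Prop :=
  ∀ (lam : Measure (XX d)), IsFiniteMeasure lam →
    ∀ (w : XX d → Euc d) (u : XX d → ℝ), Measurable w → Measurable u →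
      IsDensityV m lam w → IsDensityS μ lam u →
      ∀ φ : XX d → ℝ, IsTest φ →
        ((∫ x, fderiv ℝ φ x ((1:ℝ), (0 : Euc d)) ∂P) +
          (∫ x, fderiv ℝ φ x ((0:ℝ), w x) ∂lam) + ∫ x, φ x * u x ∂lam) = 0

/-- The Wasserstein–Fisher–Rao energy `B_δ(ρ,m,μ)` for a positive `ρ`. -/
def BdeltaMeas (δ : ℝ) (P : Measure (XX d)) (m : VectorMeasure (XX d) (Euc d))
    (μ : SignedMeasure (XX d)) : ℝ≥0∞ :=
  sInf {c : ℝ≥0∞ | ∃ lam : Measure (XX d), IsFiniteMeasure lam ∧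
    ∃ (r : XX d → ℝ) (w : XX d → Euc d) (u : XX d → ℝ),
      Measurable r ∧ Measurable w ∧ Measurable u ∧ (∀ x, 0 ≤ r x) ∧
      IsDensityP P lam r ∧ IsDensityV m lam w ∧ IsDensityS μ lam u ∧
      c = ∫⁻ x, Psi δ (r x) (w x) (u x) ∂lam}

open Classical in
/-- The coercive energy `J_{α,β,δ}(ρ,m,μ)` for a positive `ρ`. -/
def JMeas (α β δ : ℝ) (P : Measure (XX d)) (m : VectorMeasure (XX d) (Euc d))
    (μ : SignedMeasure (XX d)) : ℝ≥0∞ :=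
  if SolvesCEMeas P m μ then
    ENNReal.ofReal β * BdeltaMeas δ P m μ + ENNReal.ofReal α * P Set.univ
  else ⊤

/-- `(ρ, m, μ)` is a measure solution of `∂ₜ ρ + div m = μ` (signed case). -/
def SolvesCESigned (ρ : SignedMeasure (XX d)) (m : VectorMeasure (XX d) (Euc d))
    (μ : SignedMeasure (XX d)) : Prop :=
  ∀ (lam : Measure (XX d)), IsFiniteMeasure lam →
    ∀ (r : XX d → ℝ) (w : XX d → Euc d) (u : XX d → ℝ),
      Measurable r → Measurable w → Measurable u →
      IsDensityS ρ lam r → IsDensityV m lam w → IsDensityS μ lam u →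
      ∀ φ : XX d → ℝ, IsTest φ →
        (∫ x, (fderiv ℝ φ x ((1:ℝ), (0 : Euc d)) * r x
          + fderiv ℝ φ x ((0:ℝ), w x) + φ x * u x) ∂lam) = 0

/-- The Wasserstein–Fisher–Rao energy `B_δ(ρ,m,μ)`, signed case. -/
def BdeltaSigned (δ : ℝ) (ρ : SignedMeasure (XX d)) (m : VectorMeasure (XX d) (Euc d))
    (μ : SignedMeasure (XX d)) : ℝ≥0∞ :=
  sInf {c : ℝ≥0∞ | ∃ lam : Measure (XX d), IsFiniteMeasure lam ∧
    ∃ (r : XX d → ℝ) (w : XX d → Euc d) (u : XX d → ℝ),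
      Measurable r ∧ Measurable w ∧ Measurable u ∧
      IsDensityS ρ lam r ∧ IsDensityV m lam w ∧ IsDensityS μ lam u ∧
      c = ∫⁻ x, Psi δ (r x) (w x) (u x) ∂lam}

open Classical in
/-- The coercive energy `J_{α,β,δ}(ρ,m,μ)`, signed case. -/
def JSigned (α β δ : ℝ) (ρ : SignedMeasure (XX d)) (m : VectorMeasure (XX d) (Euc d))
    (μ : SignedMeasure (XX d)) : ℝ≥0∞ :=
  if SolvesCESigned ρ m μ then
    ENNReal.ofReal β * BdeltaSigned δ ρ m μ
      + ENNReal.ofReal α * ρ.totalVariation Set.univ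
  else ⊤

/-- A signed measure on `X = ℝ × ℝ^d` is concentrated on `X_Ω = (0,1) × Ω`. -/
def ConcS (Ω : Set (Euc d)) (ρ : SignedMeasure (XX d)) : Prop :=
  ∀ s : Set (XX d), MeasurableSet s → s ⊆ (Ioo (0:ℝ) 1 ×ˢ Ω)ᶜ → ρ s = 0

/-- A vector measure on `X = ℝ × ℝ^d` is concentrated on `X_Ω = (0,1) × Ω`. -/
def ConcV (Ω : Set (Euc d)) (m : VectorMeasure (XX d) (Euc d)) : Prop :=
  ∀ s : Set (XX d), MeasurableSet s → s ⊆ (Ioo (0:ℝ) 1 ×ˢ Ω)ᶜ → m s = 0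

/-- Integral of `φ` against a signed measure. -/
def sInt {α : Type*} [MeasurableSpace α] (σ : SignedMeasure α) (φ : α → ℝ) : ℝ :=
  (∫ x, φ x ∂σ.toJordanDecomposition.posPart) -
    ∫ x, φ x ∂σ.toJordanDecomposition.negPart

/-- Triples `(ρ, m, μ) ∈ M(X_Ω) × M(X_Ω; ℝ^d) × M(X_Ω)`. -/
abbrev Mtriple (d : ℕ) : Type :=
  SignedMeasure (XX d) × VectorMeasure (XX d) (Euc d) × SignedMeasure (XX d)

/-- `P` is the measure `dt ⊗ ρ_t` associated with the curve `η ∈ 𝒮_V`. -/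
def CurveMeasure {V : Set (Euc d)} (η : SCurve V) (P : Measure (XX d)) : Prop :=
  ∀ s : Set (XX d), MeasurableSet s →
    P s = ∫⁻ t in Ioo (0:ℝ) 1, η.toFun t {x | (t, x) ∈ s}

/-- `h'` and `γ'` are the a.e. derivatives of `h` on `(0,1)` and of `γ` on `{h>0}`. -/
def HasAEDerivs (γ : ℝ → Euc d) (h : ℝ → ℝ) (γ' : ℝ → Euc d) (h' : ℝ → ℝ) : Prop :=
  (∀ᵐ t ∂(volume.restrict (Ioo (0:ℝ) 1)), HasDerivAt h (h' t) t) ∧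
  (∀ᵐ t ∂(volume.restrict {t | t ∈ Ioo (0:ℝ) 1 ∧ 0 < h t}), HasDerivAt γ (γ' t) t)

/-- The triple `p = (ρ, m, μ)` is of characteristic form
`ρ = h dt ⊗ δ_γ`, `m = γ' ρ`, `μ = h' dt ⊗ δ_γ` with the regularity of `H_Ω`. -/
def CharRepr (Ω : Set (Euc d)) (γ : ℝ → Euc d) (h : ℝ → ℝ) (γ' : ℝ → Euc d)
    (h' : ℝ → ℝ) (p : Mtriple d) : Prop :=
  (∀ t ∈ Icc (0:ℝ) 1, 0 ≤ h t ∧ γ t ∈ Ω) ∧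
  AC2 h ∧ AC2 (fun t => Real.sqrt (h t)) ∧ AC2 (fun t => Real.sqrt (h t) • γ t) ∧
  (∀ φ : Euc d → ℝ, Continuous φ →
      ContinuousOn (fun t => h t * φ (γ t)) (Icc (0:ℝ) 1)) ∧
  HasAEDerivs γ h γ' h' ∧
  (∀ s : Set (XX d), MeasurableSet s →
      p.1 s = ∫ t in Ioo (0:ℝ) 1, Set.indicator {u : ℝ | (u, γ u) ∈ s} h t) ∧
  (∀ s : Set (XX d), MeasurableSet s →
      p.2.1 s = ∫ t in Ioo (0:ℝ) 1,
        Set.indicator {u : ℝ | (u, γ u) ∈ s} (fun u => h u • γ' u) t) ∧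
  (∀ s : Set (XX d), MeasurableSet s →
      p.2.2 s = ∫ t in Ioo (0:ℝ) 1, Set.indicator {u : ℝ | (u, γ u) ∈ s} h' t)

/-- The set `𝒞` of extremal characteristic triples. -/
def MemC (α β δ : ℝ) (Ω : Set (Euc d)) (p : Mtriple d) : Prop :=
  ∃ (γ : ℝ → Euc d) (h : ℝ → ℝ) (γ' : ℝ → Euc d) (h' : ℝ → ℝ),
    CharRepr Ω γ h γ' h' p ∧
    IsPreconnected {t | t ∈ Icc (0:ℝ) 1 ∧ 0 < h t} ∧
    JSigned α β δ p.1 p.2.1 p.2.2 = 1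


/-- Curves in `C_w([0,1]; M(Ω))`: narrowly continuous curves of signed measures
concentrated on `Ω`, extended to `ℝ` by clamping. -/
def IsCwCurve (Ω : Set (Euc d)) (f : ℝ → SignedMeasure (Euc d)) : Prop :=
  (∀ t, f t = f (clamp t)) ∧
  (∀ t, ∀ s : Set (Euc d), MeasurableSet s → s ⊆ Ωᶜ → f t s = 0) ∧
  (∀ φ : Euc d → ℝ, Continuous φ → Continuous fun t => sInt (f t) φ)

/-- `r` is a density with respect to `lam` of the measure `dt ⊗ f_t` on `X`. -/
def CwDensity (f : ℝ → SignedMeasure (Euc d)) (lam : Measure (XX d))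
    (r : XX d → ℝ) : Prop :=
  ∀ s : Set (XX d), MeasurableSet s →
    (∫ t in Ioo (0:ℝ) 1,
        sInt (f t) ({x : Euc d | (t, x) ∈ s}.indicator fun _ => (1:ℝ)))
      = ∫ x in s, r x ∂lam

/-- `(f, m, μ)` is a measure solution of `∂ₜ ρ + div m = μ`, `f` a curve. -/
def SolvesCECw (f : ℝ → SignedMeasure (Euc d)) (m : VectorMeasure (XX d) (Euc d))
    (μ : SignedMeasure (XX d)) : Prop :=
  ∀ (lam : Measure (XX d)), IsFiniteMeasure lam →
    ∀ (w : XX d → Euc d) (u : XX d → ℝ), Measurable w → Measurable u →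
      IsDensityV m lam w → IsDensityS μ lam u →
      ∀ φ : XX d → ℝ, IsTest φ →
        ((∫ t in Ioo (0:ℝ) 1, sInt (f t) fun x => fderiv ℝ φ (t, x) ((1:ℝ), (0 : Euc d)))
          + (∫ x, fderiv ℝ φ x ((0:ℝ), w x) ∂lam) + ∫ x, φ x * u x ∂lam) = 0

/-- `B_δ(dt ⊗ f_t, m, μ)`. -/
def BdeltaCw (δ : ℝ) (f : ℝ → SignedMeasure (Euc d)) (m : VectorMeasure (XX d) (Euc d))
    (μ : SignedMeasure (XX d)) : ℝ≥0∞ :=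
  sInf {c : ℝ≥0∞ | ∃ lam : Measure (XX d), IsFiniteMeasure lam ∧
    ∃ (r : XX d → ℝ) (w : XX d → Euc d) (u : XX d → ℝ),
      Measurable r ∧ Measurable w ∧ Measurable u ∧
      CwDensity f lam r ∧ IsDensityV m lam w ∧ IsDensityS μ lam u ∧
      c = ∫⁻ x, Psi δ (r x) (w x) (u x) ∂lam}

/-- `‖dt ⊗ f_t‖_{M(X_Ω)}`. -/
def TVCw (f : ℝ → SignedMeasure (Euc d)) : ℝ≥0∞ :=
  ∫⁻ t in Ioo (0:ℝ) 1, (f t).totalVariation Set.univ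

open Classical in
/-- `J_{α,β,δ}(dt ⊗ f_t, m, μ)`. -/
def JCw (α β δ : ℝ) (f : ℝ → SignedMeasure (Euc d)) (m : VectorMeasure (XX d) (Euc d))
    (μ : SignedMeasure (XX d)) : ℝ≥0∞ :=
  if SolvesCECw f m μ then
    ENNReal.ofReal β * BdeltaCw δ f m μ + ENNReal.ofReal α * TVCw f
  else ⊤

/-- The set `𝒞` in curve form: `(f, m, μ)` with `f_t = h(t) δ_{γ(t)}`,
`m = h γ' dt ⊗ δ_γ`, `μ = h' dt ⊗ δ_γ`, with `H_Ω`-regularity, connected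
positivity set and unit energy. -/
def MemCCw (α β δ : ℝ) (Ω : Set (Euc d)) (f : ℝ → SignedMeasure (Euc d))
    (m : VectorMeasure (XX d) (Euc d)) (μ : SignedMeasure (XX d)) : Prop :=
  ∃ (γ : ℝ → Euc d) (h : ℝ → ℝ) (γ' : ℝ → Euc d) (h' : ℝ → ℝ),
    (∀ t ∈ Icc (0:ℝ) 1, 0 ≤ h t ∧ γ t ∈ Ω) ∧
    AC2 h ∧ AC2 (fun t => Real.sqrt (h t)) ∧ AC2 (fun t => Real.sqrt (h t) • γ t) ∧
    (∀ φ : Euc d → ℝ, Continuous φ →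
        ContinuousOn (fun t => h t * φ (γ t)) (Icc (0:ℝ) 1)) ∧
    HasAEDerivs γ h γ' h' ∧
    (∀ t, f t = h (clamp t) • (Measure.dirac (γ (clamp t))).toSignedMeasure) ∧
    (∀ s : Set (XX d), MeasurableSet s →
        m s = ∫ t in Ioo (0:ℝ) 1,
          Set.indicator {u : ℝ | (u, γ u) ∈ s} (fun u => h u • γ' u) t) ∧
    (∀ s : Set (XX d), MeasurableSet s →
        μ s = ∫ t in Ioo (0:ℝ) 1, Set.indicator {u : ℝ | (u, γ u) ∈ s} h' t) ∧
    IsPreconnected {t | t ∈ Icc (0:ℝ) 1 ∧ 0 < h t} ∧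
    JCw α β δ f m μ = 1

/-- The mollified density `ρ_t ∗ ξ_ε + ε χ_V`. -/
def mollDens (V : Set (Euc d)) (ρ : ℝ → Measure (Euc d)) (ξ : Euc d → ℝ) (ε : ℝ)
    (t : ℝ) (x : Euc d) : ℝ :=
  (∫ y, (ε ^ d)⁻¹ * ξ (ε⁻¹ • (x - y)) ∂(ρ t)) + ε * V.indicator (fun _ => (1:ℝ)) x

/-- The mollified measure `ρ_t^ε = (ρ_t ∗ ξ_ε + ε χ_V) dx`. -/
def mollRho (V : Set (Euc d)) (ρ : ℝ → Measure (Euc d)) (ξ : Euc d → ℝ) (ε : ℝ) :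
    ℝ → Measure (Euc d) :=
  fun t => volume.withDensity fun x => ENNReal.ofReal (mollDens V ρ ξ ε t x)

open Classical in
/-- The mollified velocity field `v^ε = ((v ρ_t) ∗ ξ_ε) / ρ_t^ε`. -/
def mollV (V : Set (Euc d)) (ρ : ℝ → Measure (Euc d)) (v : XX d → Euc d)
    (ξ : Euc d → ℝ) (ε : ℝ) : XX d → Euc d :=
  fun p => if mollDens V ρ ξ ε p.1 p.2 = 0 then 0 else
    (mollDens V ρ ξ ε p.1 p.2)⁻¹ •
      ∫ y, ((ε ^ d)⁻¹ * ξ (ε⁻¹ • (p.2 - y))) • v (p.1, y) ∂(ρ p.1)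

open Classical in
/-- The mollified growth field `g^ε = ((g ρ_t) ∗ ξ_ε) / ρ_t^ε`. -/
def mollG (V : Set (Euc d)) (ρ : ℝ → Measure (Euc d)) (g : XX d → ℝ)
    (ξ : Euc d → ℝ) (ε : ℝ) : XX d → ℝ :=
  fun p => if mollDens V ρ ξ ε p.1 p.2 = 0 then 0 else
    (mollDens V ρ ξ ε p.1 p.2)⁻¹ *
      ∫ y, ((ε ^ d)⁻¹ * ξ (ε⁻¹ • (p.2 - y))) * g (p.1, y) ∂(ρ p.1)


section

abbrev ZZ (d : ℕ) : Type := WithLp 2 (ℝ × Euc d)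

/-- embedding of the spatial part -/
def jZ (d : ℕ) : Euc d →L[ℝ] ZZ d :=
  ((WithLp.prodContinuousLinearEquiv 2 ℝ ℝ (Euc d)).symm : (ℝ × Euc d) →L[ℝ] ZZ d).comp
    (ContinuousLinearMap.inr ℝ ℝ (Euc d))

def fstZ (d : ℕ) : ZZ d →L[ℝ] ℝ :=
  (ContinuousLinearMap.fst ℝ ℝ (Euc d)).comp
    ((WithLp.prodContinuousLinearEquiv 2 ℝ ℝ (Euc d)) : ZZ d →L[ℝ] (ℝ × Euc d))

def sndZ (d : ℕ) : ZZ d →L[ℝ] Euc d :=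
  (ContinuousLinearMap.snd ℝ ℝ (Euc d)).comp
    ((WithLp.prodContinuousLinearEquiv 2 ℝ ℝ (Euc d)) : ZZ d →L[ℝ] (ℝ × Euc d))

def pZ (x : Euc d) : ZZ d := WithLp.toLp 2 ((1:ℝ), x)

def e0Z (d : ℕ) : ZZ d := WithLp.toLp 2 ((1:ℝ), (0 : Euc d))

/-- the spatial position of a cone point -/
def gam (z : ZZ d) : Euc d := (fstZ d z)⁻¹ • sndZ d z

def qf (w : Euc d) (ζ : ℝ) (x : Euc d) : ZZ d := (ζ / 2) • pZ x + jZ d w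

@[simp] lemma fstZ_mk (r : ℝ) (y : Euc d) : fstZ d (WithLp.toLp 2 (r, y)) = r := rfl
@[simp] lemma sndZ_mk (r : ℝ) (y : Euc d) : sndZ d (WithLp.toLp 2 (r, y)) = y := rfl
@[simp] lemma fstZ_pZ (x : Euc d) : fstZ d (pZ x) = 1 := rfl
@[simp] lemma sndZ_pZ (x : Euc d) : sndZ d (pZ x) = x := rfl
@[simp] lemma fstZ_jZ (x : Euc d) : fstZ d (jZ d x) = 0 := rfl
@[simp] lemma sndZ_jZ (x : Euc d) : sndZ d (jZ d x) = x := rfl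

lemma ZZ_ext {z z' : ZZ d} (h1 : fstZ d z = fstZ d z') (h2 : sndZ d z = sndZ d z') : z = z' := by
  apply WithLp.ofLp_injective
  exact Prod.ext h1 h2

lemma norm_sq_ZZ (z : ZZ d) : ‖z‖ ^ 2 = (fstZ d z) ^ 2 + ‖sndZ d z‖ ^ 2 := by
  have := WithLp.prod_norm_sq_eq_of_L2 z
  simpa [fstZ, sndZ] using this

lemma abs_fstZ_le (z : ZZ d) : |fstZ d z| ≤ ‖z‖ := by
  refine abs_le_of_sq_le_sq ?_ (norm_nonneg z)
  rw [norm_sq_ZZ]; nlinarith [norm_nonneg (sndZ d z)]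

lemma norm_sndZ_le (z : ZZ d) : ‖sndZ d z‖ ≤ ‖z‖ := by
  apply le_of_sq_le_sq _ (norm_nonneg z)
  rw [norm_sq_ZZ]; nlinarith [sq_nonneg (fstZ d z)]

lemma norm_jZ (x : Euc d) : ‖jZ d x‖ = ‖x‖ := by
  have := norm_sq_ZZ (jZ d x)
  simp at this
  exact this

lemma norm_pZ_sq (x : Euc d) : ‖pZ x‖ ^ 2 = 1 + ‖x‖ ^ 2 := by
  have := norm_sq_ZZ (pZ x)
  simpa using this

lemma norm_pZ_le (x : Euc d) : ‖pZ x‖ ≤ 1 + ‖x‖ := by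
  apply le_of_sq_le_sq _ (by positivity)
  rw [norm_pZ_sq]; nlinarith [norm_nonneg x]

lemma pZ_eq (x : Euc d) : pZ x = e0Z d + jZ d x := by
  apply ZZ_ext <;> simp [e0Z]

lemma continuous_pZ : Continuous (pZ : Euc d → ZZ d) := by
  have : (pZ : Euc d → ZZ d) = fun x => e0Z d + jZ d x := by ext1 x; exact pZ_eq x
  rw [this]; fun_prop

lemma pZ_sub (x y : Euc d) : pZ x - pZ y = jZ d (x - y) := by
  rw [pZ_eq, pZ_eq, map_sub]; abel

lemma qf_sub (w : Euc d) (ζ : ℝ) (x y : Euc d) : qf w ζ x - qf w ζ y = (ζ/2) • jZ d (x - y) := by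
  rw [← pZ_sub, qf, qf, smul_sub]; abel

lemma norm_qf_le (w : Euc d) (ζ : ℝ) (x : Euc d) : ‖qf w ζ x‖ ≤ |ζ| * (1 + ‖x‖) + ‖w‖ := by
  unfold qf
  refine (norm_add_le _ _).trans ?_
  rw [norm_jZ, norm_smul, Real.norm_eq_abs, abs_div, abs_two]
  have := norm_pZ_le x
  have h1 := abs_nonneg ζ
  have h2 := norm_nonneg (pZ x)
  nlinarith [norm_nonneg x, mul_le_mul_of_nonneg_left this h1, mul_nonneg h1 (norm_nonneg x), mul_nonneg h1 h2]

lemma gam_smul (r : ℝ) (hr : r ≠ 0) (x : Euc d) : gam (r • pZ x) = x := by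
  unfold gam; simp [hr]

/-- integrand of the linear functional -/
def pay (a : XX d → ℝ) (b : XX d → ZZ d) (t : ℝ) (z q : ZZ d) : ℝ :=
  (fstZ d z) ^ 2 * a (t, gam z) + fstZ d z * inner ℝ (b (t, gam z)) q

lemma pay_smul (a : XX d → ℝ) (b : XX d → ZZ d) (t : ℝ) (r : ℝ) (hr : r ≠ 0) (x : Euc d) (q : ZZ d) :
    pay a b t (r • pZ x) (r • q) = r ^ 2 * (a (t, x) + inner ℝ (b (t, x)) q) := by
  unfold pay; rw [gam_smul r hr, inner_smul_right]; simp; ring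

/-- curve with derivative `q` -/
def zc (z0 : ZZ d) (q : ℝ → ZZ d) (t : ℝ) : ZZ d := z0 + ∫ s in (0:ℝ)..t, q s

def kap (a : XX d → ℝ) (b : XX d → ZZ d) (lam : ℝ) (t : ℝ) (x w : Euc d) (ζ : ℝ) : ℝ :=
  a (t, x) + inner ℝ (b (t, x)) (qf w ζ x) - lam * ‖qf w ζ x‖ ^ 2

lemma continuous_kap {a : XX d → ℝ} {b : XX d → ZZ d} (ha : Continuous a) (hb : Continuous b) (lam : ℝ) :
    Continuous fun p : ℝ × Euc d × Euc d × ℝ => kap a b lam p.1 p.2.1 p.2.2.1 p.2.2.2 := by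
  have := continuous_pZ (d := d)
  unfold kap qf
  fun_prop

/-- one-step payoff -/
def Gst (a : XX d → ℝ) (b : XX d → ZZ d) (lam : ℝ) (t : ℝ) (x : Euc d) (τ : ℝ) (w : Euc d) (ζ : ℝ) : ℝ :=
  ∫ s in (0:ℝ)..τ, Real.exp (ζ * s) * kap a b lam (t + s) (x + s • w) w ζ

def Jst (a : XX d → ℝ) (b : XX d → ZZ d) (lam R : ℝ) : List (ℝ × Euc d × ℝ) → ℝ → Euc d → ℝ
  | [], t, x => ∫ s in t..1, a (s, x)
  | (st :: L), t, x =>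
    if 0 < st.1 ∧ t + st.1 ≤ 1 ∧ ‖x + st.1 • st.2.1‖ ≤ R then
      Gst a b lam t x st.1 st.2.1 st.2.2 +
        Real.exp (st.2.2 * st.1) * Jst a b lam R L (t + st.1) (x + st.1 • st.2.1)
    else ∫ s in t..1, a (s, x)

def seg (t r ζ : ℝ) (x w : Euc d) (s : ℝ) : ZZ d :=
  (r * Real.exp (ζ / 2 * (s - t))) • pZ (x + (s - t) • w)

def segd (t r ζ : ℝ) (x w : Euc d) (s : ℝ) : ZZ d :=
  (r * Real.exp (ζ / 2 * (s - t))) • qf w ζ (x + (s - t) • w)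

lemma continuous_segd (t r ζ : ℝ) (x w : Euc d) : Continuous (segd t r ζ x w) := by
  have := continuous_pZ (d := d)
  unfold segd qf
  fun_prop

lemma hasDerivAt_seg (t r ζ : ℝ) (x w : Euc d) (s : ℝ) :
    HasDerivAt (seg t r ζ x w) (segd t r ζ x w s) s := by
  have h1 : HasDerivAt (fun s => r * Real.exp (ζ / 2 * (s - t)))
      (r * (Real.exp (ζ / 2 * (s - t)) * (ζ / 2 * 1))) s :=
    ((((hasDerivAt_id s).sub_const t).const_mul (ζ/2)).exp).const_mul r
  have h2 : HasDerivAt (fun s => x + (s - t) • w) ((1:ℝ) • w) s :=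
    (((hasDerivAt_id s).sub_const t).smul_const w).const_add x
  have h3 : HasDerivAt (fun s => pZ (x + (s - t) • w)) (jZ d ((1:ℝ) • w)) s := by
    have : (fun s => pZ (x + (s - t) • w)) = fun s => e0Z d + jZ d (x + (s - t) • w) := by
      ext1 s; exact pZ_eq _
    rw [this]
    exact (((jZ d).hasFDerivAt).comp_hasDerivAt s h2).const_add _
  have := h1.smul h3
  refine this.congr_deriv ?_
  unfold segd qf
  rw [smul_add, smul_smul, one_smul, add_comm]
  congr 2
  ring

end

section

def InCone (R : ℝ) (z : ZZ d) : Prop := ‖sndZ d z‖ ≤ R * fstZ d z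

/-- hypothesis on curves -/
def CurveHyp (a : XX d → ℝ) (b : XX d → ZZ d) (lam R : ℝ) : Prop :=
  ∀ (z0 : ZZ d) (q : ℝ → ZZ d), Measurable q → (∃ C, ∀ t, ‖q t‖ ≤ C) →
    (∀ t ∈ Icc (0:ℝ) 1, InCone R (zc z0 q t)) →
    ∫ t in (0:ℝ)..1, pay a b t (zc z0 q t) (q t) ≤
      lam * (‖z0‖ ^ 2 + ∫ t in (0:ℝ)..1, ‖q t‖ ^ 2)

lemma measurable_gam : Measurable (gam : ZZ d → Euc d) := by
  unfold gam
  exact ((fstZ d).measurable.inv).smul (sndZ d).measurable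

lemma ii_of_bdd {F : Type*} [NormedAddCommGroup F] [MeasurableSpace F] [BorelSpace F]
    [SecondCountableTopology F] {f : ℝ → F} (hf : Measurable f) {C s t : ℝ}
    (hC : ∀ x ∈ uIoc s t, ‖f x‖ ≤ C) : IntervalIntegrable f volume s t := by
  rw [intervalIntegrable_iff]
  refine Integrable.mono' (g := fun _ => C) ?_ hf.aestronglyMeasurable ?_
  · exact (integrableOn_const (by simp))
  · exact (ae_restrict_iff' measurableSet_uIoc).2 (ae_of_all _ hC)

lemma ii_q {q : ℝ → ZZ d} (hq : Measurable q) (hqb : ∃ C, ∀ t, ‖q t‖ ≤ C) (s t : ℝ) :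
    IntervalIntegrable q volume s t := by
  obtain ⟨C, hC⟩ := hqb
  exact ii_of_bdd hq (fun x _ => hC x)

lemma ii_q2 {q : ℝ → ZZ d} (hq : Measurable q) (hqb : ∃ C, ∀ t, ‖q t‖ ≤ C) (s t : ℝ) :
    IntervalIntegrable (fun x => ‖q x‖ ^ 2) volume s t := by
  obtain ⟨C, hC⟩ := hqb
  refine ii_of_bdd (C := C ^ 2) (hq.norm.pow_const 2) (fun x _ => ?_)
  rw [Real.norm_of_nonneg (by positivity)]
  exact pow_le_pow_left₀ (norm_nonneg _) (hC x) 2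

lemma continuous_zc {z0 : ZZ d} {q : ℝ → ZZ d} (hq : Measurable q) (hqb : ∃ C, ∀ t, ‖q t‖ ≤ C) :
    Continuous (zc z0 q) := by
  unfold zc
  exact continuous_const.add (intervalIntegral.continuous_primitive (fun s t => ii_q hq hqb s t) 0)

lemma measurable_pay {a : XX d → ℝ} {b : XX d → ZZ d} (ha : Continuous a) (hb : Continuous b)
    {z q : ℝ → ZZ d} (hz : Measurable z) (hq : Measurable q) :
    Measurable fun s => pay a b s (z s) (q s) := by
  unfold pay
  have h1 : Measurable fun s => (s, gam (z s)) := measurable_id.prodMk (measurable_gam.comp hz)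
  have h2 := (fstZ d).measurable.comp hz
  exact ((h2.pow_const 2).mul (ha.measurable.comp h1)).add
    (h2.mul ((hb.measurable.comp h1).inner hq))

lemma abs_pay_le {a : XX d → ℝ} {b : XX d → ZZ d} {C : ℝ} (hC : ∀ p, |a p| ≤ C) (hC' : ∀ p, ‖b p‖ ≤ C)
    (t : ℝ) (z q : ZZ d) : |pay a b t z q| ≤ C * (‖z‖ ^ 2 + ‖z‖ * ‖q‖) := by
  unfold pay
  have hC0 : 0 ≤ C := (abs_nonneg _).trans (hC (t, gam z))
  have h1 := abs_fstZ_le z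
  refine (abs_add_le _ _).trans ?_
  rw [abs_mul, abs_mul, mul_add, abs_pow]
  have h2 : |inner ℝ (b (t, gam z)) q| ≤ C * ‖q‖ :=
    (abs_real_inner_le_norm _ _).trans (mul_le_mul_of_nonneg_right (hC' _) (norm_nonneg _))
  have h3 : |fstZ d z| ^ 2 ≤ ‖z‖ ^ 2 := pow_le_pow_left₀ (abs_nonneg _) h1 2
  have e1 : |fstZ d z| ^ 2 * |a (t, gam z)| ≤ ‖z‖ ^ 2 * C :=
    mul_le_mul h3 (hC _) (abs_nonneg _) (by positivity)
  have e2 : |fstZ d z| * |inner ℝ (b (t, gam z)) q| ≤ ‖z‖ * (C * ‖q‖) :=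
    mul_le_mul h1 h2 (abs_nonneg _) (by positivity)
  linarith

lemma ii_pay {a : XX d → ℝ} {b : XX d → ZZ d} (ha : Continuous a) (hb : Continuous b)
    {C : ℝ} (hC : ∀ p, |a p| ≤ C) (hC' : ∀ p, ‖b p‖ ≤ C) {z0 : ZZ d} {q : ℝ → ZZ d}
    (hq : Measurable q) (hqb : ∃ C, ∀ t, ‖q t‖ ≤ C) (s t : ℝ) :
    IntervalIntegrable (fun s => pay a b s (zc z0 q s) (q s)) volume s t := by
  have hz := continuous_zc (z0 := z0) hq hqb
  obtain ⟨Cq, hCq⟩ := hqb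
  obtain ⟨Cz, hCz⟩ := (isCompact_uIcc (a := s) (b := t)).exists_bound_of_continuousOn hz.continuousOn
  have hC0 : 0 ≤ C := (abs_nonneg _).trans (hC (t, 0))
  refine ii_of_bdd (C := C * (Cz ^ 2 + Cz * Cq)) (measurable_pay ha hb hz.measurable hq) (fun x hx => ?_)
  have h1 := hCz x (uIoc_subset_uIcc hx)
  have h2 := hCq x
  refine (abs_pay_le hC hC' x _ _).trans (mul_le_mul_of_nonneg_left ?_ hC0)
  have h0 := norm_nonneg (zc z0 q x)
  have hCz0 : 0 ≤ Cz := h0.trans h1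
  gcongr

lemma zc_after {z0 : ZZ d} {q : ℝ → ZZ d} (hq : Measurable q) (hqb : ∃ C, ∀ t, ‖q t‖ ≤ C)
    {t s : ℝ} (hts : t ≤ s) (h0 : ∀ s, t < s → q s = 0) : zc z0 q s = zc z0 q t := by
  unfold zc
  rw [← intervalIntegral.integral_add_adjacent_intervals (ii_q hq hqb 0 t) (ii_q hq hqb t s)]
  have : ∫ x in t..s, q x = 0 := by
    rw [intervalIntegral.integral_of_le hts]
    rw [setIntegral_congr_fun (g := fun _ => (0 : ZZ d)) measurableSet_Ioc (fun x hx => h0 x hx.1)]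
    simp
  rw [this, add_zero]

lemma J_base {a : XX d → ℝ} {b : XX d → ZZ d} (ha : Continuous a) (hb : Continuous b)
    {C : ℝ} (hC : ∀ p, |a p| ≤ C) (hC' : ∀ p, ‖b p‖ ≤ C) {lam R : ℝ}
    (hcurve : CurveHyp a b lam R) {t : ℝ} (ht : t ∈ Icc (0:ℝ) 1) {z0 : ZZ d} {q : ℝ → ZZ d}
    (hq : Measurable q) (hqb : ∃ C, ∀ t, ‖q t‖ ≤ C) (h0 : ∀ s, t < s → q s = 0)
    (hcone : ∀ t ∈ Icc (0:ℝ) 1, InCone R (zc z0 q t)) {r : ℝ} {x : Euc d} (hr : 0 < r)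
    (hzt : zc z0 q t = r • pZ x) :
    (∫ s in (0:ℝ)..t, (pay a b s (zc z0 q s) (q s) - lam * ‖q s‖ ^ 2)) - lam * ‖z0‖ ^ 2
      + r ^ 2 * (∫ s in t..1, a (s, x)) ≤ 0 := by
  have h := hcurve z0 q hq hqb hcone
  have e1 := intervalIntegral.integral_add_adjacent_intervals
    (ii_pay ha hb hC hC' (z0 := z0) hq hqb 0 t) (ii_pay ha hb hC hC' (z0 := z0) hq hqb t 1)
  have e2 := intervalIntegral.integral_add_adjacent_intervals (ii_q2 hq hqb 0 t) (ii_q2 hq hqb t 1)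
  have e3 : ∫ s in t..1, pay a b s (zc z0 q s) (q s) = r ^ 2 * ∫ s in t..1, a (s, x) := by
    rw [← intervalIntegral.integral_const_mul, intervalIntegral.integral_of_le ht.2,
      intervalIntegral.integral_of_le ht.2]
    refine setIntegral_congr_fun measurableSet_Ioc (fun s hs => ?_)
    show pay a b s (zc z0 q s) (q s) = r ^ 2 * a (s, x)
    rw [zc_after hq hqb hs.1.le h0, hzt, h0 s hs.1]
    have := pay_smul a b s r hr.ne' x 0
    simpa using this
  have e4 : ∫ s in t..1, ‖q s‖ ^ 2 = 0 := by
    rw [intervalIntegral.integral_of_le ht.2]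
    rw [setIntegral_congr_fun (g := fun _ => (0 : ℝ)) measurableSet_Ioc
      (fun s hs => by simp [h0 s hs.1])]
    simp
  rw [intervalIntegral.integral_sub (ii_pay ha hb hC hC' hq hqb 0 t) ((ii_q2 hq hqb 0 t).const_mul lam),
    intervalIntegral.integral_const_mul, ← e3]
  rw [← e1, ← e2, e4] at h
  linarith

def qext (q : ℝ → ZZ d) (t τ r ζ : ℝ) (x w : Euc d) (s : ℝ) : ZZ d :=
  if s ≤ t then q s else if s ≤ t + τ then segd t r ζ x w s else 0

lemma zc_congr {z0 : ZZ d} {q q' : ℝ → ZZ d} {t : ℝ} (ht : 0 ≤ t) (h : ∀ s ≤ t, q s = q' s) :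
    zc z0 q t = zc z0 q' t := by
  unfold zc
  congr 1
  rw [intervalIntegral.integral_of_le ht, intervalIntegral.integral_of_le ht]
  exact setIntegral_congr_fun measurableSet_Ioc (fun s hs => h s hs.2)

lemma J_bound {a : XX d → ℝ} {b : XX d → ZZ d} (ha : Continuous a) (hb : Continuous b)
    {C : ℝ} (hC : ∀ p, |a p| ≤ C) (hC' : ∀ p, ‖b p‖ ≤ C) {lam R : ℝ}
    (hcurve : CurveHyp a b lam R) (L : List (ℝ × Euc d × ℝ)) :
    ∀ {t : ℝ} (_ : t ∈ Icc (0:ℝ) 1) {z0 : ZZ d} {q : ℝ → ZZ d}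
    (_ : Measurable q) (_ : ∃ C, ∀ t, ‖q t‖ ≤ C) (_ : ∀ s, t < s → q s = 0)
    (_ : ∀ t ∈ Icc (0:ℝ) 1, InCone R (zc z0 q t)) {r : ℝ} {x : Euc d} (_ : 0 < r) (_ : ‖x‖ ≤ R)
    (_ : zc z0 q t = r • pZ x),
    (∫ s in (0:ℝ)..t, (pay a b s (zc z0 q s) (q s) - lam * ‖q s‖ ^ 2)) - lam * ‖z0‖ ^ 2
      + r ^ 2 * Jst a b lam R L t x ≤ 0 := by
  induction L with
  | nil =>
    intro t ht z0 q hq hqb h0 hcone r x hr hx hzt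
    exact J_base ha hb hC hC' hcurve ht hq hqb h0 hcone hr hzt
  | cons st L ih =>
    intro t ht z0 q hq hqb h0 hcone r x hr hx hzt
    unfold Jst
    split_ifs with hadm
    swap
    · exact J_base ha hb hC hC' hcurve ht hq hqb h0 hcone hr hzt
    obtain ⟨τ, w, ζ⟩ := st
    obtain ⟨hτ, ht1, hxw⟩ := hadm
    simp only at hτ ht1 hxw ⊢
    set q' := qext q t τ r ζ x w with hq'
    have hsegc := continuous_segd t r ζ x w
    have hq'm : Measurable q' := by
      refine Measurable.ite measurableSet_Iic hq (Measurable.ite measurableSet_Iic hsegc.measurable measurable_const)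
    have hq'b : ∃ C, ∀ t, ‖q' t‖ ≤ C := by
      obtain ⟨C1, h1⟩ := hqb
      obtain ⟨C2, h2⟩ := (isCompact_Icc (a := t) (b := t + τ)).exists_bound_of_continuousOn hsegc.continuousOn
      refine ⟨max C1 (max C2 0), fun s => ?_⟩
      rw [hq']; unfold qext
      split_ifs with c1 c2
      · exact (h1 s).trans (le_max_left _ _)
      · exact (h2 s ⟨(not_le.1 c1).le, c2⟩).trans ((le_max_left _ _).trans (le_max_right _ _))
      · rw [norm_zero]; exact (le_max_right _ _).trans (le_max_right _ _)
    have hq'0 : ∀ s, t + τ < s → q' s = 0 := by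
      intro s hs
      rw [hq']; unfold qext
      rw [if_neg (by linarith), if_neg (by linarith)]
    have hz1 : ∀ s, 0 ≤ s → s ≤ t → zc z0 q' s = zc z0 q s := by
      intro s hs0 hs
      refine zc_congr hs0 (fun u hu => ?_)
      rw [hq']; unfold qext
      rw [if_pos (hu.trans hs)]
    have hz2 : ∀ s, t ≤ s → s ≤ t + τ → zc z0 q' s = seg t r ζ x w s := by
      intro s hs0 hs
      have e1 : zc z0 q' s = zc z0 q' t + ∫ u in t..s, q' u := by
        unfold zc
        rw [add_assoc, intervalIntegral.integral_add_adjacent_intervals (ii_q hq'm hq'b 0 t) (ii_q hq'm hq'b t s)]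
      have e2 : ∫ u in t..s, q' u = ∫ u in t..s, segd t r ζ x w u := by
        rw [intervalIntegral.integral_of_le hs0, intervalIntegral.integral_of_le hs0]
        refine setIntegral_congr_fun measurableSet_Ioc (fun u hu => ?_)
        show q' u = _
        rw [hq']; unfold qext
        rw [if_neg (by linarith [hu.1]), if_pos (hu.2.trans hs)]
      have e3 : ∫ u in t..s, segd t r ζ x w u = seg t r ζ x w s - seg t r ζ x w t :=
        intervalIntegral.integral_eq_sub_of_hasDerivAt (fun u _ => hasDerivAt_seg t r ζ x w u)
          (hsegc.intervalIntegrable _ _)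
      have e4 : seg t r ζ x w t = r • pZ x := by simp [seg]
      rw [e1, e2, e3, hz1 t ht.1 le_rfl, hzt, e4]; abel
    have hzend : zc z0 q' (t + τ) = (r * Real.exp (ζ / 2 * τ)) • pZ (x + τ • w) := by
      rw [hz2 (t + τ) (by linarith) le_rfl]; simp [seg]
    have hcone' : ∀ s ∈ Icc (0:ℝ) 1, InCone R (zc z0 q' s) := by
      intro s hs
      have hsegcone : ∀ s, t ≤ s → s ≤ t + τ → InCone R (seg t r ζ x w s) := by
        intro s h1 h2
        unfold InCone seg
        have hpos : 0 < r * Real.exp (ζ / 2 * (s - t)) := by positivity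
        have hcv : ‖x + (s - t) • w‖ ≤ R := by
          have hconv := (convex_closedBall (0 : Euc d) R)
          have m1 : x ∈ Metric.closedBall (0 : Euc d) R := by simpa using hx
          have m2 : x + τ • w ∈ Metric.closedBall (0 : Euc d) R := by simpa using hxw
          have hq1 : 0 ≤ (s - t) / τ := div_nonneg (by linarith) hτ.le
          have hq2 : (s - t) / τ ≤ 1 := (div_le_one hτ).2 (by linarith)
          have := hconv m1 m2 (a := 1 - (s - t) / τ) (b := (s - t) / τ) (by linarith) hq1 (by ring)
          have e : (1 - (s - t) / τ) • x + ((s - t) / τ) • (x + τ • w) = x + (s - t) • w := by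
            rw [smul_add, smul_smul, div_mul_cancel₀ _ hτ.ne', sub_smul, one_smul]; abel
          rw [e] at this; simpa using this
        rw [map_smul, map_smul, sndZ_pZ, fstZ_pZ, norm_smul, Real.norm_of_nonneg hpos.le, smul_eq_mul, mul_one]
        nlinarith
      rcases le_total s t with h | h
      · rw [hz1 s hs.1 h]; exact hcone s hs
      · rcases le_total s (t + τ) with h' | h'
        · rw [hz2 s h h']; exact hsegcone s h h'
        · rw [zc_after hq'm hq'b h' hq'0, hz2 (t + τ) (by linarith) le_rfl]
          exact hsegcone _ (by linarith) le_rfl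
    have key := ih (t := t + τ) ⟨by linarith [ht.1], ht1⟩ hq'm hq'b hq'0 hcone'
      (r := r * Real.exp (ζ / 2 * τ)) (x := x + τ • w) (by positivity) hxw hzend
    have hii : ∀ s1 s2, IntervalIntegrable
        (fun s => pay a b s (zc z0 q' s) (q' s) - lam * ‖q' s‖ ^ 2) volume s1 s2 := fun s1 s2 =>
      (ii_pay ha hb hC hC' hq'm hq'b s1 s2).sub ((ii_q2 hq'm hq'b s1 s2).const_mul lam)
    rw [← intervalIntegral.integral_add_adjacent_intervals (hii 0 t) (hii t (t + τ))] at key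
    have f1 : (∫ s in (0:ℝ)..t, (pay a b s (zc z0 q' s) (q' s) - lam * ‖q' s‖ ^ 2)) =
        ∫ s in (0:ℝ)..t, (pay a b s (zc z0 q s) (q s) - lam * ‖q s‖ ^ 2) := by
      rw [intervalIntegral.integral_of_le ht.1, intervalIntegral.integral_of_le ht.1]
      refine setIntegral_congr_fun measurableSet_Ioc (fun u hu => ?_)
      have : q' u = q u := by rw [hq']; unfold qext; rw [if_pos hu.2]
      simp only [this, hz1 u hu.1.le hu.2]
    have f2 : (∫ s in t..(t + τ), (pay a b s (zc z0 q' s) (q' s) - lam * ‖q' s‖ ^ 2)) =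
        r ^ 2 * Gst a b lam t x τ w ζ := by
      have g1 : (∫ s in t..(t + τ), (pay a b s (zc z0 q' s) (q' s) - lam * ‖q' s‖ ^ 2)) =
          ∫ s in t..(t + τ), r ^ 2 * (Real.exp (ζ * (s - t)) * kap a b lam s (x + (s - t) • w) w ζ) := by
        rw [intervalIntegral.integral_of_le (by linarith), intervalIntegral.integral_of_le (by linarith)]
        refine setIntegral_congr_fun measurableSet_Ioc (fun u hu => ?_)
        have : q' u = segd t r ζ x w u := by
          rw [hq']; unfold qext; rw [if_neg (by linarith [hu.1]), if_pos hu.2]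
        simp only [this, hz2 u hu.1.le hu.2]
        have hpos : 0 < r * Real.exp (ζ / 2 * (u - t)) := by positivity
        have hexp : (Real.exp (ζ / 2 * (u - t))) ^ 2 = Real.exp (ζ * (u - t)) := by
          rw [← Real.exp_nat_mul]; congr 1; push_cast; ring
        unfold seg segd
        rw [pay_smul _ _ _ _ hpos.ne', norm_smul, Real.norm_of_nonneg hpos.le]
        simp only [mul_pow, hexp]
        unfold kap
        ring
      rw [g1, intervalIntegral.integral_const_mul]
      unfold Gst
      congr 1
      have := intervalIntegral.integral_comp_add_right
        (a := 0) (b := τ) (fun s => Real.exp (ζ * (s - t)) * kap a b lam s (x + (s - t) • w) w ζ) t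
      rw [zero_add, add_comm τ t] at this
      rw [← this]
      congr 1; ext s
      simp only [add_sub_cancel_right]
      rw [add_comm s t]
    rw [f1, f2] at key
    have hexp2 : (r * Real.exp (ζ / 2 * τ)) ^ 2 = r ^ 2 * Real.exp (ζ * τ) := by
      rw [mul_pow, ← Real.exp_nat_mul]; congr 2; push_cast; ring
    rw [hexp2] at key
    linarith

end

section

lemma continuous_tail {a : XX d → ℝ} (ha : Continuous a) :
    Continuous fun p : XX d => ∫ s in p.1..1, a (s, p.2) := by
  have h := intervalIntegral.continuous_parametric_intervalIntegral_of_continuous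
    (μ := volume) (f := fun (p : XX d) (s : ℝ) => a (s, p.2)) (a₀ := 1)
    (by unfold Function.uncurry; fun_prop) (s := fun p : XX d => p.1) continuous_fst
  have e : (fun p : XX d => ∫ s in p.1..1, a (s, p.2)) = fun p => - ∫ s in (1:ℝ)..p.1, a (s, p.2) := by
    ext p; exact intervalIntegral.integral_symm _ _
  rw [e]; exact h.neg

lemma continuous_Gst {a : XX d → ℝ} {b : XX d → ZZ d} (ha : Continuous a) (hb : Continuous b)
    (lam τ : ℝ) (w : Euc d) (ζ : ℝ) : Continuous fun p : XX d => Gst a b lam p.1 p.2 τ w ζ := by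
  unfold Gst
  refine intervalIntegral.continuous_parametric_intervalIntegral_of_continuous' ?_ _ _
  have := continuous_kap ha hb lam
  unfold Function.uncurry
  have h2 : Continuous fun p : XX d × ℝ => kap a b lam (p.1.1 + p.2) (p.1.2 + p.2 • w) w ζ :=
    this.comp (by fun_prop : Continuous fun p : XX d × ℝ => ((p.1.1 + p.2), (p.1.2 + p.2 • w), w, ζ))
  fun_prop

lemma measurable_Jst {a : XX d → ℝ} {b : XX d → ZZ d} (ha : Continuous a) (hb : Continuous b)
    (lam R : ℝ) (L : List (ℝ × Euc d × ℝ)) : Measurable fun p : XX d => Jst a b lam R L p.1 p.2 := by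
  induction L with
  | nil => exact (continuous_tail ha).measurable
  | cons st L ih =>
    unfold Jst
    refine Measurable.ite ?_ ?_ (continuous_tail ha).measurable
    · have h2 : MeasurableSet {p : XX d | p.1 + st.1 ≤ 1} :=
        (isClosed_le (by fun_prop) (by fun_prop)).measurableSet
      have h3 : MeasurableSet {p : XX d | ‖p.2 + st.1 • st.2.1‖ ≤ R} :=
        (isClosed_le (by fun_prop) (by fun_prop)).measurableSet
      exact (MeasurableSet.const _).inter (h2.inter h3)
    · refine (continuous_Gst ha hb _ _ _ _).measurable.add (measurable_const.mul ?_)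
      exact ih.comp (by fun_prop : Measurable fun p : XX d => (p.1 + st.1, p.2 + st.1 • st.2.1))

lemma J_le {a : XX d → ℝ} {b : XX d → ZZ d} (ha : Continuous a) (hb : Continuous b)
    {C : ℝ} (hC : ∀ p, |a p| ≤ C) (hC' : ∀ p, ‖b p‖ ≤ C) {lam R : ℝ}
    (hcurve : CurveHyp a b lam R) (L : List (ℝ × Euc d × ℝ)) {t : ℝ} (ht : t ∈ Icc (0:ℝ) 1)
    {x : Euc d} (hx : ‖x‖ ≤ R) : Jst a b lam R L t x ≤ C * t + lam * ‖pZ x‖ ^ 2 := by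
  have hz : ∀ s, zc (pZ x) (fun _ => (0 : ZZ d)) s = pZ x := by intro s; simp [zc]
  have h := J_bound ha hb hC hC' hcurve L ht (z0 := pZ x) (q := fun _ => 0) measurable_const
    ⟨0, by simp⟩ (by simp) (by intro s _; rw [hz]; simpa [InCone] using hx) (r := 1) (x := x)
    one_pos hx (by rw [hz, one_smul])
  simp only [hz] at h
  have h1 : |∫ s in (0:ℝ)..t, (pay a b s (pZ x) 0 - lam * ‖(0 : ZZ d)‖ ^ 2)| ≤ C * |t - 0| := by
    rw [← Real.norm_eq_abs]
    refine intervalIntegral.norm_integral_le_of_norm_le_const (fun s _ => ?_)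
    have := pay_smul a b s 1 one_ne_zero x 0
    simp only [one_smul, one_pow, one_mul, inner_zero_right, add_zero] at this
    rw [this]; simpa using hC _
  rw [sub_zero, abs_of_nonneg ht.1] at h1
  have := (abs_le.1 h1).1
  linarith

lemma le_tail {a : XX d → ℝ} {C : ℝ} (hC : ∀ p, |a p| ≤ C) {t : ℝ} (ht : t ≤ 1)
    (x : Euc d) : - (C * (1 - t)) ≤ ∫ s in t..1, a (s, x) := by
  have h1 : |∫ s in t..1, a (s, x)| ≤ C * |1 - t| := by
    rw [← Real.norm_eq_abs]
    exact intervalIntegral.norm_integral_le_of_norm_le_const (fun s _ => hC _)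
  rw [abs_of_nonneg (sub_nonneg.2 ht)] at h1
  exact (abs_le.1 h1).1

def stepOf (p : ℕ × ℕ × ℕ) : ℝ × Euc d × ℝ :=
  (1 / ((p.1 : ℝ) + 1), TopologicalSpace.denseSeq (Euc d) p.2.1, TopologicalSpace.denseSeq ℝ p.2.2)

open Classical in
/-- value function -/
def UU (a : XX d → ℝ) (b : XX d → ZZ d) (lam R : ℝ) (p : XX d) : ℝ :=
  if p.1 ∈ Icc (0:ℝ) 1 ∧ ‖p.2‖ ≤ R then
    ⨆ L : List (ℕ × ℕ × ℕ), Jst a b lam R (L.map stepOf) p.1 p.2 else 0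

lemma measurableSet_dom (R : ℝ) : MeasurableSet {p : XX d | p.1 ∈ Icc (0:ℝ) 1 ∧ ‖p.2‖ ≤ R} := by
  have h3 : MeasurableSet {p : XX d | ‖p.2‖ ≤ R} :=
    (isClosed_le (by fun_prop) (by fun_prop)).measurableSet
  exact (measurable_fst measurableSet_Icc).inter h3

lemma measurable_UU {a : XX d → ℝ} {b : XX d → ZZ d} (ha : Continuous a) (hb : Continuous b)
    (lam R : ℝ) : Measurable (UU a b lam R) := by
  unfold UU
  refine Measurable.ite (measurableSet_dom R) ?_ measurable_const
  exact Measurable.iSup (fun L => measurable_Jst ha hb lam R _)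

lemma UU_bdd {a : XX d → ℝ} {b : XX d → ZZ d} (ha : Continuous a) (hb : Continuous b)
    {C : ℝ} (hC : ∀ p, |a p| ≤ C) (hC' : ∀ p, ‖b p‖ ≤ C) {lam R : ℝ}
    (hcurve : CurveHyp a b lam R) {t : ℝ} (ht : t ∈ Icc (0:ℝ) 1) {x : Euc d} (hx : ‖x‖ ≤ R) :
    BddAbove (range fun L : List (ℕ × ℕ × ℕ) => Jst a b lam R (L.map stepOf) t x) := by
  refine ⟨C * t + lam * ‖pZ x‖ ^ 2, ?_⟩
  rintro _ ⟨L, rfl⟩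
  exact J_le ha hb hC hC' hcurve _ ht hx

lemma UU_le {a : XX d → ℝ} {b : XX d → ZZ d} (ha : Continuous a) (hb : Continuous b)
    {C : ℝ} (hC : ∀ p, |a p| ≤ C) (hC' : ∀ p, ‖b p‖ ≤ C) {lam R : ℝ}
    (hcurve : CurveHyp a b lam R) {t : ℝ} (ht : t ∈ Icc (0:ℝ) 1) {x : Euc d} (hx : ‖x‖ ≤ R) :
    UU a b lam R (t, x) ≤ C * t + lam * ‖pZ x‖ ^ 2 := by
  unfold UU
  rw [if_pos ⟨ht, hx⟩]
  exact ciSup_le (fun L => J_le ha hb hC hC' hcurve _ ht hx)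

lemma le_UU {a : XX d → ℝ} {b : XX d → ZZ d} (ha : Continuous a) (hb : Continuous b)
    {C : ℝ} (hC : ∀ p, |a p| ≤ C) (hC' : ∀ p, ‖b p‖ ≤ C) {lam R : ℝ}
    (hcurve : CurveHyp a b lam R) {t : ℝ} (ht : t ∈ Icc (0:ℝ) 1) {x : Euc d} (hx : ‖x‖ ≤ R) :
    - (C * (1 - t)) ≤ UU a b lam R (t, x) := by
  unfold UU
  rw [if_pos ⟨ht, hx⟩]
  refine (le_tail hC ht.2 x).trans ?_
  exact le_ciSup (UU_bdd ha hb hC hC' hcurve ht hx) []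

lemma UU_dp {a : XX d → ℝ} {b : XX d → ZZ d} (ha : Continuous a) (hb : Continuous b)
    {C : ℝ} (hC : ∀ p, |a p| ≤ C) (hC' : ∀ p, ‖b p‖ ≤ C) {lam R : ℝ}
    (hcurve : CurveHyp a b lam R) {t : ℝ} (ht : t ∈ Icc (0:ℝ) 1) {x : Euc d} (hx : ‖x‖ ≤ R) (n i j : ℕ)
    {τ : ℝ} {w : Euc d} {ζ : ℝ} (hs : stepOf (n, i, j) = (τ, w, ζ)) (h1 : t + τ ≤ 1)
    (h2 : ‖x + τ • w‖ ≤ R) :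
    Gst a b lam t x τ w ζ + Real.exp (ζ * τ) * UU a b lam R (t + τ, x + τ • w) ≤ UU a b lam R (t, x) := by
  have hτ : 0 < τ := by
    have : τ = 1 / ((n : ℝ) + 1) := by
      have := congrArg Prod.fst hs; exact this.symm
    rw [this]; positivity
  have ht' : t + τ ∈ Icc (0:ℝ) 1 := ⟨by linarith [ht.1], h1⟩
  have e : UU a b lam R (t + τ, x + τ • w) =
    ⨆ L : List (ℕ × ℕ × ℕ), Jst a b lam R (L.map stepOf) (t + τ) (x + τ • w) := by
    unfold UU; rw [if_pos ⟨ht', h2⟩]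
  have e' : UU a b lam R (t, x) = ⨆ L : List (ℕ × ℕ × ℕ), Jst a b lam R (L.map stepOf) t x := by
    unfold UU; rw [if_pos ⟨ht, hx⟩]
  rw [e, ← le_sub_iff_add_le', ← le_div_iff₀' (Real.exp_pos _)]
  refine ciSup_le (fun L => ?_)
  rw [le_div_iff₀' (Real.exp_pos _), le_sub_iff_add_le', e']
  refine le_trans (le_of_eq ?_) (le_ciSup (UU_bdd ha hb hC hC' hcurve ht hx) ((n, i, j) :: L))
  simp only [List.map_cons, hs]
  rw [Jst, if_pos ⟨hτ, h1, h2⟩]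

lemma UU_abs_le {a : XX d → ℝ} {b : XX d → ZZ d} (ha : Continuous a) (hb : Continuous b)
    {C : ℝ} (hC : ∀ p, |a p| ≤ C) (hC' : ∀ p, ‖b p‖ ≤ C) {lam R : ℝ}
    (hcurve : CurveHyp a b lam R) (hlam : 0 ≤ lam) : ∃ D, 0 ≤ D ∧ ∀ p : XX d, |UU a b lam R p| ≤ D := by
  have hC0 : 0 ≤ C := (abs_nonneg _).trans (hC (0, 0))
  refine ⟨C + lam * (1 + R ^ 2), by positivity, fun p => ?_⟩
  by_cases h : p.1 ∈ Icc (0:ℝ) 1 ∧ ‖p.2‖ ≤ R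
  · have h1 := UU_le ha hb hC hC' hcurve h.1 h.2
    have h2 := le_UU ha hb hC hC' hcurve h.1 h.2
    rw [norm_pZ_sq] at h1
    have h3 : ‖p.2‖ ^ 2 ≤ R ^ 2 := pow_le_pow_left₀ (norm_nonneg _) h.2 2
    have h4 : lam * (1 + ‖p.2‖ ^ 2) ≤ lam * (1 + R ^ 2) := by gcongr
    have h5 : 0 ≤ lam * (1 + R ^ 2) := by positivity
    have := h.1.1
    have := h.1.2
    rw [abs_le]; constructor <;> nlinarith
  · unfold UU; rw [if_neg h, abs_zero]; positivity

end

section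

instance instHaarXX : Measure.IsAddHaarMeasure (volume : Measure (XX d)) := by
  have : (volume : Measure (XX d)) = (volume : Measure ℝ).prod (volume : Measure (Euc d)) := rfl
  rw [this]; infer_instance

lemma kap_sub {a : XX d → ℝ} {b : XX d → ZZ d} {C : ℝ} (hC' : ∀ p, ‖b p‖ ≤ C) {lam R ω : ℝ}
    (hlam : 0 ≤ lam) (hω : 0 ≤ ω) {t t' : ℝ} {x x' : Euc d} (hx : ‖x‖ ≤ R) (hx' : ‖x'‖ ≤ R)
    (h1 : |a (t', x') - a (t, x)| ≤ ω) (h2 : ‖b (t', x') - b (t, x)‖ ≤ ω) (h3 : ‖x' - x‖ ≤ ω)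
    (w : Euc d) (ζ : ℝ) :
    |kap a b lam t' x' w ζ - kap a b lam t x w ζ| ≤
      ω * (3 + R + C + lam * (2 * (2 + R))) * (1 + ‖w‖ ^ 2 + ζ ^ 2) := by
  have hR : 0 ≤ R := (norm_nonneg x).trans hx
  have hC0 : 0 ≤ C := (norm_nonneg _).trans (hC' (t, x))
  set Q := |ζ| * (1 + R) + ‖w‖ with hQ
  have hQ0 : 0 ≤ Q := by positivity
  have q1 : ‖qf w ζ x‖ ≤ Q := (norm_qf_le w ζ x).trans (by rw [hQ]; gcongr)
  have q2 : ‖qf w ζ x'‖ ≤ Q := (norm_qf_le w ζ x').trans (by rw [hQ]; gcongr)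
  have q3 : ‖qf w ζ x' - qf w ζ x‖ ≤ |ζ| * ω := by
    rw [qf_sub, norm_smul, norm_jZ, Real.norm_eq_abs, abs_div, abs_two]
    have := mul_le_mul_of_nonneg_left h3 (abs_nonneg ζ)
    have := mul_nonneg (abs_nonneg ζ) (norm_nonneg (x' - x))
    linarith
  have e1 : |inner ℝ (b (t', x')) (qf w ζ x') - inner ℝ (b (t, x)) (qf w ζ x)| ≤ ω * Q + C * (|ζ| * ω) := by
    have : inner ℝ (b (t', x')) (qf w ζ x') - inner ℝ (b (t, x)) (qf w ζ x) =
        inner ℝ (b (t', x') - b (t, x)) (qf w ζ x') + inner ℝ (b (t, x)) (qf w ζ x' - qf w ζ x) := by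
      rw [inner_sub_left, inner_sub_right]; ring
    rw [this]
    refine (abs_add_le _ _).trans (add_le_add ?_ ?_)
    · exact (abs_real_inner_le_norm _ _).trans (mul_le_mul h2 q2 (norm_nonneg _) hω)
    · exact (abs_real_inner_le_norm _ _).trans (mul_le_mul (hC' _) q3 (norm_nonneg _) hC0)
  have e2 : |‖qf w ζ x'‖ ^ 2 - ‖qf w ζ x‖ ^ 2| ≤ (|ζ| * ω) * (2 * Q) := by
    rw [sq_sub_sq, abs_mul, mul_comm]
    refine mul_le_mul ((abs_norm_sub_norm_le _ _).trans q3) ?_ (abs_nonneg _) (by positivity)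
    rw [abs_of_nonneg (by positivity)]; linarith
  have e3 : |kap a b lam t' x' w ζ - kap a b lam t x w ζ| ≤
      ω + (ω * Q + C * (|ζ| * ω)) + lam * ((|ζ| * ω) * (2 * Q)) := by
    unfold kap
    have f : ∀ A1 B1 C1 A2 B2 C2 : ℝ, A1 + B1 - lam * C1 - (A2 + B2 - lam * C2) =
      (A1 - A2) + (B1 - B2) - lam * (C1 - C2) := by intros; ring
    rw [f]
    refine (abs_sub _ _).trans (add_le_add ((abs_add_le _ _).trans (add_le_add h1 e1)) ?_)
    rw [abs_mul, abs_of_nonneg hlam]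
    exact mul_le_mul_of_nonneg_left e2 hlam
  refine e3.trans ?_
  have z1 : |ζ| ≤ 1 + ‖w‖ ^ 2 + ζ ^ 2 := by
    rw [← sq_abs ζ]; nlinarith [sq_nonneg (|ζ| - 1), sq_nonneg ‖w‖]
  have z2 : ‖w‖ ≤ 1 + ‖w‖ ^ 2 + ζ ^ 2 := by nlinarith [sq_nonneg (‖w‖ - 1), sq_nonneg ζ]
  have z3 : |ζ| * |ζ| ≤ 1 + ‖w‖ ^ 2 + ζ ^ 2 := by
    rw [← sq_abs ζ]; nlinarith [sq_nonneg ‖w‖]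
  have z4 : |ζ| * ‖w‖ ≤ 1 + ‖w‖ ^ 2 + ζ ^ 2 := by
    rw [← sq_abs ζ]; nlinarith [sq_nonneg (|ζ| - ‖w‖)]
  have z0 : 1 ≤ 1 + ‖w‖ ^ 2 + ζ ^ 2 := by nlinarith [sq_nonneg ζ, sq_nonneg ‖w‖]
  set S := 1 + ‖w‖ ^ 2 + ζ ^ 2
  have k1 : Q ≤ (2 + R) * S := by
    have := mul_le_mul_of_nonneg_right z1 (by positivity : 0 ≤ 1 + R)
    rw [hQ]; linarith
  have k2 : |ζ| * Q ≤ (2 + R) * S := by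
    have := mul_le_mul_of_nonneg_right z3 (by positivity : 0 ≤ 1 + R)
    rw [hQ]; nlinarith
  have k3 := mul_le_mul_of_nonneg_left k2 hlam
  have k4 := mul_le_mul_of_nonneg_left z1 hC0
  have : ω + (ω * Q + C * (|ζ| * ω)) + lam * ((|ζ| * ω) * (2 * Q)) =
    ω * (1 + Q + C * |ζ| + 2 * (lam * (|ζ| * Q))) := by ring
  rw [this, mul_assoc ω]
  refine mul_le_mul_of_nonneg_left ?_ hω
  nlinarith

lemma avg_ge {ε : ℝ} (f : ContDiffBump (0 : XX d)) (hf : f.rOut = ε) {F : XX d → ℝ}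
    (hF : Measurable F) {D : ℝ} (hD : ∀ p, |F p| ≤ D) {c : ℝ}
    (h : ∀ s : XX d, ‖s‖ < ε → c ≤ F s) : c ≤ ∫ s, f.normed volume s * F s := by
  have hi : Integrable (f.normed volume : XX d → ℝ) volume := f.integrable_normed
  have : c = ∫ s, f.normed volume s * c := by
    rw [integral_mul_const, f.integral_normed, one_mul]
  rw [this]
  refine integral_mono (hi.mul_const c) (hi.mul_bdd (c := D) hF.aestronglyMeasurable (ae_of_all _ hD)) ?_
  intro s
  by_cases hs : ‖s‖ < ε
  · exact mul_le_mul_of_nonneg_left (h s hs) (f.nonneg_normed s)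
  · have : f.normed volume s = 0 := by
      have : s ∉ Function.support (f.normed (volume : Measure (XX d))) := by
        rw [f.support_normed_eq, hf]; simpa using hs
      simpa using this
    simp [this]

lemma deriv_nonpos_of_seq {F : ℝ → ℝ} {c : ℝ} (hF : HasDerivAt F c 0)
    (h : ∀ᶠ n : ℕ in atTop, F (1 / ((n : ℝ) + 1)) ≤ F 0) : c ≤ 0 := by
  have h1 := hasDerivAt_iff_tendsto_slope.1 hF
  have h2 : Tendsto (fun n : ℕ => 1 / ((n : ℝ) + 1)) atTop (𝓝[≠] 0) := by
    refine tendsto_nhdsWithin_iff.2 ⟨tendsto_one_div_add_atTop_nhds_zero_nat, ?_⟩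
    exact Eventually.of_forall (fun n => by simp; positivity)
  refine le_of_tendsto (h1.comp h2) ?_
  filter_upwards [h] with n hn
  simp only [Function.comp, slope_def_field, sub_zero]
  exact div_nonpos_of_nonpos_of_nonneg (by linarith) (by positivity)

end

section

set_option maxHeartbeats 1600000 in
lemma key2 {a : XX d → ℝ} {b : XX d → ZZ d} (ha : Continuous a) (hb : Continuous b)
    {C : ℝ} (hC : ∀ p, |a p| ≤ C) (hC' : ∀ p, ‖b p‖ ≤ C) {lam R : ℝ}
    (hcurve : CurveHyp a b lam R) (hlam : 0 ≤ lam) (hR : 1 ≤ R) {δ θ : ℝ} (hδ : 0 < δ)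
    (hθ : 0 < θ) :
    ∃ u : XX d → ℝ, ContDiff ℝ (⊤ : ℕ∞) u ∧ HasCompactSupport u ∧
      ∀ t ∈ Icc δ (1 - δ), ∀ x : Euc d, ‖x‖ ≤ R - 1 →
        (u (t, x) ≤ C * t + lam * ‖pZ x‖ ^ 2 + θ) ∧ (- (C * (1 - t)) - θ ≤ u (t, x)) ∧
        ∀ w ζ, fderiv ℝ u (t, x) (1, w) + ζ * u (t, x) + kap a b lam t x w ζ ≤
          θ * (1 + ‖w‖ ^ 2 + ζ ^ 2) := by
  have hC0 : 0 ≤ C := (abs_nonneg _).trans (hC (0, 0))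
  obtain ⟨D, hD0, hD⟩ := UU_abs_le ha hb hC hC' hcurve hlam
  have hUm := measurable_UU ha hb lam R
  set M := 3 + R + C + lam * (2 * (2 + R)) with hM
  have hM0 : 0 < M := by positivity
  set ω := θ / M with hω
  have hω0 : 0 < ω := by positivity
  have hωM : ω * M = θ := div_mul_cancel₀ _ hM0.ne'
  -- uniform continuity
  have hK : IsCompact (Icc (-1:ℝ) 2 ×ˢ Metric.closedBall (0 : Euc d) R) :=
    isCompact_Icc.prod (isCompact_closedBall _ _)
  obtain ⟨ε1, hε1, hua⟩ := Metric.uniformContinuousOn_iff.1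
    (hK.uniformContinuousOn_of_continuous ha.continuousOn) ω hω0
  obtain ⟨ε2, hε2, hub⟩ := Metric.uniformContinuousOn_iff.1
    (hK.uniformContinuousOn_of_continuous hb.continuousOn) ω hω0
  set W := 1 + C + lam * (2 * R + 1) with hW
  have hW0 : 0 < W := by positivity
  obtain ⟨ε, hε, hεle⟩ : ∃ ε > 0, ε ≤ δ / 2 ∧ ε ≤ 1 / 4 ∧ 2 * ε ≤ ω ∧ 2 * ε < ε1 ∧ 2 * ε < ε2 ∧ ε * W ≤ θ := by
    refine ⟨min (δ / 2) (min (1 / 4) (min (ω / 2) (min (ε1 / 4) (min (ε2 / 4) (θ / W))))), by positivity, ?_⟩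
    refine ⟨min_le_left _ _, ?_, ?_, ?_, ?_, ?_⟩
    · exact (min_le_right _ _).trans (min_le_left _ _)
    · have := (min_le_right (δ/2) _).trans ((min_le_right (1/4) _).trans (min_le_left (ω / 2) (min (ε1 / 4) (min (ε2 / 4) (θ / W)))))
      linarith
    · have := (min_le_right (δ/2) _).trans ((min_le_right (1/4) _).trans ((min_le_right (ω / 2) _).trans (min_le_left (ε1 / 4) (min (ε2 / 4) (θ / W)))))
      linarith
    · have := (min_le_right (δ/2) _).trans ((min_le_right (1/4) _).trans ((min_le_right (ω / 2) _).trans ((min_le_right (ε1 / 4) _).trans (min_le_left (ε2 / 4) (θ / W)))))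
      linarith
    · have := (min_le_right (δ/2) _).trans ((min_le_right (1/4) _).trans ((min_le_right (ω / 2) _).trans ((min_le_right (ε1 / 4) _).trans (min_le_right (ε2 / 4) (θ / W)))))
      exact (le_div_iff₀ hW0).1 this
  obtain ⟨hεδ, hε4, hεω, hε1', hε2', hεW⟩ := hεle
  let f : ContDiffBump (0 : XX d) := ⟨ε / 2, ε, by positivity, by linarith⟩
  have hfr : f.rOut = ε := rfl
  set U := UU a b lam R with hU
  let u : XX d → ℝ := convolution (f.normed volume) U (ContinuousLinearMap.lsmul ℝ ℝ) volume
  have hu : ∀ p, u p = ∫ s, f.normed volume s * U (p - s) := fun p => rfl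
  have hUmp : ∀ p, Measurable fun s => U (p - s) := fun p => hUm.comp (measurable_const.sub measurable_id)
  have hUi : ∀ p, Integrable (fun s => f.normed volume s * U (p - s)) (volume : Measure (XX d)) := fun p =>
    (f.integrable_normed).mul_bdd (c := D) (hUmp p).aestronglyMeasurable (ae_of_all _ fun s => hD _)
  have hUsupp : HasCompactSupport U := by
    refine HasCompactSupport.intro (K := Icc (0:ℝ) 1 ×ˢ Metric.closedBall (0 : Euc d) R)
      (isCompact_Icc.prod (isCompact_closedBall _ _)) (fun p hp => ?_)
    rw [hU]; unfold UU
    rw [if_neg]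
    intro h; apply hp
    exact ⟨h.1, by simpa using h.2⟩
  have hUloc : LocallyIntegrable U volume := by
    refine (locallyIntegrable_const D).mono hUm.aestronglyMeasurable (ae_of_all _ fun p => ?_)
    rw [Real.norm_of_nonneg hD0]; exact hD p
  have hucd : ContDiff ℝ (⊤ : ℕ∞) u :=
    HasCompactSupport.contDiff_convolution_left _ f.hasCompactSupport_normed f.contDiff_normed hUloc
  refine ⟨u, hucd, HasCompactSupport.convolution _ f.hasCompactSupport_normed hUsupp, ?_⟩
  intro t ht x hx
  have hs1 : ∀ s : XX d, ‖s‖ < ε → |s.1| < ε ∧ ‖s.2‖ < ε := fun s hs =>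
    ⟨(norm_fst_le s).trans_lt hs, (norm_snd_le s).trans_lt hs⟩
  have hgood : ∀ s : XX d, ‖s‖ < ε → t - s.1 ∈ Icc (δ / 2) (1 - δ / 2) ∧ ‖x - s.2‖ ≤ R - 3 / 4 := by
    intro s hs
    obtain ⟨h1, h2⟩ := hs1 s hs
    rw [abs_lt] at h1
    refine ⟨⟨by linarith [ht.1], by linarith [ht.2]⟩, ?_⟩
    have := norm_sub_le x s.2
    linarith
  have hgood' : ∀ s : XX d, ‖s‖ < ε → t - s.1 ∈ Icc (0:ℝ) 1 ∧ ‖x - s.2‖ ≤ R := by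
    intro s hs
    obtain ⟨h1, h2⟩ := hgood s hs
    exact ⟨⟨by linarith [h1.1], by linarith [h1.2]⟩, by linarith⟩
  refine ⟨?_, ?_, ?_⟩
  · have := avg_ge f hfr (F := fun s => - U ((t, x) - s)) (hUmp _).neg (D := D)
      (fun s => by rw [abs_neg]; exact hD _) (c := - (C * t + lam * ‖pZ x‖ ^ 2 + θ)) (by
        intro s hs
        obtain ⟨g1, g2⟩ := hgood' s hs
        obtain ⟨h1, h2⟩ := hs1 s hs
        have h3 := UU_le ha hb hC hC' hcurve g1 g2
        have h4 : ‖x - s.2‖ ^ 2 ≤ ‖x‖ ^ 2 + ε * (2 * R + 1) := by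
          have := norm_sub_le x s.2
          have h5 : ‖x - s.2‖ ≤ ‖x‖ + ε := by linarith
          have h6 := pow_le_pow_left₀ (norm_nonneg _) h5 2
          nlinarith [norm_nonneg x]
        rw [norm_pZ_sq] at h3 ⊢
        rw [abs_lt] at h1
        have h7 : C * (t - s.1) ≤ C * t + C * ε := by nlinarith
        have h8 := mul_le_mul_of_nonneg_left h4 hlam
        have : U ((t, x) - s) = UU a b lam R (t - s.1, x - s.2) := rfl
        rw [this]
        rw [hW] at hεW
        nlinarith)
    simp only [mul_neg, integral_neg, ← hu] at this
    linarith
  · have := avg_ge f hfr (F := fun s => U ((t, x) - s)) (hUmp _) (D := D)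
      (fun s => hD _) (c := - (C * (1 - t)) - θ) (by
        intro s hs
        obtain ⟨g1, g2⟩ := hgood' s hs
        obtain ⟨h1, h2⟩ := hs1 s hs
        have h3 := le_UU ha hb hC hC' hcurve g1 g2
        rw [abs_lt] at h1
        have : U ((t, x) - s) = UU a b lam R (t - s.1, x - s.2) := rfl
        rw [this]
        rw [hW] at hεW
        have h9 : 0 ≤ ε * (lam * (2 * R + 1)) := by positivity
        nlinarith)
    rw [← hu] at this
    exact this
  · -- the differential inequality
    have hdense : ∀ i j : ℕ, ∀ w ζ, w = TopologicalSpace.denseSeq (Euc d) i →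
        ζ = TopologicalSpace.denseSeq ℝ j →
        fderiv ℝ u (t, x) (1, w) + ζ * u (t, x) + kap a b lam t x w ζ ≤
          θ * (1 + ‖w‖ ^ 2 + ζ ^ 2) := by
      intro i j w ζ hw hζ
      set E := θ * (1 + ‖w‖ ^ 2 + ζ ^ 2) with hE
      set κ := kap a b lam t x w ζ with hκ
      let F : ℝ → ℝ := fun τ => (κ - E) * (∫ s in (0:ℝ)..τ, Real.exp (ζ * s)) +
        Real.exp (ζ * τ) * u ((t, x) + τ • ((1:ℝ), w))
      have hcexp : Continuous fun s : ℝ => Real.exp (ζ * s) := by fun_prop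
      have hF : HasDerivAt F ((κ - E) * 1 + (ζ * u (t, x) + fderiv ℝ u (t, x) (1, w))) 0 := by
        have d1 : HasDerivAt (fun τ => ∫ s in (0:ℝ)..τ, Real.exp (ζ * s)) 1 0 := by
          have := intervalIntegral.integral_hasDerivAt_right (f := fun s : ℝ => Real.exp (ζ * s))
            (a := 0) (b := 0) (hcexp.intervalIntegrable _ _)
            (hcexp.stronglyMeasurableAtFilter _ _) hcexp.continuousAt
          simpa using this
        have d2 : HasDerivAt (fun τ => Real.exp (ζ * τ)) ζ 0 := by
          have := ((hasDerivAt_id (0:ℝ)).const_mul ζ).exp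
          simpa using this
        have d3 : HasDerivAt (fun τ : ℝ => u ((t, x) + τ • ((1:ℝ), w))) (fderiv ℝ u (t, x) (1, w)) 0 := by
          have l1 : HasDerivAt (fun τ : ℝ => (t, x) + τ • ((1:ℝ), w)) ((1:ℝ) • ((1:ℝ), w)) 0 :=
            ((hasDerivAt_id (0:ℝ)).smul_const _).const_add _
          have l2 : HasFDerivAt u (fderiv ℝ u (t, x)) ((t, x) + (0:ℝ) • ((1:ℝ), w)) := by
            rw [zero_smul, add_zero]
            exact (hucd.differentiable (by simp)).differentiableAt.hasFDerivAt
          have := l2.comp_hasDerivAt (0:ℝ) l1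
          rw [one_smul] at this
          exact this
        have := (d1.const_mul (κ - E)).add (d2.mul d3)
        refine this.congr_deriv ?_
        simp
      have hev : ∀ᶠ n : ℕ in atTop, F (1 / ((n : ℝ) + 1)) ≤ F 0 := by
        have hT : Tendsto (fun n : ℕ => 1 / ((n : ℝ) + 1)) atTop (𝓝 0) :=
          tendsto_one_div_add_atTop_nhds_zero_nat
        have hT2 : Tendsto (fun n : ℕ => (1 / ((n : ℝ) + 1)) * (1 + ‖w‖)) atTop (𝓝 (0 * (1 + ‖w‖))) :=
          hT.mul_const _
        rw [zero_mul] at hT2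
        filter_upwards [hT2.eventually (gt_mem_nhds hε)] with n hn
        set τ := 1 / ((n : ℝ) + 1) with hτ
        have hτ0 : 0 < τ := by positivity
        have hτw0 : 0 ≤ τ * ‖w‖ := mul_nonneg hτ0.le (norm_nonneg w)
        rw [mul_add, mul_one] at hn
        have hτε : τ ≤ ε := by linarith only [hn, hτw0]
        have hτw : ‖τ • w‖ ≤ ε := by
          rw [norm_smul, Real.norm_of_nonneg hτ0.le]; linarith only [hn, hτ0]
        have hF0 : F 0 = u (t, x) := by simp [F]
        rw [hF0]
        have hmeas : Measurable fun s => U ((t, x) - s) - Real.exp (ζ * τ) * U ((t, x) + τ • ((1:ℝ), w) - s) :=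
          (hUmp _).sub (measurable_const.mul (hUmp _))
        have key := avg_ge f hfr hmeas (D := D + Real.exp (ζ * τ) * D) (by
            intro s
            refine (abs_sub _ _).trans (add_le_add (hD _) ?_)
            rw [abs_mul, Real.abs_exp]
            exact mul_le_mul_of_nonneg_left (hD _) (Real.exp_pos _).le)
          (c := (κ - E) * (∫ s in (0:ℝ)..τ, Real.exp (ζ * s))) (by
            intro s hs
            obtain ⟨g1, g2⟩ := hgood' s hs
            obtain ⟨g3, g4⟩ := hgood s hs
            obtain ⟨h1, h2⟩ := hs1 s hs
            rw [abs_lt] at h1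
            have e1 : U ((t, x) - s) = UU a b lam R (t - s.1, x - s.2) := rfl
            have e2 : U ((t, x) + τ • ((1:ℝ), w) - s) = UU a b lam R ((t - s.1) + τ, (x - s.2) + τ • w) := by
              rw [hU]; congr 1
              ext1
              · simp; ring
              · simp; abel
            have hball : ∀ σ ∈ Icc (0:ℝ) τ, ‖σ • w‖ ≤ ε := by
              intro σ hσ
              refine le_trans ?_ hτw
              rw [norm_smul, norm_smul, Real.norm_of_nonneg hσ.1, Real.norm_of_nonneg hτ0.le]
              exact mul_le_mul_of_nonneg_right hσ.2 (norm_nonneg _)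
            have hdp := UU_dp ha hb hC hC' hcurve g1 g2 n i j (τ := τ) (w := w) (ζ := ζ)
              (by rw [hw, hζ, hτ]; rfl) (by linarith [g3.2]) (by
                have := norm_add_le (x - s.2) (τ • w); linarith)
            rw [e1, e2]
            refine le_trans ?_ (le_sub_iff_add_le.2 hdp)
            unfold Gst
            rw [← intervalIntegral.integral_const_mul]
            refine intervalIntegral.integral_mono_on hτ0.le ((hcexp.const_mul _).intervalIntegrable _ _) ?_ ?_
            · have hk := continuous_kap ha hb lam
              have h2 : Continuous fun σ : ℝ => kap a b lam (t - s.1 + σ) (x - s.2 + σ • w) w ζ :=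
                hk.comp (by fun_prop : Continuous fun σ : ℝ => ((t - s.1 + σ), (x - s.2 + σ • w), w, ζ))
              exact (hcexp.mul h2).intervalIntegrable _ _
            · intro σ hσ
              rw [mul_comm]
              refine mul_le_mul_of_nonneg_left ?_ (Real.exp_pos _).le
              have hb1 := hball σ hσ
              have hxx : ‖x - s.2 + σ • w‖ ≤ R := by
                have := norm_add_le (x - s.2) (σ • w); linarith
              have hx2 : ‖(x - s.2 + σ • w) - x‖ ≤ 2 * ε := by
                have : (x - s.2 + σ • w) - x = σ • w - s.2 := by abel
                rw [this]
                have := norm_sub_le (σ • w) s.2; linarith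
              have ht2 : |(t - s.1 + σ) - t| ≤ 2 * ε := by
                rw [abs_le]; constructor <;> linarith [hσ.1, hσ.2]
              have hdist : dist ((t - s.1 + σ, x - s.2 + σ • w) : XX d) (t, x) ≤ 2 * ε := by
                rw [Prod.dist_eq, Real.dist_eq, dist_eq_norm]
                exact max_le ht2 hx2
              have m1 : ((t - s.1 + σ, x - s.2 + σ • w) : XX d) ∈ Icc (-1:ℝ) 2 ×ˢ Metric.closedBall (0 : Euc d) R := by
                refine ⟨⟨?_, ?_⟩, by simpa using hxx⟩
                · show -1 ≤ t - s.1 + σ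
                  linarith [hσ.1, g1.1]
                · show t - s.1 + σ ≤ 2
                  linarith [hσ.2, g1.2]
              have m2 : ((t, x) : XX d) ∈ Icc (-1:ℝ) 2 ×ˢ Metric.closedBall (0 : Euc d) R := by
                refine ⟨⟨?_, ?_⟩, ?_⟩
                · show -1 ≤ t
                  linarith [ht.1]
                · show t ≤ 2
                  linarith [ht.2]
                · have : ‖x‖ ≤ R := by linarith
                  simpa using this
              have n1 := hua _ m1 _ m2 (hdist.trans_lt hε1')
              have n2 := hub _ m1 _ m2 (hdist.trans_lt hε2')
              rw [Real.dist_eq] at n1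
              rw [dist_eq_norm] at n2
              have := kap_sub hC' hlam hω0.le (by linarith : ‖x‖ ≤ R) hxx n1.le n2.le (hx2.trans hεω) w ζ
              rw [← hM, hωM] at this
              have := (abs_le.1 this).1
              linarith)
        simp only [mul_sub] at key
        rw [integral_sub (hUi _) (by
          have := (hUi ((t, x) + τ • ((1:ℝ), w))).const_mul (Real.exp (ζ * τ))
          refine this.congr (ae_of_all _ fun s => ?_)
          simp only; ring), ← hu] at key
        have e5 : ∫ s, f.normed volume s * (Real.exp (ζ * τ) * U ((t, x) + τ • ((1:ℝ), w) - s)) =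
          Real.exp (ζ * τ) * u ((t, x) + τ • ((1:ℝ), w)) := by
          rw [hu, ← integral_const_mul]; congr 1; ext s; ring
        rw [e5] at key
        show (κ - E) * (∫ s in (0:ℝ)..τ, Real.exp (ζ * s)) +
          Real.exp (ζ * τ) * u ((t, x) + τ • ((1:ℝ), w)) ≤ u (t, x)
        linarith
      have := deriv_nonpos_of_seq hF hev
      linarith
    have hk := continuous_kap ha hb lam
    intro w ζ
    refine DenseRange.induction_on (TopologicalSpace.denseRange_denseSeq (Euc d)) w ?_ (fun i => ?_)
    · refine isClosed_le ?_ (by fun_prop)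
      have h2 : Continuous fun w : Euc d => kap a b lam t x w ζ :=
        hk.comp (by fun_prop : Continuous fun w : Euc d => (t, x, w, ζ))
      fun_prop
    · refine DenseRange.induction_on (TopologicalSpace.denseRange_denseSeq ℝ) ζ ?_ (fun j => ?_)
      · refine isClosed_le ?_ (by fun_prop)
        have h2 : Continuous fun ζ : ℝ => kap a b lam t x (TopologicalSpace.denseSeq (Euc d) i) ζ :=
          hk.comp (by fun_prop : Continuous fun ζ : ℝ => (t, x, _, ζ))
        fun_prop
      · exact hdense i j _ _ rfl rfl

end

section

lemma measurable_measure_of_lip {α : Type*} [MeasurableSpace α] (μ : α → Measure (Euc d))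
    (hfin : ∀ a, IsFiniteMeasure (μ a))
    (h : ∀ φ : Euc d → ℝ, Continuous φ → (∀ x, |φ x| ≤ 1) → LipschitzWith 1 φ →
      Measurable fun a => ∫ x, φ x ∂(μ a)) : Measurable μ := by
  have hcl : ∀ F : Set (Euc d), IsClosed F → Measurable fun a => μ a F := by
    intro F hF
    have hp : ∀ n : ℕ, (0:ℝ) < 1 / ((n : ℝ) + 1) := fun n => by positivity
    have hT := fun a => tendsto_lintegral_thickenedIndicator_of_isClosed (μ a) hF
      (δs := fun n : ℕ => 1 / ((n : ℝ) + 1)) hp tendsto_one_div_add_atTop_nhds_zero_nat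
    refine measurable_of_tendsto_metrizable (f := fun n a => ∫⁻ x, (thickenedIndicator (hp n) F x : ℝ≥0∞) ∂(μ a)) (fun n => ?_)
      (tendsto_pi_nhds.2 hT)
    set f := thickenedIndicator (hp n) F with hf
    have hflip := lipschitzWith_thickenedIndicator (hp n) F
    rw [← hf] at hflip
    have hf1 : ∀ x, (f x : ℝ) ≤ 1 := fun x => by
      exact NNReal.coe_le_coe.2 (thickenedIndicator_le_one (hp n) F x)
    have hf0 : ∀ x, (0:ℝ) ≤ (f x : ℝ) := fun x => NNReal.coe_nonneg _
    have hcp : (0:ℝ) < 1 / ((n : ℝ) + 1) := hp n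
    set c : ℝ := 1 / ((n : ℝ) + 1) with hc
    have hc1 : c ≤ 1 := by rw [hc, div_le_one (by positivity)]; linarith [n.cast_nonneg (α := ℝ)]
    have hfc : Continuous fun x => (f x : ℝ) := NNReal.continuous_coe.comp f.continuous
    have hm := h (fun x => c * (f x : ℝ)) (by fun_prop) (fun x => by
        rw [abs_of_nonneg (mul_nonneg hcp.le (hf0 x))]
        calc c * (f x : ℝ) ≤ 1 * 1 := mul_le_mul hc1 (hf1 x) (hf0 x) zero_le_one
          _ = 1 := one_mul 1)
      (by
        refine LipschitzWith.of_dist_le_mul (fun x y => ?_)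
        have := hflip.dist_le_mul x y
        rw [NNReal.dist_eq] at this
        rw [Real.dist_eq, ← mul_sub, abs_mul, abs_of_pos hcp]
        have e : ((Real.toNNReal c)⁻¹ : ℝ≥0) = (c⁻¹ : ℝ) := by
          rw [NNReal.coe_inv, Real.coe_toNNReal _ hcp.le]
        rw [e] at this
        calc c * |(f x : ℝ) - f y| ≤ c * (c⁻¹ * dist x y) := mul_le_mul_of_nonneg_left this hcp.le
          _ = ((1 : ℝ≥0) : ℝ) * dist x y := by
            rw [← mul_assoc, mul_inv_cancel₀ hcp.ne']; simp)
    have e : (fun a => ∫⁻ x, (f x : ℝ≥0∞) ∂(μ a)) =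
        fun a => ENNReal.ofReal (c⁻¹ * ∫ x, c * (f x : ℝ) ∂(μ a)) := by
      ext a
      rw [integral_const_mul, ← mul_assoc, inv_mul_cancel₀ hcp.ne', one_mul,
        ofReal_integral_eq_lintegral_ofReal]
      · simp
      · refine Integrable.of_bound hfc.aestronglyMeasurable 1 (ae_of_all _ fun x => ?_)
        rw [Real.norm_of_nonneg (hf0 x)]; exact hf1 x
      · exact ae_of_all _ fun x => hf0 x
    rw [e]
    exact (measurable_const.mul hm).ennreal_ofReal
  refine Measurable.measure_of_isPiSystem (S := {s | IsClosed s}) ?_ isPiSystem_isClosed hcl (hcl _ isClosed_univ)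
  rw [← borel_eq_generateFrom_isClosed]
  exact BorelSpace.measurable_eq

/-- narrowly continuous curve of finite measures on `Ω`, on all of `ℝ` -/
structure Good (Ω : Set (Euc d)) (ρ : ℝ → Measure (Euc d)) : Prop where
  fin : ∀ t, IsFiniteMeasure (ρ t)
  supp : ∀ t, ρ t Ωᶜ = 0
  cont : ∀ φ : Euc d → ℝ, Continuous φ → Continuous fun t => ∫ x, φ x ∂(ρ t)
  bdd : ∃ C : ℝ≥0∞, C < ⊤ ∧ ∀ t, ρ t univ ≤ C

lemma clamp_mem (t : ℝ) : clamp t ∈ Icc (0:ℝ) 1 :=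
  ⟨le_max_left _ _, max_le zero_le_one (min_le_left _ _)⟩

lemma continuous_clamp : Continuous clamp := by unfold clamp; fun_prop

lemma clamp_of_mem {t : ℝ} (ht : t ∈ Icc (0:ℝ) 1) : clamp t = t := by
  unfold clamp; rw [min_eq_right ht.2, max_eq_right ht.1]

lemma good_of_narrow {Ω : Set (Euc d)} {ρ : ℝ → Measure (Euc d)} (h : NarrowCurve Ω ρ) :
    Good Ω (fun t => ρ (clamp t)) := by
  have hfin : ∀ t, IsFiniteMeasure (ρ (clamp t)) := fun t =>
    ⟨lt_top_iff_ne_top.2 (h.1 _ (clamp_mem t)).2⟩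
  refine ⟨hfin, fun t => (h.1 _ (clamp_mem t)).1, fun φ hφ => ?_, ?_⟩
  · exact (h.2 φ hφ).comp_continuous continuous_clamp clamp_mem
  · obtain ⟨C, hC⟩ := isCompact_Icc.exists_bound_of_continuousOn (h.2 (fun _ => 1) continuous_const)
    refine ⟨ENNReal.ofReal C, ENNReal.ofReal_lt_top, fun t => ?_⟩
    have hh := hC _ (clamp_mem t)
    simp only [integral_const, smul_eq_mul, mul_one] at hh
    have := hfin t
    rw [Real.norm_of_nonneg measureReal_nonneg] at hh
    rw [← ofReal_measureReal]
    exact ENNReal.ofReal_le_ofReal hh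

def kerOf {Ω : Set (Euc d)} {ρ : ℝ → Measure (Euc d)} (h : Good Ω ρ) :
    ProbabilityTheory.Kernel ℝ (Euc d) :=
  ⟨ρ, measurable_measure_of_lip ρ h.fin (fun φ hφ _ _ => (h.cont φ hφ).measurable)⟩

instance instFinKer {Ω : Set (Euc d)} {ρ : ℝ → Measure (Euc d)} (h : Good Ω ρ) :
    ProbabilityTheory.IsFiniteKernel (kerOf h) := ⟨h.bdd⟩

/-- space-time measure -/
def PP {Ω : Set (Euc d)} {ρ : ℝ → Measure (Euc d)} (h : Good Ω ρ) : Measure (XX d) :=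
  (volume.restrict (Ioo (0:ℝ) 1)).compProd (kerOf h)

instance instFinPP {Ω : Set (Euc d)} {ρ : ℝ → Measure (Euc d)} (h : Good Ω ρ) :
    IsFiniteMeasure (PP h) := by unfold PP; infer_instance

lemma lintegral_PP {Ω : Set (Euc d)} {ρ : ℝ → Measure (Euc d)} (h : Good Ω ρ) {F : XX d → ℝ≥0∞}
    (hF : Measurable F) : ∫⁻ p, F p ∂(PP h) = ∫⁻ t in Ioo (0:ℝ) 1, ∫⁻ x, F (t, x) ∂(ρ t) :=
  Measure.lintegral_compProd hF

lemma integral_PP {Ω : Set (Euc d)} {ρ : ℝ → Measure (Euc d)} (h : Good Ω ρ) {F : XX d → ℝ}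
    (hF : Integrable F (PP h)) : ∫ p, F p ∂(PP h) = ∫ t in Ioo (0:ℝ) 1, ∫ x, F (t, x) ∂(ρ t) :=
  Measure.integral_compProd hF

lemma ae_PP {Ω : Set (Euc d)} (hΩ : MeasurableSet Ω) {ρ : ℝ → Measure (Euc d)} (h : Good Ω ρ) :
    ∀ᵐ p ∂(PP h), p.1 ∈ Ioo (0:ℝ) 1 ∧ p.2 ∈ Ω := by
  have hm : MeasurableSet {p : XX d | p.1 ∈ Ioo (0:ℝ) 1 ∧ p.2 ∈ Ω} :=
    (measurable_fst measurableSet_Ioo).inter (measurable_snd hΩ)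
  refine (Measure.ae_compProd_iff hm).2 ?_
  filter_upwards [ae_restrict_mem measurableSet_Ioo] with t ht
  have : ∀ᵐ x ∂(ρ t), x ∈ Ω := h.supp t
  show ∀ᵐ x ∂(ρ t), _
  filter_upwards [this] with x hx
  exact ⟨ht, hx⟩

lemma integrable_cont {Ω : Set (Euc d)} (hΩ : IsCompact Ω) {ρ : ℝ → Measure (Euc d)} (h : Good Ω ρ)
    {φ : Euc d → ℝ} (hφ : Continuous φ) (t : ℝ) : Integrable φ (ρ t) := by
  obtain ⟨C, hC⟩ := hΩ.exists_bound_of_continuousOn hφ.continuousOn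
  have := h.fin t
  refine Integrable.of_bound hφ.aestronglyMeasurable C ?_
  have : ∀ᵐ x ∂(ρ t), x ∈ Ω := h.supp t
  filter_upwards [this] with x hx using hC x hx

end

section

/-- smooth step from `0` (before `δ`) to `1` (after `2δ`) -/
def chi1 (δ t : ℝ) : ℝ := Real.smoothTransition ((t - δ) / δ)

lemma chi1_contDiff (δ : ℝ) : ContDiff ℝ (⊤:ℕ∞) (chi1 δ) := by
  unfold chi1
  exact Real.smoothTransition.contDiff.comp ((contDiff_id.sub contDiff_const).div_const δ)

lemma chi1_nonneg (δ t : ℝ) : 0 ≤ chi1 δ t := Real.smoothTransition.nonneg _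
lemma chi1_le_one (δ t : ℝ) : chi1 δ t ≤ 1 := Real.smoothTransition.le_one _
lemma chi1_zero {δ t : ℝ} (hδ : 0 < δ) (h : t ≤ δ) : chi1 δ t = 0 :=
  Real.smoothTransition.zero_of_nonpos (div_nonpos_of_nonpos_of_nonneg (by linarith) hδ.le)
lemma chi1_one {δ t : ℝ} (hδ : 0 < δ) (h : 2 * δ ≤ t) : chi1 δ t = 1 :=
  Real.smoothTransition.one_of_one_le ((one_le_div hδ).2 (by linarith))

lemma chi1_differentiable (δ : ℝ) : Differentiable ℝ (chi1 δ) :=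
  (chi1_contDiff δ).differentiable (by simp)

lemma chi1_deriv_cont (δ : ℝ) : Continuous (deriv (chi1 δ)) :=
  (chi1_contDiff δ).continuous_deriv (by simp)

lemma chi1_deriv_nonneg {δ : ℝ} (hδ : 0 < δ) (t : ℝ) : 0 ≤ deriv (chi1 δ) t := by
  apply Monotone.deriv_nonneg
  intro s t hst
  apply Real.smoothTransition.monotone
  gcongr

lemma chi1_deriv_zero {δ : ℝ} (hδ : 0 < δ) {t : ℝ} (ht : t ∉ Icc δ (2*δ)) : deriv (chi1 δ) t = 0 := by
  by_cases h : t < δ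
  · have : chi1 δ =ᶠ[𝓝 t] fun _ => 0 := by
      filter_upwards [Iio_mem_nhds h] with s hs using chi1_zero hδ (le_of_lt hs)
    rw [this.deriv_eq]; simp
  · have h2 : 2 * δ < t := by
      by_contra h3; exact ht ⟨by linarith, by linarith⟩
    have : chi1 δ =ᶠ[𝓝 t] fun _ => 1 := by
      filter_upwards [Ioi_mem_nhds h2] with s hs using chi1_one hδ (le_of_lt hs)
    rw [this.deriv_eq]; simp

lemma chi1_deriv_integral {δ : ℝ} (hδ : 0 < δ) (h4 : δ < 1/4) :
    ∫ t in (0:ℝ)..1, deriv (chi1 δ) t = 1 := by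
  rw [intervalIntegral.integral_deriv_eq_sub (fun x _ => chi1_differentiable δ x)
    ((chi1_deriv_cont δ).intervalIntegrable _ _), chi1_zero (t := 0) hδ (by linarith), chi1_one (t := 1) hδ (by linarith)]
  simp

lemma chi1_deriv_integral' {δ : ℝ} (hδ : 0 < δ) (h4 : δ < 1/4) :
    ∫ t in (0:ℝ)..1, deriv (chi1 δ) (1 - t) = 1 := by
  rw [intervalIntegral.integral_comp_sub_left]
  simpa using chi1_deriv_integral hδ h4

lemma integrable_contP {Ω : Set (Euc d)} (hΩ : IsCompact Ω) {ρ : ℝ → Measure (Euc d)} (h : Good Ω ρ)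
    {F : XX d → ℝ} (hF : Continuous F) : Integrable F (PP h) := by
  obtain ⟨C, hC⟩ := ((isCompact_Icc (a := (0:ℝ)) (b := 1)).prod hΩ).exists_bound_of_continuousOn
    hF.continuousOn
  refine Integrable.of_bound hF.aestronglyMeasurable C ?_
  filter_upwards [ae_PP hΩ.measurableSet h] with p hp
  exact hC p ⟨⟨hp.1.1.le, hp.1.2.le⟩, hp.2⟩

lemma weight_le {Ω : Set (Euc d)} (hΩ : IsCompact Ω) {ρ : ℝ → Measure (Euc d)} (h : Good Ω ρ)
    {w : ℝ → ℝ} (hw : Continuous w) (hw0 : ∀ t, 0 ≤ w t) (hw1 : ∫ t in (0:ℝ)..1, w t = 1)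
    {f : Euc d → ℝ} (hf : Continuous f) {A : ℝ} (hA : ∀ t, w t ≠ 0 → ∫ x, f x ∂(ρ t) ≤ A) :
    ∫ p, w p.1 * f p.2 ∂(PP h) ≤ A := by
  have hc : Continuous fun p : XX d => w p.1 * f p.2 := by fun_prop
  rw [integral_PP h (integrable_contP hΩ h hc)]
  have h1 : ∀ t, ∫ x, w t * f x ∂(ρ t) = w t * ∫ x, f x ∂(ρ t) := fun t => integral_const_mul _ _
  simp only [h1]
  rw [← integral_Ioc_eq_integral_Ioo, ← intervalIntegral.integral_of_le zero_le_one]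
  calc ∫ t in (0:ℝ)..1, w t * ∫ x, f x ∂(ρ t) ≤ ∫ t in (0:ℝ)..1, w t * A := by
        apply intervalIntegral.integral_mono_on zero_le_one
        · exact (hw.mul (h.cont f hf)).intervalIntegrable _ _
        · exact (hw.mul continuous_const).intervalIntegrable _ _
        · intro t _
          by_cases hwt : w t = 0
          · simp [hwt]
          · exact mul_le_mul_of_nonneg_left (hA t hwt) (hw0 t)
    _ = A := by rw [intervalIntegral.integral_mul_const, hw1, one_mul]

/-- weak form of the continuity equation against the space-time measure -/
def CEP {Ω : Set (Euc d)} {ρ : ℝ → Measure (Euc d)} (h : Good Ω ρ) (v : XX d → Euc d) (g : XX d → ℝ) : Prop :=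
  ∀ φ : XX d → ℝ, IsTest φ →
    ∫ p, (fderiv ℝ φ p (1, v p) + φ p * g p) ∂(PP h) = 0

lemma integrable_test {Ω : Set (Euc d)} {ρ : ℝ → Measure (Euc d)} (h : Good Ω ρ)
    {v : XX d → Euc d} {g : XX d → ℝ} (hv : Measurable v) (hg : Measurable g)
    (hv2 : Integrable (fun p => ‖v p‖ ^ 2) (PP h)) (hg2 : Integrable (fun p => g p ^ 2) (PP h))
    {φ : XX d → ℝ} (hφ : ContDiff ℝ (⊤:ℕ∞) φ) (hs : HasCompactSupport φ) :
    Integrable (fun p => fderiv ℝ φ p (1, v p) + φ p * g p) (PP h) := by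
  have hDc : Continuous (fderiv ℝ φ) := hφ.continuous_fderiv (by simp)
  obtain ⟨C, hC⟩ := (hs.fderiv (𝕜 := ℝ)).exists_bound_of_continuous hDc
  obtain ⟨C', hC'⟩ := hs.exists_bound_of_continuous hφ.continuous
  have hC0 : 0 ≤ C := (norm_nonneg _).trans (hC 0)
  have hm : Measurable fun p => fderiv ℝ φ p (1, v p) + φ p * g p := by
    have h1 : Measurable fun p => fderiv ℝ φ p (1, v p) := by
      have : Continuous fun q : (XX d) × (XX d) => fderiv ℝ φ q.1 q.2 := by fun_prop
      exact this.measurable.comp (measurable_id.prodMk (measurable_const.prodMk hv))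
    exact h1.add (hφ.continuous.measurable.mul hg)
  have hi : Integrable (fun p => C * (2 + ‖v p‖ ^ 2) + C' * (1 + g p ^ 2)) (PP h) :=
    (((integrable_const _).add hv2).const_mul C).add (((integrable_const _).add hg2).const_mul C')
  refine hi.mono' hm.aestronglyMeasurable (ae_of_all _ fun p => ?_)
  have hC0' : 0 ≤ C' := (norm_nonneg _).trans (hC' 0)
  refine (norm_add_le _ _).trans (add_le_add ?_ ?_)
  · refine ((fderiv ℝ φ p).le_opNorm _).trans ?_
    apply mul_le_mul (hC p) _ (norm_nonneg _) hC0
    rw [Prod.norm_def]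
    apply max_le
    · simp; nlinarith [norm_nonneg (v p)]
    · simp only; nlinarith [norm_nonneg (v p), sq_nonneg (‖v p‖ - 1)]
  · rw [norm_mul]
    apply mul_le_mul (hC' p) _ (norm_nonneg _) hC0'
    rw [Real.norm_eq_abs]
    nlinarith [sq_abs (g p), sq_nonneg (|g p| - 1)]

lemma measurable_kapP {a : XX d → ℝ} {b : XX d → ZZ d} (ha : Continuous a) (hb : Continuous b)
    (lam : ℝ) {v : XX d → Euc d} {g : XX d → ℝ} (hv : Measurable v) (hg : Measurable g) :
    Measurable fun p : XX d => kap a b lam p.1 p.2 (v p) (g p) :=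
  (continuous_kap ha hb lam).measurable.comp
    (measurable_fst.prodMk (measurable_snd.prodMk (hv.prodMk hg)))

lemma integrable_kapP {Ω : Set (Euc d)} (hΩ : IsCompact Ω) {ρ : ℝ → Measure (Euc d)} (h : Good Ω ρ)
    {R : ℝ} (hΩR : ∀ x ∈ Ω, ‖x‖ ≤ R - 1)
    {v : XX d → Euc d} {g : XX d → ℝ} (hv : Measurable v) (hg : Measurable g)
    (hv2 : Integrable (fun p => ‖v p‖ ^ 2) (PP h)) (hg2 : Integrable (fun p => g p ^ 2) (PP h))
    {a : XX d → ℝ} {b : XX d → ZZ d} (ha : Continuous a) (hb : Continuous b) {C : ℝ}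
    (hC : ∀ p, |a p| ≤ C) (hC' : ∀ p, ‖b p‖ ≤ C) {lam : ℝ} (hlam : 0 ≤ lam) (hR : 1 ≤ R) :
    Integrable (fun p : XX d => kap a b lam p.1 p.2 (v p) (g p)) (PP h) := by
  have hi : Integrable (fun p => C + C * (1 + R^2 * (2 * g p ^ 2 + 2 * ‖v p‖^2)) +
      lam * (R ^ 2 * (2 * g p ^ 2 + 2 * ‖v p‖ ^ 2))) (PP h) :=
    ((integrable_const _).add (((integrable_const _).add
      (((hg2.const_mul 2).add (hv2.const_mul 2)).const_mul _)).const_mul _)).add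
      ((((hg2.const_mul 2).add (hv2.const_mul 2)).const_mul _).const_mul _)
  refine hi.mono' (measurable_kapP ha hb lam hv hg).aestronglyMeasurable ?_
  filter_upwards [ae_PP hΩ.measurableSet h] with p hp
  have hx := hΩR _ hp.2
  set q := qf (v p) (g p) p.2 with hq
  have hq1 : ‖q‖ ≤ |g p| * R + ‖v p‖ := by
    refine (norm_qf_le _ _ _).trans ?_
    gcongr; linarith
  have hq2 : ‖q‖ ^ 2 ≤ R ^ 2 * (2 * g p ^ 2 + 2 * ‖v p‖ ^ 2) := by
    have h1 : ‖q‖ ≤ R * (|g p| + ‖v p‖) := by nlinarith [norm_nonneg (v p)]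
    calc ‖q‖ ^ 2 ≤ (R * (|g p| + ‖v p‖)) ^ 2 := by gcongr
      _ ≤ _ := by
        rw [mul_pow, ← sq_abs (g p)]
        apply mul_le_mul_of_nonneg_left _ (sq_nonneg R)
        nlinarith [sq_nonneg (|g p| - ‖v p‖)]
  have hC0 : 0 ≤ C := (norm_nonneg _).trans (hC' p)
  unfold kap
  rw [← hq]
  refine (norm_sub_le _ _).trans (add_le_add ((norm_add_le _ _).trans (add_le_add (hC p) ?_)) ?_)
  · refine (norm_inner_le_norm _ _).trans ?_
    apply mul_le_mul (hC' p) _ (norm_nonneg _) hC0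
    nlinarith [sq_nonneg (‖q‖ - 1)]
  · rw [norm_mul, norm_pow, norm_norm, Real.norm_of_nonneg hlam]
    gcongr

end

section

def chi2 (δ t : ℝ) : ℝ := chi1 δ t * chi1 δ (1 - t)

lemma chi2_contDiff (δ : ℝ) : ContDiff ℝ (⊤:ℕ∞) (chi2 δ) := by
  unfold chi2
  exact (chi1_contDiff δ).mul ((chi1_contDiff δ).comp (contDiff_const.sub contDiff_id))

lemma chi2_hasDeriv (δ t : ℝ) : HasDerivAt (chi2 δ)
    (deriv (chi1 δ) t * chi1 δ (1 - t) - chi1 δ t * deriv (chi1 δ) (1 - t)) t := by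
  have h1 := (chi1_differentiable δ t).hasDerivAt
  have h2 : HasDerivAt (fun s => chi1 δ (1 - s)) (deriv (chi1 δ) (1 - t) * (-1)) t :=
    ((chi1_differentiable δ (1 - t)).hasDerivAt).comp t ((hasDerivAt_id t).const_sub 1)
  refine (h1.mul h2).congr_deriv ?_
  ring

lemma chi2_nonneg (δ t : ℝ) : 0 ≤ chi2 δ t := mul_nonneg (chi1_nonneg _ _) (chi1_nonneg _ _)
lemma chi2_le_one (δ t : ℝ) : chi2 δ t ≤ 1 :=
  mul_le_one₀ (chi1_le_one _ _) (chi1_nonneg _ _) (chi1_le_one _ _)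

lemma key3_step {Ω : Set (Euc d)} (hΩ : IsCompact Ω) {ρ : ℝ → Measure (Euc d)} (h : Good Ω ρ)
    {R : ℝ} (hΩR : ∀ x ∈ Ω, ‖x‖ ≤ R - 1)
    {v : XX d → Euc d} {g : XX d → ℝ} (hv : Measurable v) (hg : Measurable g)
    (hv2 : Integrable (fun p => ‖v p‖ ^ 2) (PP h)) (hg2 : Integrable (fun p => g p ^ 2) (PP h))
    (hCE : CEP h v g)
    {a : XX d → ℝ} {b : XX d → ZZ d} (ha : Continuous a) (hb : Continuous b) {C : ℝ}
    (hC : ∀ p, |a p| ≤ C) (hC' : ∀ p, ‖b p‖ ≤ C) {lam : ℝ} (hlam : 0 ≤ lam) (hR : 1 ≤ R)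
    (hcurve : CurveHyp a b lam R) {δ : ℝ} (hδ : 0 < δ) (h4 : δ < 1/4) :
    ∫ p, chi2 δ p.1 * kap a b lam p.1 p.2 (v p) (g p) ∂(PP h) ≤
      (∫ p, deriv (chi1 δ) p.1 * ((2 * C + 1) * δ + lam * ‖pZ p.2‖ ^ 2) ∂(PP h)) +
      (∫ p, deriv (chi1 δ) (1 - p.1) * ((2 * C + 1) * δ) ∂(PP h)) +
      δ * ∫ p, (1 + ‖v p‖ ^ 2 + g p ^ 2) ∂(PP h) := by
  obtain ⟨u, hu, hus, hprop⟩ := key2 ha hb hC hC' hcurve hlam hR hδ hδ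
  have hC0 : 0 ≤ C := (norm_nonneg _).trans (hC' 0)
  set φ : XX d → ℝ := (fun p => chi2 δ p.1) * u with hφ
  have hχ : ContDiff ℝ (⊤:ℕ∞) (fun p : XX d => chi2 δ p.1) := (chi2_contDiff δ).comp contDiff_fst
  have hφc : ContDiff ℝ (⊤:ℕ∞) φ := hχ.mul hu
  have hφs : HasCompactSupport φ := hus.mul_left
  have htest : IsTest φ := by
    refine ⟨hφc, hφs, ?_⟩
    have h1 : tsupport φ ⊆ Icc δ (1 - δ) ×ˢ univ := by
      apply closure_minimal
      · intro p hp
        refine ⟨⟨?_, ?_⟩, mem_univ _⟩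
        · by_contra hlt
          apply hp
          simp [hφ, chi2, chi1_zero hδ (le_of_lt (not_le.1 hlt))]
        · by_contra hlt
          apply hp
          have : 1 - p.1 ≤ δ := by linarith [not_le.1 hlt]
          simp [hφ, chi2, chi1_zero hδ this]
      · exact isClosed_Icc.prod isClosed_univ
    refine h1.trans (prod_mono ?_ subset_rfl)
    intro t ht
    exact ⟨by linarith [ht.1], by linarith [ht.2]⟩
  have h0 := hCE φ htest
  have hInt := integrable_test h hv hg hv2 hg2 hφc hφs
  have hikap := integrable_kapP hΩ h hΩR hv hg hv2 hg2 ha hb hC hC' hlam hR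
  have hi0 : Integrable (fun p : XX d => chi2 δ p.1 * kap a b lam p.1 p.2 (v p) (g p)) (PP h) := by
    refine hikap.bdd_mul (c := 1) hχ.continuous.aestronglyMeasurable (ae_of_all _ fun p => ?_)
    rw [Real.norm_of_nonneg (chi2_nonneg _ _)]; exact chi2_le_one _ _
  have hcp := continuous_pZ (d := d)
  have hcd := chi1_deriv_cont δ
  have hi1 : Integrable (fun p : XX d => deriv (chi1 δ) p.1 * ((2 * C + 1) * δ + lam * ‖pZ p.2‖ ^ 2)) (PP h) :=
    integrable_contP hΩ h (by fun_prop)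
  have hi2 : Integrable (fun p : XX d => deriv (chi1 δ) (1 - p.1) * ((2 * C + 1) * δ)) (PP h) :=
    integrable_contP hΩ h (by fun_prop)
  have hi3 : Integrable (fun p : XX d => δ * (1 + ‖v p‖ ^ 2 + g p ^ 2)) (PP h) :=
    (((integrable_const _).add hv2).add hg2).const_mul δ
  suffices hh : 0 ≤ ∫ p, (((deriv (chi1 δ) p.1 * ((2 * C + 1) * δ + lam * ‖pZ p.2‖ ^ 2)) +
      deriv (chi1 δ) (1 - p.1) * ((2 * C + 1) * δ)) + δ * (1 + ‖v p‖ ^ 2 + g p ^ 2)) -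
      chi2 δ p.1 * kap a b lam p.1 p.2 (v p) (g p) ∂(PP h) by
    have hi12 : Integrable (fun p : XX d => deriv (chi1 δ) p.1 * ((2 * C + 1) * δ + lam * ‖pZ p.2‖ ^ 2) +
      deriv (chi1 δ) (1 - p.1) * ((2 * C + 1) * δ)) (PP h) := hi1.add hi2
    have hi123 : Integrable (fun p : XX d => deriv (chi1 δ) p.1 * ((2 * C + 1) * δ + lam * ‖pZ p.2‖ ^ 2) +
      deriv (chi1 δ) (1 - p.1) * ((2 * C + 1) * δ) + δ * (1 + ‖v p‖ ^ 2 + g p ^ 2)) (PP h) := hi12.add hi3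
    rw [integral_sub hi123 hi0, integral_add hi12 hi3, integral_add hi1 hi2,
      integral_const_mul, sub_nonneg] at hh
    exact hh
  rw [← h0]
  refine integral_mono_ae hInt (((hi1.add hi2).add hi3).sub hi0) ?_
  filter_upwards [ae_PP hΩ.measurableSet h] with p hp
  obtain ⟨t, x⟩ := p
  have hx := hΩR _ hp.2
  simp only at hx
  have hfd : fderiv ℝ φ (t, x) (1, v (t, x)) =
      chi2 δ t * fderiv ℝ u (t, x) (1, v (t, x)) +
      (deriv (chi1 δ) t * chi1 δ (1 - t) - chi1 δ t * deriv (chi1 δ) (1 - t)) * u (t, x) := by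
    have e1 : HasFDerivAt (fun p : XX d => chi2 δ p.1)
        ((ContinuousLinearMap.toSpanSingleton ℝ
          (deriv (chi1 δ) t * chi1 δ (1 - t) - chi1 δ t * deriv (chi1 δ) (1 - t))).comp
          (ContinuousLinearMap.fst ℝ ℝ (Euc d))) (t, x) := by
      have e0 : HasFDerivAt (fun p : XX d => p.1) (ContinuousLinearMap.fst ℝ ℝ (Euc d)) (t, x) := hasFDerivAt_fst
      exact HasFDerivAt.comp (g := chi2 δ) (t, x) (chi2_hasDeriv δ t).hasFDerivAt e0
    have e2 : HasFDerivAt u (fderiv ℝ u (t, x)) (t, x) :=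
      (hu.differentiable (by simp) (t, x)).hasFDerivAt
    rw [hφ, (e1.mul e2).fderiv]
    simp
    ring
  simp only [hfd]
  have hφe : φ (t, x) = chi2 δ t * u (t, x) := rfl
  rw [hφe]
  set U := u (t, x)
  set D := fderiv ℝ u (t, x) (1, v (t, x))
  set K := kap a b lam t x (v (t, x)) (g (t, x))
  have d1 := chi1_deriv_nonneg hδ t
  have d2 := chi1_deriv_nonneg hδ (1 - t)
  set B := (2 * C + 1) * δ with hB
  have hB0 : 0 ≤ B := by positivity
  have t1 : deriv (chi1 δ) t * chi1 δ (1 - t) * U ≤ deriv (chi1 δ) t * (B + lam * ‖pZ x‖ ^ 2) := by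
    by_cases ht : t ∈ Icc δ (2 * δ)
    · have hb1 := (hprop t ⟨ht.1, by linarith [ht.2]⟩ x hx).1
      rw [mul_assoc]
      apply mul_le_mul_of_nonneg_left _ d1
      have e1 : U ≤ B + lam * ‖pZ x‖ ^ 2 := by
        have : C * t ≤ C * (2 * δ) := mul_le_mul_of_nonneg_left ht.2 hC0
        rw [hB]; linarith
      have e2 : 0 ≤ B + lam * ‖pZ x‖ ^ 2 := by positivity
      nlinarith [chi1_nonneg δ (1 - t), chi1_le_one δ (1 - t)]
    · simp [chi1_deriv_zero hδ ht]
  have t2 : - (chi1 δ t * deriv (chi1 δ) (1 - t)) * U ≤ deriv (chi1 δ) (1 - t) * B := by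
    by_cases ht : 1 - t ∈ Icc δ (2 * δ)
    · have hb1 := (hprop t ⟨by linarith [ht.2], by linarith [ht.1]⟩ x hx).2.1
      have e1 : - U ≤ B := by
        have : C * (1 - t) ≤ C * (2 * δ) := mul_le_mul_of_nonneg_left ht.2 hC0
        rw [hB]; linarith
      have e2 : chi1 δ t * (-U) ≤ B := by
        nlinarith [chi1_nonneg δ t, chi1_le_one δ t]
      calc - (chi1 δ t * deriv (chi1 δ) (1 - t)) * U = deriv (chi1 δ) (1 - t) * (chi1 δ t * (-U)) := by ring
        _ ≤ _ := mul_le_mul_of_nonneg_left e2 d2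
    · simp [chi1_deriv_zero hδ ht]
  have t3 : chi2 δ t * (D + g (t, x) * U + K) ≤ δ * (1 + ‖v (t, x)‖ ^ 2 + g (t, x) ^ 2) := by
    by_cases ht : t ∈ Icc δ (1 - δ)
    · have hb1 := (hprop t ht x hx).2.2 (v (t, x)) (g (t, x))
      have e2 : 0 ≤ δ * (1 + ‖v (t, x)‖ ^ 2 + g (t, x) ^ 2) := by positivity
      have e3 : chi2 δ t * (D + g (t, x) * U + K) ≤ chi2 δ t * (δ * (1 + ‖v (t, x)‖ ^ 2 + g (t, x) ^ 2)) :=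
        mul_le_mul_of_nonneg_left hb1 (chi2_nonneg δ t)
      nlinarith [chi2_nonneg δ t, chi2_le_one δ t]
    · have : chi2 δ t = 0 := by
        unfold chi2
        by_cases h1 : δ ≤ t
        · have : 1 - t ≤ δ := by
            by_contra hh; exact ht ⟨h1, by linarith⟩
          simp [chi1_zero hδ this]
        · simp [chi1_zero hδ (le_of_lt (not_le.1 h1))]
      rw [this]; simp; positivity
  linarith

lemma chi2_tendsto {t : ℝ} (ht : t ∈ Ioo (0:ℝ) 1) :
    Tendsto (fun n : ℕ => chi2 (1 / ((n:ℝ) + 5)) t) atTop (𝓝 1) := by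
  apply tendsto_const_nhds.congr'
  have h1 : Tendsto (fun n : ℕ => 1 / ((n:ℝ) + 5)) atTop (𝓝 0) := by
    have := tendsto_one_div_add_atTop_nhds_zero_nat (𝕜 := ℝ)
    have := this.comp (tendsto_add_atTop_nat 4)
    refine this.congr (fun n => ?_)
    simp; ring
  have hm : 0 < min t (1 - t) / 2 := by
    have := ht.1; have := ht.2
    have : 0 < min t (1 - t) := lt_min ht.1 (by linarith)
    linarith
  filter_upwards [h1.eventually (gt_mem_nhds hm)] with n hn
  have hp : (0:ℝ) < 1 / ((n:ℝ) + 5) := by positivity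
  unfold chi2
  rw [chi1_one hp (by linarith [min_le_left t (1-t)]), chi1_one hp (by linarith [min_le_right t (1-t)])]
  simp

lemma key3 {Ω : Set (Euc d)} (hΩ : IsCompact Ω) {ρ : ℝ → Measure (Euc d)} (h : Good Ω ρ)
    {R : ℝ} (hΩR : ∀ x ∈ Ω, ‖x‖ ≤ R - 1)
    {v : XX d → Euc d} {g : XX d → ℝ} (hv : Measurable v) (hg : Measurable g)
    (hv2 : Integrable (fun p => ‖v p‖ ^ 2) (PP h)) (hg2 : Integrable (fun p => g p ^ 2) (PP h))
    (hCE : CEP h v g)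
    {a : XX d → ℝ} {b : XX d → ZZ d} (ha : Continuous a) (hb : Continuous b) {C : ℝ}
    (hC : ∀ p, |a p| ≤ C) (hC' : ∀ p, ‖b p‖ ≤ C) {lam : ℝ} (hlam : 0 ≤ lam) (hR : 1 ≤ R)
    (hcurve : CurveHyp a b lam R) :
    ∫ p, kap a b lam p.1 p.2 (v p) (g p) ∂(PP h) ≤ lam * ∫ x, ‖pZ x‖ ^ 2 ∂(ρ 0) := by
  have hC0 : 0 ≤ C := (norm_nonneg _).trans (hC' 0)
  have hcp := continuous_pZ (d := d)
  have hikap := integrable_kapP hΩ h hΩR hv hg hv2 hg2 ha hb hC hC' hlam hR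
  have hlim : Tendsto (fun n : ℕ => ∫ p, chi2 (1 / ((n:ℝ) + 5)) p.1 * kap a b lam p.1 p.2 (v p) (g p) ∂(PP h))
      atTop (𝓝 (∫ p, kap a b lam p.1 p.2 (v p) (g p) ∂(PP h))) := by
    refine tendsto_integral_of_dominated_convergence
      (fun p : XX d => ‖kap a b lam p.1 p.2 (v p) (g p)‖) ?_ hikap.norm ?_ ?_
    · intro n
      exact (((chi2_contDiff _).continuous.comp continuous_fst).measurable.mul
        (measurable_kapP ha hb lam hv hg)).aestronglyMeasurable
    · intro n
      refine ae_of_all _ fun p => ?_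
      rw [norm_mul, Real.norm_of_nonneg (chi2_nonneg _ _)]
      exact mul_le_of_le_one_left (norm_nonneg _) (chi2_le_one _ _)
    · filter_upwards [ae_PP hΩ.measurableSet h] with p hp
      simpa using (chi2_tendsto hp.1).mul_const (kap a b lam p.1 p.2 (v p) (g p))
  obtain ⟨M0, hM0, hM⟩ := h.bdd
  set m := M0.toReal with hm
  have hmass : ∀ t, (ρ t).real univ ≤ m := fun t => ENNReal.toReal_mono hM0.ne (hM t)
  have hm0 : 0 ≤ m := ENNReal.toReal_nonneg
  set M1 := ∫ p, (1 + ‖v p‖ ^ 2 + g p ^ 2) ∂(PP h)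
  have h1 : Tendsto (fun n : ℕ => 1 / ((n:ℝ) + 5)) atTop (𝓝 0) := by
    have := tendsto_one_div_add_atTop_nhds_zero_nat (𝕜 := ℝ)
    have := this.comp (tendsto_add_atTop_nat 4)
    refine this.congr (fun n => ?_)
    simp; ring
  set e0 := ∫ x, ‖pZ x‖ ^ 2 ∂(ρ 0)
  have hec := h.cont (fun x => ‖pZ x‖ ^ 2) (by fun_prop)
  suffices H : ∀ η : ℝ, 0 < η → ∫ p, kap a b lam p.1 p.2 (v p) (g p) ∂(PP h) ≤ lam * (e0 + η) by
    apply le_of_forall_pos_le_add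
    intro ε hε
    refine (H (ε / (lam + 1)) (by positivity)).trans ?_
    rw [mul_add]
    have : lam * (ε / (lam + 1)) ≤ ε := by
      rw [mul_div_assoc', div_le_iff₀ (by positivity)]; nlinarith
    linarith
  intro η hη
  have hnear : ∀ᶠ t in 𝓝 (0:ℝ), ∫ x, ‖pZ x‖ ^ 2 ∂(ρ t) < e0 + η :=
    hec.continuousAt.eventually (gt_mem_nhds (by linarith : e0 < e0 + η))
  obtain ⟨ε, hε, hball⟩ := Metric.eventually_nhds_iff.1 hnear
  have hub : Tendsto (fun n : ℕ => (2 * (2 * C + 1) * m + M1) * (1 / ((n:ℝ) + 5)) + lam * (e0 + η)) atTop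
      (𝓝 (lam * (e0 + η))) := by
    simpa using (h1.const_mul (2 * (2 * C + 1) * m + M1)).add_const (lam * (e0 + η))
  refine le_of_tendsto_of_tendsto hlim hub ?_
  filter_upwards [h1.eventually (gt_mem_nhds (by linarith : 0 < ε / 2))] with n hn
  set δ := 1 / ((n:ℝ) + 5) with hδe
  have hδ : 0 < δ := by positivity
  have h4 : δ < 1/4 := by
    rw [hδe]; apply one_div_lt_one_div_of_lt (by norm_num)
    have : (0:ℝ) ≤ n := Nat.cast_nonneg n
    linarith
  refine (key3_step hΩ h hΩR hv hg hv2 hg2 hCE ha hb hC hC' hlam hR hcurve hδ h4).trans ?_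
  have w1 := weight_le hΩ h (chi1_deriv_cont δ) (chi1_deriv_nonneg hδ) (chi1_deriv_integral hδ h4)
    (f := fun x => (2 * C + 1) * δ + lam * ‖pZ x‖ ^ 2) (by fun_prop)
    (A := (2 * C + 1) * δ * m + lam * (e0 + η)) (by
      intro t ht
      have htm : t ∈ Icc δ (2 * δ) := by
        by_contra hh; exact ht (chi1_deriv_zero hδ hh)
      have := h.fin t
      rw [integral_add (integrable_const _) (integrable_cont hΩ h (by fun_prop) t), integral_const_mul lam]
      simp only [integral_const, smul_eq_mul]
      apply add_le_add
      · rw [mul_comm]; exact mul_le_mul_of_nonneg_left (hmass t) (by positivity : 0 ≤ (2 * C + 1) * δ)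
      · apply mul_le_mul_of_nonneg_left _ hlam
        apply (hball _).le
        rw [Real.dist_eq, sub_zero, abs_of_nonneg (by linarith [htm.1])]
        linarith [htm.2])
  have hcd := chi1_deriv_cont δ
  have w2 := weight_le hΩ h (w := fun t => deriv (chi1 δ) (1 - t)) (by fun_prop)
    (fun t => chi1_deriv_nonneg hδ _) (chi1_deriv_integral' hδ h4)
    (f := fun x => (2 * C + 1) * δ) (by fun_prop)
    (A := (2 * C + 1) * δ * m) (by
      intro t _
      simp only [integral_const, smul_eq_mul]
      rw [mul_comm]; exact mul_le_mul_of_nonneg_left (hmass t) (by positivity))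
  linarith

end

section

/-- reference measure: an atom at `-1` (initial value) and Lebesgue measure on `[0,1]` (derivative) -/
def nu : Measure ℝ := Measure.dirac (-1) + volume.restrict (Icc (0:ℝ) 1)

instance instFinNu : IsFiniteMeasure nu := by unfold nu; infer_instance

/-- the Hilbert space of (initial value, derivative) pairs -/
abbrev HH (d : ℕ) : Type := Lp (ZZ d) 2 nu

/-- value at time `t` -/
def zt (f : ℝ → ZZ d) (t : ℝ) : ZZ d := ∫ s in Iic t, f s ∂nu

lemma integrable_dirac' {F : Type*} [NormedAddCommGroup F] (f : ℝ → F) :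
    Integrable f (Measure.dirac (-1 : ℝ)) := by
  have : f =ᵐ[Measure.dirac (-1:ℝ)] fun _ => f (-1) := ae_eq_dirac f
  exact (integrable_congr this).2 (integrable_const _)

lemma integral_nu {F : Type*} [NormedAddCommGroup F] [NormedSpace ℝ F] [CompleteSpace F] {f : ℝ → F}
    (hf : Integrable f nu) : ∫ s, f s ∂nu = f (-1) + ∫ s in (0:ℝ)..1, f s := by
  have h2 : Integrable f (volume.restrict (Icc (0:ℝ) 1)) := hf.mono_measure (by
    unfold nu; exact Measure.le_add_left le_rfl)
  rw [nu, integral_add_measure (integrable_dirac' f) h2, integral_dirac,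
    intervalIntegral.integral_of_le zero_le_one, integral_Icc_eq_integral_Ioc]

lemma intInt_of_nu {F : Type*} [NormedAddCommGroup F] {f : ℝ → F}
    (hf : Integrable f nu) {s t : ℝ} (hs : s ∈ Icc (0:ℝ) 1) (ht : t ∈ Icc (0:ℝ) 1) :
    IntervalIntegrable f volume s t := by
  have h2 : IntegrableOn f (Icc (0:ℝ) 1) := hf.mono_measure (by
    unfold nu; exact Measure.le_add_left le_rfl)
  rw [intervalIntegrable_iff]
  refine h2.mono_set ?_
  intro x hx
  rw [uIoc, mem_Ioc] at hx
  exact ⟨(le_min hs.1 ht.1).trans hx.1.le, hx.2.trans (max_le hs.2 ht.2)⟩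

lemma zt_eq_zc {f : ℝ → ZZ d} (hf : Integrable f nu) {t : ℝ} (ht : t ∈ Icc (0:ℝ) 1) :
    zt f t = zc (f (-1)) f t := by
  have hI : Integrable ((Iic t).indicator f) nu := hf.indicator measurableSet_Iic
  rw [zt, ← integral_indicator measurableSet_Iic, integral_nu hI, zc]
  congr 1
  · rw [indicator_of_mem]; simp; linarith [ht.1]
  · rw [← intervalIntegral.integral_add_adjacent_intervals (intInt_of_nu hI ⟨le_rfl, zero_le_one⟩ ht)
      (intInt_of_nu hI ht ⟨zero_le_one, le_rfl⟩)]
    have h1 : ∫ s in (0:ℝ)..t, (Iic t).indicator f s = ∫ s in (0:ℝ)..t, f s := by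
      apply intervalIntegral.integral_congr_ae
      refine ae_of_all _ fun s hs => ?_
      rw [uIoc_of_le ht.1] at hs
      rw [indicator_of_mem]; exact hs.2
    have h2 : ∫ s in t..1, (Iic t).indicator f s = 0 := by
      apply intervalIntegral.integral_zero_ae
      refine ae_of_all _ fun s hs => ?_
      rw [uIoc_of_le ht.2] at hs
      rw [indicator_of_notMem]; simp; exact hs.1
    rw [h1, h2, add_zero]

lemma zt_congr {f g : ℝ → ZZ d} (h : f =ᵐ[nu] g) (t : ℝ) : zt f t = zt g t := by
  unfold zt
  exact setIntegral_congr_ae measurableSet_Iic (h.mono fun x hx _ => hx)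

lemma ae_nu_at {p : ℝ → Prop} (h : ∀ᵐ s ∂nu, p s) : p (-1) := by
  have : ∀ᵐ s ∂(Measure.dirac (-1:ℝ)), p s := by
    refine (Measure.absolutelyContinuous_of_le ?_).ae_le h
    unfold nu; exact Measure.le_add_right le_rfl
  rwa [ae_dirac_eq] at this

lemma ae_nu_vol {p : ℝ → Prop} (h : ∀ᵐ s ∂nu, p s) : ∀ᵐ s, s ∈ uIoc (0:ℝ) 1 → p s := by
  have : ∀ᵐ s ∂(volume.restrict (Icc (0:ℝ) 1)), p s := by
    refine (Measure.absolutelyContinuous_of_le ?_).ae_le h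
    unfold nu; exact Measure.le_add_left le_rfl
  rw [ae_restrict_iff' measurableSet_Icc] at this
  filter_upwards [this] with s hs h1
  rw [uIoc_of_le zero_le_one] at h1
  exact hs ⟨h1.1.le, h1.2⟩

lemma integrable_HH (ξ : HH d) : Integrable (ξ : ℝ → ZZ d) nu :=
  (Lp.memLp ξ).integrable (by norm_num)

lemma integrable_HH_sq (ξ : HH d) : Integrable (fun s => ‖ξ s‖ ^ 2) nu :=
  (Lp.memLp ξ).integrable_norm_pow (by norm_num)

lemma norm_HH_sq (ξ : HH d) : ‖ξ‖ ^ 2 = ‖ξ (-1)‖ ^ 2 + ∫ s in (0:ℝ)..1, ‖ξ s‖ ^ 2 := by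
  have h1 : ‖ξ‖ ^ 2 = ∫ s, ‖ξ s‖ ^ 2 ∂nu := by
    rw [← real_inner_self_eq_norm_sq, L2.inner_def]
    simp only [real_inner_self_eq_norm_sq]
  rw [h1, integral_nu (integrable_HH_sq ξ)]

lemma norm_setInt_le (ξ : HH d) {S : Set ℝ} (hS : MeasurableSet S) :
    ‖∫ s in S, ξ s ∂nu‖ ≤ Real.sqrt (nu.real S) * ‖ξ‖ := by
  set z := ∫ s in S, ξ s ∂nu
  have h1 := L2.inner_indicatorConstLp_eq_inner_setIntegral ℝ hS (measure_ne_top nu S) z ξ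
  have h2 := real_inner_le_norm (indicatorConstLp 2 hS (measure_ne_top nu S) z) ξ
  rw [h1, norm_indicatorConstLp (by norm_num) (by norm_num)] at h2
  change inner ℝ z z ≤ _ at h2
  rw [real_inner_self_eq_norm_sq] at h2
  rw [Real.sqrt_eq_rpow]
  simp only [ENNReal.toReal_ofNat] at h2
  by_cases hz : ‖z‖ = 0
  · rw [hz]; positivity
  · have hz' : 0 < ‖z‖ := lt_of_le_of_ne (norm_nonneg _) (Ne.symm hz)
    have : ‖z‖ * ‖z‖ ≤ ‖z‖ * (nu.real S ^ (1 / 2:ℝ) * ‖ξ‖) := by nlinarith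
    exact le_of_mul_le_mul_left this hz'

lemma nu_univ : nu.real univ = 2 := by
  unfold nu
  rw [measureReal_add_apply]
  simp [Measure.real]
  norm_num

lemma norm_zt_le (ξ : HH d) (t : ℝ) : ‖zt ξ t‖ ≤ 2 * ‖ξ‖ := by
  refine (norm_setInt_le ξ measurableSet_Iic).trans ?_
  gcongr
  have : nu.real (Iic t) ≤ 2 := by rw [← nu_univ]; exact measureReal_mono (subset_univ _)
  rw [Real.sqrt_le_left (by norm_num)]
  linarith

lemma nu_Ioc {s t : ℝ} (hs : 0 ≤ s) (hst : s ≤ t) : nu.real (Ioc s t) ≤ t - s := by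
  unfold nu
  rw [measureReal_add_apply]
  have h1 : (Measure.dirac (-1:ℝ)).real (Ioc s t) = 0 := by
    have hn : (-1:ℝ) ∉ Ioc s t := fun hh => by linarith [hh.1]
    rw [Measure.real, Measure.dirac_apply' _ measurableSet_Ioc, indicator_of_notMem hn]; simp
  rw [h1, zero_add]
  calc (volume.restrict (Icc (0:ℝ) 1)).real (Ioc s t) ≤ (volume : Measure ℝ).real (Ioc s t) := by
        apply ENNReal.toReal_mono
        · simp
        · exact Measure.restrict_apply_le _ _
    _ = t - s := by simp [Measure.real, hst]

lemma zt_sub_le (ξ : HH d) {s t : ℝ} (hs : 0 ≤ s) (hst : s ≤ t) :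
    ‖zt ξ t - zt ξ s‖ ≤ Real.sqrt (t - s) * ‖ξ‖ := by
  have hi := integrable_HH ξ
  have : zt ξ t - zt ξ s = ∫ u in Ioc s t, ξ u ∂nu := by
    unfold zt
    rw [← Iic_union_Ioc_eq_Iic hst, setIntegral_union _ measurableSet_Ioc hi.integrableOn hi.integrableOn]
    · abel
    · exact Set.Iic_disjoint_Ioc le_rfl
  rw [this]
  refine (norm_setInt_le ξ measurableSet_Ioc).trans ?_
  gcongr
  exact nu_Ioc hs hst

lemma zt_sub_le' (ξ : HH d) {s t : ℝ} (hs : 0 ≤ s) (ht : 0 ≤ t) :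
    ‖zt ξ t - zt ξ s‖ ≤ Real.sqrt |t - s| * ‖ξ‖ := by
  rcases le_total s t with h | h
  · rw [abs_of_nonneg (by linarith)]; exact zt_sub_le ξ hs h
  · rw [abs_of_nonpos (by linarith), norm_sub_rev, neg_sub]; exact zt_sub_le ξ ht h

lemma abs_clamp_sub (s t : ℝ) : |clamp s - clamp t| ≤ |s - t| := by
  unfold clamp
  refine (abs_max_sub_max_le_max _ _ _ _).trans (max_le (by simp) ?_)
  exact (abs_min_sub_min_le_max _ _ _ _).trans (by simp)

/-- the representing vector -/
def xi (f : WeakDual ℝ (HH d)) : HH d := (InnerProductSpace.toDual ℝ (HH d)).symm (WeakDual.toStrongDual f)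

lemma xi_inner (f : WeakDual ℝ (HH d)) (h : HH d) : inner ℝ (xi f) h = f h := by
  unfold xi
  rw [InnerProductSpace.toDual_symm_apply]; rfl

lemma norm_xi (f : WeakDual ℝ (HH d)) : ‖xi f‖ = ‖WeakDual.toStrongDual f‖ := by
  unfold xi; simp

lemma continuous_zt_xi (t : ℝ) : Continuous fun f : WeakDual ℝ (HH d) => zt (xi f) t := by
  have h : ∀ e : ZZ d, Continuous fun f : WeakDual ℝ (HH d) => inner ℝ e (zt (xi f) t) := by
    intro e
    have : (fun f : WeakDual ℝ (HH d) => inner ℝ e (zt (xi f) t)) =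
        fun f => f (indicatorConstLp 2 (measurableSet_Iic (a := t)) (measure_ne_top nu _) e) := by
      ext1 f
      rw [← xi_inner, real_inner_comm _ (xi f), L2.inner_indicatorConstLp_eq_inner_setIntegral]
      rfl
    rw [this]
    exact WeakDual.eval_continuous _
  have h2 : (fun f : WeakDual ℝ (HH d) => zt (xi f) t) = fun f =>
      ∑ i, inner ℝ ((stdOrthonormalBasis ℝ (ZZ d)) i) (zt (xi f) t) • (stdOrthonormalBasis ℝ (ZZ d)) i := by
    ext1 f
    rw [OrthonormalBasis.sum_repr']
  rw [h2]
  exact continuous_finsetSum _ fun i _ => (h _).smul continuous_const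

/-- compact space of paths -/
def KKset (d : ℕ) (R : ℝ) : Set (WeakDual ℝ (HH d)) :=
  {f | ‖xi f‖ ≤ 1 ∧ ∀ t ∈ Icc (0:ℝ) 1, InCone R (zt (xi f) t)}

lemma isCompact_KKset (R : ℝ) : IsCompact (KKset d R) := by
  have h1 := WeakDual.isCompact_closedBall (𝕜 := ℝ) (0 : StrongDual ℝ (HH d)) 1
  have h2 : KKset d R = (WeakDual.toStrongDual ⁻¹' Metric.closedBall (0 : StrongDual ℝ (HH d)) 1) ∩
      ⋂ t ∈ Icc (0:ℝ) 1, {f | InCone R (zt (xi f) t)} := by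
    ext f
    simp [KKset, norm_xi]
  rw [h2]
  apply h1.inter_right
  refine isClosed_biInter fun t _ => ?_
  have := continuous_zt_xi (d := d) t
  unfold InCone
  exact isClosed_le (by fun_prop) (by fun_prop)

def KK (d : ℕ) (R : ℝ) : Type := KKset d R

instance (R : ℝ) : TopologicalSpace (KK d R) := inferInstanceAs (TopologicalSpace (KKset d R))
instance (R : ℝ) : T2Space (KK d R) := inferInstanceAs (T2Space (KKset d R))
instance (R : ℝ) : CompactSpace (KK d R) := isCompact_iff_compactSpace.1 (isCompact_KKset R)
instance (R : ℝ) : MeasurableSpace (KK d R) := borel _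
instance (R : ℝ) : BorelSpace (KK d R) := ⟨rfl⟩

/-- derivative of a path -/
def xk {R : ℝ} (k : KK d R) : HH d := xi k.1
/-- value of a path -/
def Zk {R : ℝ} (t : ℝ) (k : KK d R) : ZZ d := zt (xk k) (clamp t)

lemma norm_xk {R : ℝ} (k : KK d R) : ‖xk k‖ ≤ 1 := k.2.1

lemma norm_Zk {R : ℝ} (t : ℝ) (k : KK d R) : ‖Zk t k‖ ≤ 2 :=
  (norm_zt_le _ _).trans (by linarith [norm_xk k])

lemma cone_Zk {R : ℝ} (t : ℝ) (k : KK d R) : InCone R (Zk t k) := k.2.2 _ (clamp_mem t)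

lemma continuous_xk {R : ℝ} (h : HH d) : Continuous fun k : KK d R => inner ℝ (xk k) h := by
  have : (fun k : KK d R => inner ℝ (xk k) h) = fun k => k.1 h := by
    ext1 k; exact xi_inner _ _
  rw [this]
  exact (WeakDual.eval_continuous h).comp continuous_subtype_val

lemma continuous_Zk {R : ℝ} : Continuous fun p : ℝ × KK d R => Zk p.1 p.2 := by
  rw [continuous_iff_continuousAt]
  rintro ⟨t0, k0⟩
  rw [ContinuousAt, tendsto_iff_norm_sub_tendsto_zero]
  have hc : Continuous fun k : KK d R => Zk t0 k :=
    (continuous_zt_xi (clamp t0)).comp continuous_subtype_val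
  have hub : Continuous fun p : ℝ × KK d R => Real.sqrt |p.1 - t0| + ‖Zk t0 p.2 - Zk t0 k0‖ := by
    have := hc.comp (continuous_snd (X := ℝ) (Y := KK d R))
    have h3 : Continuous fun p : ℝ × KK d R => Zk t0 p.2 := this
    fun_prop
  have hub2 := hub.tendsto (t0, k0)
  simp only [sub_self, abs_zero, Real.sqrt_zero, norm_zero, add_zero] at hub2
  refine squeeze_zero (fun _ => norm_nonneg _) (fun p => ?_) hub2
  have e : Zk p.1 p.2 - Zk t0 k0 = (Zk p.1 p.2 - Zk t0 p.2) + (Zk t0 p.2 - Zk t0 k0) := by abel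
  rw [e]
  refine (norm_add_le _ _).trans (add_le_add ?_ le_rfl)
  refine (zt_sub_le' _ (clamp_mem t0).1 (clamp_mem p.1).1).trans ?_
  calc _ ≤ Real.sqrt |clamp p.1 - clamp t0| * 1 := by gcongr; exact norm_xk _
    _ ≤ _ := by rw [mul_one]; exact Real.sqrt_le_sqrt (abs_clamp_sub _ _)

lemma exists_KK {R : ℝ} {f : WeakDual ℝ (HH d)} (h : f ∈ KKset d R) :
    ∃ k : KK d R, xk k = xi f := ⟨⟨f, h⟩, rfl⟩

lemma Zk_def {R : ℝ} (t : ℝ) (k : KK d R) : Zk t k = zt (xk k) (clamp t) := rfl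

attribute [irreducible] Zk xk zt xi

end

section

lemma continuous_sc {F : Type*} [NormedAddCommGroup F] [NormedSpace ℝ F] {c : XX d → F}
    (hc : Continuous c) {C : ℝ} (hC : ∀ p, ‖c p‖ ≤ C) :
    Continuous fun p : ℝ × ZZ d => fstZ d p.2 • c (p.1, gam p.2) := by
  rw [continuous_iff_continuousAt]
  rintro ⟨t0, z0⟩
  by_cases h0 : fstZ d z0 = 0
  · rw [ContinuousAt, tendsto_iff_norm_sub_tendsto_zero]
    simp only [h0, zero_smul, sub_zero]
    have hub : Tendsto (fun p : ℝ × ZZ d => ‖fstZ d p.2‖ * C) (𝓝 (t0, z0)) (𝓝 0) := by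
      have : Continuous fun p : ℝ × ZZ d => ‖fstZ d p.2‖ * C := by fun_prop
      simpa [h0] using this.tendsto (t0, z0)
    refine squeeze_zero (fun _ => norm_nonneg _) (fun p => ?_) hub
    rw [norm_smul]
    exact mul_le_mul_of_nonneg_left (hC _) (norm_nonneg _)
  · have h1 : ContinuousAt (fun p : ℝ × ZZ d => fstZ d p.2) (t0, z0) := by fun_prop
    have h2 : ContinuousAt (fun p : ℝ × ZZ d => gam p.2) (t0, z0) := by
      unfold gam
      exact (h1.inv₀ h0).smul (by fun_prop)
    have h3 : ContinuousAt (fun p : ℝ × ZZ d => c (p.1, gam p.2)) (t0, z0) :=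
      ContinuousAt.comp (g := c) hc.continuousAt (continuousAt_fst.prodMk h2)
    exact h1.smul h3

lemma continuous_scZ {R : ℝ} {F : Type*} [NormedAddCommGroup F] [NormedSpace ℝ F] {c : XX d → F}
    (hc : Continuous c) {C : ℝ} (hC : ∀ p, ‖c p‖ ≤ C) :
    Continuous fun p : ℝ × KK d R => fstZ d (Zk p.1 p.2) • c (p.1, gam (Zk p.1 p.2)) :=
  (continuous_sc hc hC).comp (continuous_fst.prodMk continuous_Zk)

lemma continuous_rZ {R : ℝ} : Continuous fun p : ℝ × KK d R => fstZ d (Zk p.1 p.2) :=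
  (fstZ d).continuous.comp continuous_Zk

lemma continuous_aZ {R : ℝ} {a : XX d → ℝ}
    (ha : Continuous a) {C : ℝ} (hC : ∀ p, |a p| ≤ C) :
    Continuous fun p : ℝ × KK d R => (fstZ d (Zk p.1 p.2)) ^ 2 * a (p.1, gam (Zk p.1 p.2)) := by
  have := (continuous_rZ (d := d) (R := R)).mul (continuous_scZ (R := R) ha hC)
  refine this.congr fun p => ?_
  simp; ring

def bfun {R : ℝ} (b : XX d → ZZ d) (k : KK d R) (s : ℝ) : ZZ d :=
  fstZ d (Zk s k) • b (s, gam (Zk s k))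

lemma continuous_bfun {R : ℝ} {b : XX d → ZZ d} (hb : Continuous b) {C : ℝ} (hC : ∀ p, ‖b p‖ ≤ C)
    (k : KK d R) : Continuous (bfun b k) :=
  Continuous.comp (g := fun p : ℝ × KK d R => fstZ d (Zk p.1 p.2) • b (p.1, gam (Zk p.1 p.2)))
    (f := fun s : ℝ => (s, k)) (continuous_scZ (R := R) hb hC) (by fun_prop)

lemma norm_bfun {R : ℝ} {b : XX d → ZZ d} {C : ℝ} (hC : ∀ p, ‖b p‖ ≤ C)
    (k : KK d R) (s : ℝ) : ‖bfun b k s‖ ≤ 2 * C := by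
  unfold bfun
  rw [norm_smul]
  exact mul_le_mul ((abs_fstZ_le _).trans (norm_Zk s k)) (hC _) (norm_nonneg _) (by norm_num)

lemma memLp_bfun {R : ℝ} {b : XX d → ZZ d} (hb : Continuous b) {C : ℝ} (hC : ∀ p, ‖b p‖ ≤ C)
    (k : KK d R) : MemLp ((Ici (0:ℝ)).indicator (bfun b k)) 2 nu := by
  refine MemLp.of_bound ((continuous_bfun hb hC k).measurable.indicator measurableSet_Ici).aestronglyMeasurable
    (2 * C) (ae_of_all _ fun s => ?_)
  exact (norm_indicator_le_norm_self _ _).trans (norm_bfun hC k s)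

def betaH {R : ℝ} {b : XX d → ZZ d} (hb : Continuous b) {C : ℝ} (hC : ∀ p, ‖b p‖ ≤ C)
    (k : KK d R) : HH d := (memLp_bfun hb hC k).toLp _

lemma betaH_inner {R : ℝ} {b : XX d → ZZ d} (hb : Continuous b) {C : ℝ} (hC : ∀ p, ‖b p‖ ≤ C)
    (k k' : KK d R) : inner ℝ (xk k') (betaH hb hC k) = ∫ s in (0:ℝ)..1, inner ℝ (bfun b k s) (xk k' s) := by
  rw [L2.inner_def, integral_nu (L2.integrable_inner _ _)]
  have hae : ∀ᵐ s ∂nu, betaH hb hC k s = (Ici (0:ℝ)).indicator (bfun b k) s := MemLp.coeFn_toLp _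
  rw [ae_nu_at hae, indicator_of_notMem (by simp), inner_zero_right, zero_add]
  apply intervalIntegral.integral_congr_ae
  filter_upwards [ae_nu_vol hae] with s hs hm
  rw [hs hm, indicator_of_mem, real_inner_comm]
  rw [uIoc_of_le zero_le_one] at hm
  exact hm.1.le

lemma betaH_sub {R : ℝ} {b : XX d → ZZ d} (hb : Continuous b) {C : ℝ} (hC : ∀ p, ‖b p‖ ≤ C)
    (k k' : KK d R) : ‖betaH hb hC k - betaH hb hC k'‖ ^ 2 =
      ∫ s in (0:ℝ)..1, ‖bfun b k s - bfun b k' s‖ ^ 2 := by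
  have hae : ∀ᵐ s ∂nu, betaH hb hC k s = (Ici (0:ℝ)).indicator (bfun b k) s := MemLp.coeFn_toLp _
  have hae' : ∀ᵐ s ∂nu, betaH hb hC k' s = (Ici (0:ℝ)).indicator (bfun b k') s := MemLp.coeFn_toLp _
  have hs := Lp.coeFn_sub (betaH hb hC k) (betaH hb hC k')
  have h3 : ∀ᵐ s ∂nu, (betaH hb hC k - betaH hb hC k' : HH d) s =
      (Ici (0:ℝ)).indicator (bfun b k) s - (Ici (0:ℝ)).indicator (bfun b k') s := by
    filter_upwards [hae, hae', hs] with s h1 h2 h3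
    rw [h3, Pi.sub_apply, h1, h2]
  rw [norm_HH_sq, ae_nu_at h3, indicator_of_notMem (by simp), indicator_of_notMem (by simp)]
  simp only [sub_self, norm_zero, ne_eq, OfNat.ofNat_ne_zero, not_false_eq_true, zero_pow, zero_add]
  apply intervalIntegral.integral_congr_ae
  filter_upwards [ae_nu_vol h3] with s hs hm
  rw [hs hm]
  rw [uIoc_of_le zero_le_one] at hm
  rw [indicator_of_mem (show s ∈ Ici (0:ℝ) from hm.1.le), indicator_of_mem (show s ∈ Ici (0:ℝ) from hm.1.le)]

lemma continuous_LB {R : ℝ} {b : XX d → ZZ d} (hb : Continuous b) {C : ℝ} (hC : ∀ p, ‖b p‖ ≤ C) :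
    Continuous fun k : KK d R => ∫ s in (0:ℝ)..1, inner ℝ (bfun b k s) (xk k s) := by
  simp only [← betaH_inner hb hC]
  rw [continuous_iff_continuousAt]
  intro k0
  rw [ContinuousAt, tendsto_iff_norm_sub_tendsto_zero]
  have h1 : Continuous fun k : KK d R => ‖betaH hb hC k - betaH hb hC k0‖ := by
    have e : (fun k : KK d R => ‖betaH hb hC k - betaH hb hC k0‖) =
        fun k => Real.sqrt (∫ s in (0:ℝ)..1, ‖bfun b k s - bfun b k0 s‖ ^ 2) := by
      ext1 k
      rw [← betaH_sub hb hC, Real.sqrt_sq (norm_nonneg _)]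
    rw [e]
    apply Real.continuous_sqrt.comp
    apply intervalIntegral.continuous_parametric_intervalIntegral_of_continuous'
    have c1 : Continuous fun p : KK d R × ℝ => bfun b p.1 p.2 :=
      Continuous.comp (g := fun p : ℝ × KK d R => fstZ d (Zk p.1 p.2) • b (p.1, gam (Zk p.1 p.2)))
        (f := fun p : KK d R × ℝ => (p.2, p.1)) (continuous_scZ (R := R) hb hC) (by fun_prop)
    have c2 : Continuous fun p : KK d R × ℝ => bfun b k0 p.2 :=
      (continuous_bfun hb hC k0).comp continuous_snd
    exact ((c1.sub c2).norm).pow 2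
  have h2 : Continuous fun k : KK d R => ‖betaH hb hC k - betaH hb hC k0‖ +
      ‖(inner ℝ (xk k) (betaH hb hC k0) : ℝ) - inner ℝ (xk k0) (betaH hb hC k0)‖ :=
    h1.add ((continuous_xk _).sub continuous_const).norm
  have h3 := h2.tendsto k0
  simp only [sub_self, norm_zero, add_zero] at h3
  refine squeeze_zero (fun _ => norm_nonneg _) (fun k => ?_) h3
  have e : (inner ℝ (xk k) (betaH hb hC k) : ℝ) - inner ℝ (xk k0) (betaH hb hC k0) =
      inner ℝ (xk k) (betaH hb hC k - betaH hb hC k0) +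
      (inner ℝ (xk k) (betaH hb hC k0) - inner ℝ (xk k0) (betaH hb hC k0)) := by
    rw [inner_sub_right]; ring
  rw [e]
  refine (norm_add_le _ _).trans (add_le_add ?_ le_rfl)
  refine (norm_inner_le_norm _ _).trans ?_
  exact mul_le_of_le_one_left (norm_nonneg _) (norm_xk k)

/-- pairing of a path with the test pair `(a,b)` -/
def LL {R : ℝ} (a : XX d → ℝ) (b : XX d → ZZ d) (k : KK d R) : ℝ :=
  (∫ s in (0:ℝ)..1, (fstZ d (Zk s k)) ^ 2 * a (s, gam (Zk s k))) +
    ∫ s in (0:ℝ)..1, inner ℝ (bfun b k s) (xk k s)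

lemma continuous_LA {R : ℝ} {a : XX d → ℝ} (ha : Continuous a) {C : ℝ} (hC : ∀ p, |a p| ≤ C) :
    Continuous fun k : KK d R => ∫ s in (0:ℝ)..1, (fstZ d (Zk s k)) ^ 2 * a (s, gam (Zk s k)) := by
  apply intervalIntegral.continuous_parametric_intervalIntegral_of_continuous'
  exact Continuous.comp (g := fun p : ℝ × KK d R => (fstZ d (Zk p.1 p.2)) ^ 2 * a (p.1, gam (Zk p.1 p.2)))
        (f := fun p : KK d R × ℝ => (p.2, p.1)) (continuous_aZ (R := R) ha hC) (by fun_prop)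

lemma continuous_LL {R : ℝ} {a : XX d → ℝ} {b : XX d → ZZ d} (ha : Continuous a) (hb : Continuous b)
    {C C' : ℝ} (hC : ∀ p, |a p| ≤ C) (hC' : ∀ p, ‖b p‖ ≤ C') : Continuous (LL (R := R) a b) :=
  (continuous_LA ha hC).add (continuous_LB hb hC')

lemma ii_aZ {R : ℝ} {a : XX d → ℝ} (ha : Continuous a) {C : ℝ} (hC : ∀ p, |a p| ≤ C) (k : KK d R) :
    IntervalIntegrable (fun s => (fstZ d (Zk s k)) ^ 2 * a (s, gam (Zk s k))) volume 0 1 :=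
  (Continuous.comp (g := fun p : ℝ × KK d R => (fstZ d (Zk p.1 p.2)) ^ 2 * a (p.1, gam (Zk p.1 p.2)))
        (f := fun s : ℝ => (s, k)) (continuous_aZ (R := R) ha hC) (by fun_prop)).intervalIntegrable _ _

lemma ii_bZ {R : ℝ} {b : XX d → ZZ d} (hb : Continuous b) {C : ℝ} (hC : ∀ p, ‖b p‖ ≤ C) (k : KK d R) :
    IntervalIntegrable (fun s => (inner ℝ (bfun b k s) (xk k s) : ℝ)) volume 0 1 := by
  have h1 : Integrable (fun s => 2 * C * ‖xk k s‖) nu := (integrable_HH (xk k)).norm.const_mul _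
  have h2 : Integrable (fun s => (inner ℝ (bfun b k s) (xk k s) : ℝ)) nu := by
    refine h1.mono' ?_ (ae_of_all _ fun s => ?_)
    · exact (continuous_bfun hb hC k).aestronglyMeasurable.inner (integrable_HH (xk k)).aestronglyMeasurable
    · refine (norm_inner_le_norm _ _).trans ?_
      exact mul_le_mul_of_nonneg_right (norm_bfun hC k s) (norm_nonneg _)
  exact intInt_of_nu h2 ⟨le_rfl, zero_le_one⟩ ⟨zero_le_one, le_rfl⟩

lemma LL_eq_pay {R : ℝ} {a : XX d → ℝ} {b : XX d → ZZ d} (ha : Continuous a) (hb : Continuous b)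
    {C C' : ℝ} (hC : ∀ p, |a p| ≤ C) (hC' : ∀ p, ‖b p‖ ≤ C') (k : KK d R) :
    LL a b k = ∫ s in (0:ℝ)..1, pay a b s (Zk s k) (xk k s) := by
  unfold LL
  rw [← intervalIntegral.integral_add (ii_aZ ha hC k) (ii_bZ hb hC' k)]
  simp only [pay, bfun, real_inner_smul_left]

lemma pay_hom (a : XX d → ℝ) (b : XX d → ZZ d) (t : ℝ) (z q : ZZ d) {c : ℝ} (hc : c ≠ 0) :
    pay a b t (c • z) (c • q) = c ^ 2 * pay a b t z q := by
  have : gam (c • z) = gam z := by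
    unfold gam
    rw [map_smul, map_smul, smul_smul]
    simp [hc]
  unfold pay
  rw [this, inner_smul_right, map_smul, smul_eq_mul]
  ring

lemma curveHyp_of_LL {R : ℝ} {a : XX d → ℝ} {b : XX d → ZZ d} (ha : Continuous a) (hb : Continuous b)
    {C C' : ℝ} (hC : ∀ p, |a p| ≤ C) (hC' : ∀ p, ‖b p‖ ≤ C') {lam : ℝ}
    (h : ∀ k : KK d R, LL a b k ≤ lam) : CurveHyp a b lam R := by
  intro z0 q hq hqb hcone
  obtain ⟨B, hB⟩ := hqb
  set N := ‖z0‖ ^ 2 + ∫ t in (0:ℝ)..1, ‖q t‖ ^ 2 with hN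
  have hq2 : 0 ≤ ∫ t in (0:ℝ)..1, ‖q t‖ ^ 2 :=
    intervalIntegral.integral_nonneg zero_le_one (fun _ _ => by positivity)
  have hN0 : 0 ≤ N := by positivity
  rcases hN0.eq_or_lt with h0 | hpos
  · have hz0 : z0 = 0 := by
      have : ‖z0‖ ^ 2 = 0 := by nlinarith [sq_nonneg ‖z0‖]
      simpa using this
    have hi : ∫ t in (0:ℝ)..1, ‖q t‖ ^ 2 = 0 := by nlinarith [sq_nonneg ‖z0‖]
    have hae : ∀ᵐ t ∂(volume.restrict (Ioc (0:ℝ) 1)), q t = 0 := by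
      rw [intervalIntegral.integral_of_le zero_le_one, integral_eq_zero_iff_of_nonneg
        (fun _ => by positivity)] at hi
      · filter_upwards [hi] with t ht; simpa using ht
      · exact (intervalIntegrable_iff_integrableOn_Ioc_of_le zero_le_one).1 (ii_q2 hq ⟨B, hB⟩ 0 1)
    have hz : ∀ t ∈ Icc (0:ℝ) 1, zc z0 q t = 0 := by
      intro t ht
      rw [zc, hz0, zero_add]
      apply intervalIntegral.integral_zero_ae
      rw [ae_restrict_iff' measurableSet_Ioc] at hae
      filter_upwards [hae] with s hs hm
      rw [uIoc_of_le ht.1] at hm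
      exact hs ⟨hm.1, hm.2.trans ht.2⟩
    rw [← h0, mul_zero]
    apply le_of_eq
    rw [intervalIntegral.integral_congr (g := fun _ => 0)]
    · simp
    · intro t ht
      rw [uIcc_of_le zero_le_one] at ht
      simp [hz t ht, pay]
  set c := (Real.sqrt N)⁻¹ with hc
  have hsq : 0 < Real.sqrt N := Real.sqrt_pos.2 hpos
  have hc0 : 0 < c := inv_pos.2 hsq
  have hcN : c ^ 2 * N = 1 := by
    rw [hc, inv_pow, Real.sq_sqrt hN0, inv_mul_cancel₀ hpos.ne']
  set f : ℝ → ZZ d := fun s => if s = -1 then c • z0 else c • q s with hf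
  have hfm : Measurable f := Measurable.ite (measurableSet_singleton _) measurable_const (hq.const_smul c)
  have hfL : MemLp f 2 nu := by
    refine MemLp.of_bound hfm.aestronglyMeasurable (max (c * ‖z0‖) (c * B)) (ae_of_all _ fun s => ?_)
    by_cases hs : s = -1
    · simp only [hf, hs, if_true, norm_smul, Real.norm_of_nonneg hc0.le]; exact le_max_left _ _
    · simp only [hf, hs, if_false, norm_smul, Real.norm_of_nonneg hc0.le]
      exact le_max_of_le_right (mul_le_mul_of_nonneg_left (hB s) hc0.le)
  set ξ : HH d := hfL.toLp f with hξ
  have hξf : ∀ᵐ s ∂nu, ξ s = f s := MemLp.coeFn_toLp _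
  have hfs : ∀ s, 0 < s → f s = c • q s := fun s hs => by
    simp only [hf]; rw [if_neg]; linarith
  have hnorm : ‖ξ‖ ^ 2 = 1 := by
    rw [norm_HH_sq, ae_nu_at hξf]
    have e1 : ‖f (-1)‖ ^ 2 = c ^ 2 * ‖z0‖ ^ 2 := by simp [hf, norm_smul, mul_pow]
    have e2 : ∫ s in (0:ℝ)..1, ‖ξ s‖ ^ 2 = c ^ 2 * ∫ s in (0:ℝ)..1, ‖q s‖ ^ 2 := by
      rw [← intervalIntegral.integral_const_mul]
      apply intervalIntegral.integral_congr_ae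
      filter_upwards [ae_nu_vol hξf] with s hs hm
      rw [hs hm]
      rw [uIoc_of_le zero_le_one] at hm
      rw [hfs s hm.1, norm_smul, mul_pow]; simp
    rw [e1, e2, ← mul_add, ← hN, hcN]
  have hztz : ∀ t ∈ Icc (0:ℝ) 1, zt ξ t = c • zc z0 q t := by
    intro t ht
    rw [zt_congr hξf, zt_eq_zc (hfL.integrable (by norm_num)) ht, zc, zc, smul_add,
      ← intervalIntegral.integral_smul]
    congr 1
    · simp [hf]
    · apply intervalIntegral.integral_congr_ae
      refine ae_of_all _ fun s hs => ?_
      rw [uIoc_of_le ht.1] at hs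
      exact hfs s hs.1
  set φ : WeakDual ℝ (HH d) := WeakDual.toStrongDual.symm (InnerProductSpace.toDual ℝ (HH d) ξ)
  have hxi : xi φ = ξ := by
    simp [xi, φ]
  have hmem : φ ∈ KKset d R := by
    refine ⟨?_, fun t ht => ?_⟩
    · rw [hxi]; nlinarith [norm_nonneg ξ]
    · rw [hxi, hztz t ht]
      have := hcone t ht
      unfold InCone at this ⊢
      rw [map_smul, map_smul, norm_smul, Real.norm_of_nonneg hc0.le, smul_eq_mul]
      nlinarith
  obtain ⟨k, hkx⟩ : ∃ k : KK d R, xk k = ξ := by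
    obtain ⟨k, hk⟩ := exists_KK hmem
    exact ⟨k, hk.trans hxi⟩
  have hk := h k
  rw [LL_eq_pay ha hb hC hC'] at hk
  have e3 : ∫ s in (0:ℝ)..1, pay a b s (Zk s k) (xk k s) =
      c ^ 2 * ∫ s in (0:ℝ)..1, pay a b s (zc z0 q s) (q s) := by
    rw [← intervalIntegral.integral_const_mul]
    apply intervalIntegral.integral_congr_ae
    filter_upwards [ae_nu_vol hξf] with s hs hm
    rw [Zk, hkx, hs hm]
    rw [uIoc_of_le zero_le_one] at hm
    have hmm : s ∈ Icc (0:ℝ) 1 := ⟨hm.1.le, hm.2⟩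
    rw [hfs s hm.1, clamp_of_mem hmm, hztz s hmm, pay_hom _ _ _ _ _ hc0.ne']
  rw [e3] at hk
  have : N * (c ^ 2 * ∫ s in (0:ℝ)..1, pay a b s (zc z0 q s) (q s)) ≤ N * lam :=
    mul_le_mul_of_nonneg_left hk hN0
  have e5 : N * (c ^ 2 * ∫ s in (0:ℝ)..1, pay a b s (zc z0 q s) (q s)) = ∫ s in (0:ℝ)..1, pay a b s (zc z0 q s) (q s) := by
    rw [← mul_assoc, mul_comm N, hcN, one_mul]
  linarith

end

section

lemma hb_riesz {X E : Type*} [TopologicalSpace X] [T2Space X] [CompactSpace X] [MeasurableSpace X]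
    [BorelSpace X] [AddCommGroup E] [Module ℝ E] (T : E →ₗ[ℝ] C(X, ℝ)) (Λ : E →ₗ[ℝ] ℝ) (M : ℝ)
    (hM : 0 ≤ M)
    (h : ∀ e lam, 0 ≤ lam → (∀ x, T e x ≤ lam) → Λ e ≤ lam * M) :
    ∃ σ : Measure X, IsFiniteMeasure σ ∧ σ.Regular ∧ (∀ e, ∫ x, T e x ∂σ = Λ e) ∧
      σ.real univ ≤ M := by
  set N : C(X, ℝ) → ℝ := fun f => ‖f ⊔ 0‖ * M with hN
  have hle : ∀ (f : C(X, ℝ)) x, f x ≤ ‖f ⊔ 0‖ := fun f x =>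
    (le_sup_left.trans (le_abs_self _)).trans ((f ⊔ 0).norm_coe_le_norm x)
  have hN_hom : ∀ c : ℝ, 0 < c → ∀ f, N (c • f) = c * N f := by
    intro c hc f
    have : (c • f) ⊔ 0 = c • (f ⊔ 0) := by
      ext x
      simp only [ContinuousMap.sup_apply, ContinuousMap.smul_apply, smul_eq_mul, ContinuousMap.zero_apply]
      rw [mul_max_of_nonneg _ _ hc.le, mul_zero]
    simp only [hN]
    rw [this, norm_smul, Real.norm_of_nonneg hc.le, mul_assoc]
  have hN_add : ∀ f g, N (f + g) ≤ N f + N g := by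
    intro f g
    simp only [hN]
    rw [← add_mul]
    refine mul_le_mul_of_nonneg_right ?_ hM
    rw [ContinuousMap.norm_le _ (by positivity)]
    intro x
    rw [Real.norm_of_nonneg (by simp)]
    simp only [ContinuousMap.sup_apply, ContinuousMap.add_apply, ContinuousMap.zero_apply]
    exact max_le (add_le_add (hle f x) (hle g x)) (by positivity)
  have hN0 : N 0 = 0 := by simp [hN]
  let f0 : (E × C(X, ℝ)) →ₗ.[ℝ] ℝ :=
    { domain := LinearMap.ker (LinearMap.snd ℝ E C(X, ℝ))
      toFun := (Λ ∘ₗ LinearMap.fst ℝ E C(X, ℝ)) ∘ₗ (LinearMap.ker (LinearMap.snd ℝ E C(X, ℝ))).subtype }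
  obtain ⟨G, hG1, hG2⟩ := exists_extension_of_le_sublinear f0 (fun p => N (T p.1 + p.2))
    (by
      intro c hc p
      rw [← hN_hom c hc]
      simp)
    (by
      intro p q
      refine le_trans (le_of_eq ?_) (hN_add _ _)
      simp only [Prod.fst_add, Prod.snd_add, map_add]
      congr 1; abel)
    (by
      rintro ⟨⟨e, f⟩, hf⟩
      have hf' : f = 0 := hf
      subst hf'
      change Λ e ≤ N (T e + 0)
      rw [add_zero]
      exact h e _ (norm_nonneg _) (hle _))
  have hGe : ∀ e, G (e, 0) = Λ e := fun e => hG1 ⟨(e, 0), rfl⟩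
  have hGN : ∀ f, G (0, f) ≤ N f := fun f => by simpa using hG2 (0, f)
  have hGT : ∀ e, G (0, T e) = Λ e := by
    intro e
    have key : ∀ e, Λ e - G (0, T e) ≤ 0 := by
      intro e
      have := hG2 (e, - T e)
      simp only [add_neg_cancel, hN0] at this
      have e2 : ((e, - T e) : E × C(X, ℝ)) = (e, 0) - (0, T e) := by simp
      rw [e2, map_sub, hGe] at this
      exact this
    have h1 := key e
    have h2 := key (-e)
    have e2 : ((0, T (-e)) : E × C(X, ℝ)) = - (0, T e) := by simp
    rw [e2, map_neg, map_neg] at h2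
    linarith
  have hGpos : ∀ f : C(X, ℝ), 0 ≤ f → 0 ≤ G (0, f) := by
    intro f hf
    have := hGN (-f)
    have e2 : ((0, -f) : E × C(X, ℝ)) = - (0, f) := by simp
    have e3 : (-f) ⊔ 0 = 0 := sup_eq_right.2 (by simpa using hf)
    rw [e2, map_neg] at this
    simp only [hN, e3, norm_zero, zero_mul] at this
    linarith
  let Γ : CompactlySupportedContinuousMap X ℝ →ₚ[ℝ] ℝ :=
    { toFun := fun f => G (0, f.toContinuousMap)
      map_add' := fun f f' => by
        rw [← map_add]
        congr 1
        simp only [Prod.mk_add_mk, add_zero]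
        rfl
      map_smul' := fun c f => by
        simp only [RingHom.id_apply]
        rw [← map_smul]
        congr 1
        simp only [Prod.smul_mk, smul_zero]
        rfl
      monotone' := fun f f' hff => by
        have := hGpos (f'.toContinuousMap - f.toContinuousMap) (sub_nonneg.2 hff)
        have e2 : ((0, f'.toContinuousMap - f.toContinuousMap) : E × C(X, ℝ)) =
          (0, f'.toContinuousMap) - (0, f.toContinuousMap) := by simp
        rw [e2, map_sub] at this
        exact sub_nonneg.1 this }
  have hInt : ∀ f : C(X, ℝ), ∫ x, f x ∂(RealRMK.rieszMeasure Γ) = G (0, f) := by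
    intro f
    exact RealRMK.integral_rieszMeasure Γ
      ⟨f, HasCompactSupport.of_compactSpace _⟩
  refine ⟨RealRMK.rieszMeasure Γ, inferInstance, inferInstance, fun e => ?_, ?_⟩
  · rw [hInt, hGT]
  · have h1 := hInt 1
    have h2 := hGN 1
    simp only [ContinuousMap.one_apply, integral_const, smul_eq_mul, mul_one] at h1
    rw [h1]
    refine h2.trans ?_
    simp only [hN]
    refine mul_le_of_le_one_left hM ?_
    rw [ContinuousMap.norm_le _ zero_le_one]
    intro x; simp

/-- the cone velocity field -/
def VV (v : XX d → Euc d) (g : XX d → ℝ) (p : XX d) : ZZ d := qf (v p) (g p) p.2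

end

section

lemma measurable_VV {v : XX d → Euc d} {g : XX d → ℝ} (hv : Measurable v) (hg : Measurable g) :
    Measurable (VV v g) := by
  have := (continuous_pZ (d := d)).measurable
  unfold VV qf
  exact ((hg.div_const 2).smul (this.comp measurable_snd)).add ((jZ d).measurable.comp hv)

lemma integrable_VV2 {Ω : Set (Euc d)} (hΩ : IsCompact Ω) {ρ : ℝ → Measure (Euc d)} (h : Good Ω ρ)
    {R : ℝ} (hR : 1 ≤ R) (hΩR : ∀ x ∈ Ω, ‖x‖ ≤ R - 1)
    {v : XX d → Euc d} {g : XX d → ℝ} (hv : Measurable v) (hg : Measurable g)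
    (hv2 : Integrable (fun p => ‖v p‖ ^ 2) (PP h)) (hg2 : Integrable (fun p => g p ^ 2) (PP h)) :
    Integrable (fun p => ‖VV v g p‖ ^ 2) (PP h) := by
  have hi : Integrable (fun p => R ^ 2 * (2 * g p ^ 2 + 2 * ‖v p‖ ^ 2)) (PP h) :=
    ((hg2.const_mul 2).add (hv2.const_mul 2)).const_mul _
  refine hi.mono' ((measurable_VV hv hg).norm.pow_const 2).aestronglyMeasurable ?_
  filter_upwards [ae_PP hΩ.measurableSet h] with p hp
  rw [Real.norm_of_nonneg (by positivity)]
  have h1 := norm_qf_le (v p) (g p) p.2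
  have h2 := hΩR _ hp.2
  have h3 : ‖VV v g p‖ ≤ R * (|g p| + ‖v p‖) := by
    refine h1.trans ?_
    nlinarith [abs_nonneg (g p), norm_nonneg (v p)]
  calc ‖VV v g p‖ ^ 2 ≤ (R * (|g p| + ‖v p‖)) ^ 2 := by gcongr
    _ ≤ _ := by
      rw [mul_pow]
      refine mul_le_mul_of_nonneg_left ?_ (by positivity)
      nlinarith [sq_abs (g p), sq_nonneg (|g p| - ‖v p‖)]

lemma memLp_VV {Ω : Set (Euc d)} (hΩ : IsCompact Ω) {ρ : ℝ → Measure (Euc d)} (h : Good Ω ρ)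
    {R : ℝ} (hR : 1 ≤ R) (hΩR : ∀ x ∈ Ω, ‖x‖ ≤ R - 1)
    {v : XX d → Euc d} {g : XX d → ℝ} (hv : Measurable v) (hg : Measurable g)
    (hv2 : Integrable (fun p => ‖v p‖ ^ 2) (PP h)) (hg2 : Integrable (fun p => g p ^ 2) (PP h)) :
    MemLp (VV v g) 2 (PP h) :=
  (memLp_two_iff_integrable_sq_norm (measurable_VV hv hg).aestronglyMeasurable).2
    (integrable_VV2 hΩ h hR hΩR hv hg hv2 hg2)

open scoped BoundedContinuousFunction

lemma LL_add {R : ℝ} {a a' : XX d → ℝ} {b b' : XX d → ZZ d} (ha : Continuous a) (hb : Continuous b)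
    (ha' : Continuous a') (hb' : Continuous b')
    {C C' D D' : ℝ} (hC : ∀ p, |a p| ≤ C) (hC' : ∀ p, ‖b p‖ ≤ C')
    (hD : ∀ p, |a' p| ≤ D) (hD' : ∀ p, ‖b' p‖ ≤ D') (k : KK d R) :
    LL (fun p => a p + a' p) (fun p => b p + b' p) k = LL a b k + LL a' b' k := by
  unfold LL
  have e1 := intervalIntegral.integral_add (ii_aZ ha hC k) (ii_aZ ha' hD k)
  have e2 := intervalIntegral.integral_add (ii_bZ hb hC' k) (ii_bZ hb' hD' k)
  rw [show ∀ A B C D : ℝ, A + B + (C + D) = (A + C) + (B + D) from fun _ _ _ _ => by ring,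
    ← e1, ← e2]
  congr 1
  · congr 1; ext s; ring
  · congr 1; ext s; rw [← inner_add_left]; simp [bfun]

lemma LL_smul {R : ℝ} (c : ℝ) (a : XX d → ℝ) (b : XX d → ZZ d) (k : KK d R) :
    LL (fun p => c * a p) (fun p => c • b p) k = c * LL a b k := by
  unfold LL
  rw [mul_add, ← intervalIntegral.integral_const_mul, ← intervalIntegral.integral_const_mul]
  congr 1
  · congr 1; ext s; ring
  · congr 1; ext s; rw [← real_inner_smul_left]; simp only [bfun]; rw [smul_comm]

def TT (d : ℕ) (R : ℝ) : ((XX d →ᵇ ℝ) × (XX d →ᵇ ZZ d)) →ₗ[ℝ] C(KK d R, ℝ) where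
  toFun e := ⟨LL e.1 e.2, continuous_LL e.1.continuous e.2.continuous
    (fun p => e.1.norm_coe_le_norm p) (fun p => e.2.norm_coe_le_norm p)⟩
  map_add' e e' := by
    ext k
    exact LL_add e.1.continuous e.2.continuous e'.1.continuous e'.2.continuous
      (fun p => e.1.norm_coe_le_norm p) (fun p => e.2.norm_coe_le_norm p)
      (fun p => e'.1.norm_coe_le_norm p) (fun p => e'.2.norm_coe_le_norm p) k
  map_smul' c e := by
    ext k
    exact LL_smul c e.1 e.2 k

lemma integrable_bV {V : XX d → ZZ d} {P : Measure (XX d)} [IsFiniteMeasure P] (hV : MemLp V 2 P)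
    (b : XX d →ᵇ ZZ d) : Integrable (fun p => (inner ℝ (b p) (V p) : ℝ)) P := by
  have h1 : Integrable (fun p => ‖b‖ * ‖V p‖) P := (hV.integrable (by norm_num)).norm.const_mul _
  refine h1.mono' (b.continuous.aestronglyMeasurable.inner hV.1) (ae_of_all _ fun p => ?_)
  exact (norm_inner_le_norm _ _).trans (mul_le_mul_of_nonneg_right (b.norm_coe_le_norm p) (norm_nonneg _))

def LamP {V : XX d → ZZ d} {P : Measure (XX d)} [IsFiniteMeasure P] (hV : MemLp V 2 P) :
    ((XX d →ᵇ ℝ) × (XX d →ᵇ ZZ d)) →ₗ[ℝ] ℝ where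
  toFun e := (∫ p, e.1 p ∂P) + ∫ p, inner ℝ (e.2 p) (V p) ∂P
  map_add' e e' := by
    have e1 := integral_add (e.1.integrable P) (e'.1.integrable P)
    have e2 := integral_add (integrable_bV hV e.2) (integrable_bV hV e'.2)
    rw [show ∀ A B C D : ℝ, A + B + (C + D) = (A + C) + (B + D) from fun _ _ _ _ => by ring,
      ← e1, ← e2]
    simp [inner_add_left]
  map_smul' c e := by
    simp only [Prod.smul_fst, Prod.smul_snd, BoundedContinuousFunction.coe_smul, smul_eq_mul,
      RingHom.id_apply, real_inner_smul_left]
    rw [integral_const_mul c, integral_const_mul c, mul_add]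

theorem exists_sigma {Ω : Set (Euc d)} (hΩ : IsCompact Ω) {ρ : ℝ → Measure (Euc d)} (h : Good Ω ρ)
    {R : ℝ} (hR : 1 ≤ R) (hΩR : ∀ x ∈ Ω, ‖x‖ ≤ R - 1)
    {v : XX d → Euc d} {g : XX d → ℝ} (hv : Measurable v) (hg : Measurable g)
    (hv2 : Integrable (fun p => ‖v p‖ ^ 2) (PP h)) (hg2 : Integrable (fun p => g p ^ 2) (PP h))
    (hCE : CEP h v g) :
    ∃ σ : Measure (KK d R), IsFiniteMeasure σ ∧ σ.Regular ∧
      (∀ (a : XX d →ᵇ ℝ) (b : XX d →ᵇ ZZ d), ∫ k, LL a b k ∂σ =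
        (∫ p, a p ∂(PP h)) + ∫ p, inner ℝ (b p) (VV v g p) ∂(PP h)) ∧
      σ.real univ ≤ (∫ x, ‖pZ x‖ ^ 2 ∂(ρ 0)) + ∫ p, ‖VV v g p‖ ^ 2 ∂(PP h) := by
  have hV := memLp_VV hΩ h hR hΩR hv hg hv2 hg2
  have hV2 := integrable_VV2 hΩ h hR hΩR hv hg hv2 hg2
  obtain ⟨σ, h1, h2, h3, h4⟩ := hb_riesz (TT d R) (LamP hV)
    ((∫ x, ‖pZ x‖ ^ 2 ∂(ρ 0)) + ∫ p, ‖VV v g p‖ ^ 2 ∂(PP h))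
    (add_nonneg (integral_nonneg fun _ => by positivity) (integral_nonneg fun _ => by positivity))
    (by
      rintro ⟨a, b⟩ lam hlam hk
      have hC : ∀ p, |a p| ≤ max ‖a‖ ‖b‖ := fun p => (a.norm_coe_le_norm p).trans (le_max_left _ _)
      have hC' : ∀ p, ‖b p‖ ≤ max ‖a‖ ‖b‖ := fun p => (b.norm_coe_le_norm p).trans (le_max_right _ _)
      have hcurve : CurveHyp a b lam R := curveHyp_of_LL a.continuous b.continuous hC hC' hk
      have key := key3 hΩ h hΩR hv hg hv2 hg2 hCE a.continuous b.continuous hC hC' hlam hR hcurve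
      have e : ∫ p, kap a b lam p.1 p.2 (v p) (g p) ∂(PP h) =
          ((∫ p, a p ∂(PP h)) + ∫ p, inner ℝ (b p) (VV v g p) ∂(PP h)) -
            lam * ∫ p, ‖VV v g p‖ ^ 2 ∂(PP h) := by
        rw [← integral_const_mul lam, ← integral_add (a.integrable (PP h)) (integrable_bV hV b),
          ← integral_sub _ (hV2.const_mul lam)]
        · rfl
        · exact (a.integrable (PP h)).add (integrable_bV hV b)
      rw [e] at key
      change (∫ p, a p ∂(PP h)) + ∫ p, inner ℝ (b p) (VV v g p) ∂(PP h) ≤ _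
      linarith)
  exact ⟨σ, h1, h2, fun a b => h3 (a, b), h4⟩

end

open scoped BoundedContinuousFunction

section

/-- time marginals of the representing measure against bounded continuous functions -/
lemma marg_bcf {Ω : Set (Euc d)} {ρ : ℝ → Measure (Euc d)} (h : Good Ω ρ)
    {R : ℝ} {V : XX d → ZZ d} {σ : Measure (KK d R)} [IsFiniteMeasure σ]
    (hLL : ∀ (a : XX d →ᵇ ℝ) (b : XX d →ᵇ ZZ d), ∫ k, LL a b k ∂σ =
        (∫ p, a p ∂(PP h)) + ∫ p, inner ℝ (b p) (V p) ∂(PP h)) (φ : Euc d →ᵇ ℝ)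
    {t : ℝ} (ht : t ∈ Icc (0:ℝ) 1) :
    ∫ x, φ x ∂(ρ t) = ∫ k, (fstZ d (Zk t k)) ^ 2 * φ (gam (Zk t k)) ∂σ := by
  have hjc : Continuous fun p : ℝ × KK d R => (fstZ d (Zk p.1 p.2)) ^ 2 * φ (gam (Zk p.1 p.2)) :=
    continuous_aZ (R := R) (a := fun p : XX d => φ p.2) (φ.continuous.comp continuous_snd)
      (C := ‖φ‖) (fun p => φ.norm_coe_le_norm p.2)
  set F : ℝ → ℝ := fun s => ∫ k, (fstZ d (Zk s k)) ^ 2 * φ (gam (Zk s k)) ∂σ with hF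
  set G : ℝ → ℝ := fun s => ∫ x, φ x ∂(ρ s) with hG
  have hGc : Continuous G := h.cont _ φ.continuous
  have hFc : Continuous F := by
    have := continuous_parametric_integral_of_continuous (μ := σ)
      (f := fun (s : ℝ) (k : KK d R) => (fstZ d (Zk s k)) ^ 2 * φ (gam (Zk s k))) hjc isCompact_univ
    simpa using this
  have hDc : Continuous fun s => G s - F s := hGc.sub hFc
  have hbd : ∃ C, ∀ s, |G (clamp s) - F (clamp s)| ≤ C := by
    obtain ⟨C, hC⟩ := (isCompact_Icc (a := (0:ℝ)) (b := 1)).exists_bound_of_continuousOn hDc.continuousOn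
    exact ⟨C, fun s => hC _ (clamp_mem s)⟩
  obtain ⟨C, hC⟩ := hbd
  let χ : ℝ →ᵇ ℝ := BoundedContinuousFunction.ofNormedAddCommGroup (fun s => G (clamp s) - F (clamp s))
    (hDc.comp continuous_clamp) C hC
  let a : XX d →ᵇ ℝ := BoundedContinuousFunction.ofNormedAddCommGroup (fun p => χ p.1 * φ p.2)
    ((χ.continuous.comp continuous_fst).mul (φ.continuous.comp continuous_snd)) (‖χ‖ * ‖φ‖)
    (fun p => by
      rw [norm_mul]
      exact mul_le_mul (χ.norm_coe_le_norm _) (φ.norm_coe_le_norm _) (norm_nonneg _) (norm_nonneg _))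
  have h1 : ∫ k, LL (R := R) a (0 : XX d →ᵇ ZZ d) k ∂σ = ∫ p, a p ∂(PP h) := by
    rw [hLL a 0]; simp
  have hleft : ∫ k, LL (R := R) a (0 : XX d →ᵇ ZZ d) k ∂σ = ∫ s in (0:ℝ)..1, χ s * F s := by
    have e1 : ∀ k, LL (R := R) a (0 : XX d →ᵇ ZZ d) k =
        ∫ s in Ioc (0:ℝ) 1, χ s * ((fstZ d (Zk s k)) ^ 2 * φ (gam (Zk s k))) := by
      intro k
      unfold LL bfun
      simp only [BoundedContinuousFunction.coe_zero, Pi.zero_apply, smul_zero, inner_zero_left,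
        intervalIntegral.integral_zero, add_zero]
      rw [intervalIntegral.integral_of_le zero_le_one]
      congr 1; ext s
      change _ * (χ s * φ _) = _
      ring
    simp only [e1]
    rw [integral_integral_swap, intervalIntegral.integral_of_le zero_le_one]
    · congr 1; ext s
      rw [hF, ← integral_const_mul (χ s)]
    · have hc : Continuous fun p : KK d R × ℝ => χ p.2 * ((fstZ d (Zk p.2 p.1)) ^ 2 * φ (gam (Zk p.2 p.1))) :=
        (χ.continuous.comp continuous_snd).mul (Continuous.comp
          (g := fun p : ℝ × KK d R => (fstZ d (Zk p.1 p.2)) ^ 2 * φ (gam (Zk p.1 p.2)))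
          (f := fun p : KK d R × ℝ => (p.2, p.1)) hjc (by fun_prop))
      refine Integrable.of_bound (C := ‖χ‖ * (2 ^ 2 * ‖φ‖)) hc.aestronglyMeasurable
        (ae_of_all _ fun p => ?_)
      simp only [Function.uncurry]
      rw [norm_mul, norm_mul, norm_pow]
      have := (abs_fstZ_le _).trans (norm_Zk p.2 p.1)
      refine mul_le_mul (χ.norm_coe_le_norm _) (mul_le_mul ?_ (φ.norm_coe_le_norm _) (norm_nonneg _)
        (by positivity)) (by positivity) (norm_nonneg _)
      exact pow_le_pow_left₀ (norm_nonneg _) this 2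
  have hright : ∫ p, a p ∂(PP h) = ∫ s in (0:ℝ)..1, χ s * G s := by
    rw [integral_PP h (a.integrable _), intervalIntegral.integral_of_le zero_le_one,
      integral_Ioc_eq_integral_Ioo]
    congr 1; ext s
    rw [hG, ← integral_const_mul (χ s)]
    rfl
  rw [hleft, hright] at h1
  have h0 : ∫ s in (0:ℝ)..1, (G (clamp s) - F (clamp s)) ^ 2 = 0 := by
    have e : ∫ s in (0:ℝ)..1, (G (clamp s) - F (clamp s)) ^ 2 =
        (∫ s in (0:ℝ)..1, χ s * G s) - ∫ s in (0:ℝ)..1, χ s * F s := by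
      have i1 : IntervalIntegrable (fun s => χ s * G s) volume 0 1 :=
        (χ.continuous.mul hGc).intervalIntegrable _ _
      have i2 : IntervalIntegrable (fun s => χ s * F s) volume 0 1 :=
        (χ.continuous.mul hFc).intervalIntegrable _ _
      rw [← intervalIntegral.integral_sub i1 i2]
      apply intervalIntegral.integral_congr
      intro s hs
      rw [uIcc_of_le zero_le_one] at hs
      have : χ s = G s - F s := by
        change G (clamp s) - F (clamp s) = _
        rw [clamp_of_mem hs]
      simp only [this, clamp_of_mem hs]
      ring
    rw [e, h1, sub_self]
  by_contra hne
  have hpos : 0 < ∫ s in (0:ℝ)..1, (G (clamp s) - F (clamp s)) ^ 2 := by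
    refine intervalIntegral.integral_pos zero_lt_one ((hDc.comp continuous_clamp).pow 2).continuousOn
      (fun s _ => by positivity) ⟨t, ht, ?_⟩
    rw [clamp_of_mem ht]
    have := sub_ne_zero.2 hne; positivity
  exact hpos.ne' h0

/-- the cone weight -/
def wt {R : ℝ} (t : ℝ) (k : KK d R) : ℝ≥0∞ := ENNReal.ofReal ((fstZ d (Zk t k)) ^ 2)

lemma continuous_Zkt {R : ℝ} (t : ℝ) : Continuous fun k : KK d R => Zk t k :=
  Continuous.comp (g := fun p : ℝ × KK d R => Zk p.1 p.2) (f := fun k : KK d R => (t, k))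
    continuous_Zk (by fun_prop)

lemma continuous_Zks {R : ℝ} (k : KK d R) : Continuous fun t : ℝ => Zk t k :=
  Continuous.comp (g := fun p : ℝ × KK d R => Zk p.1 p.2) (f := fun t : ℝ => (t, k))
    continuous_Zk (by fun_prop)

lemma measurable_ZkP {R : ℝ} : Measurable fun p : ℝ × KK d R => Zk p.1 p.2 :=
  continuous_Zk.measurable

lemma measurable_wt {R : ℝ} (t : ℝ) : Measurable (wt (d := d) (R := R) t) := by
  unfold wt
  exact (((fstZ d).measurable.comp (continuous_Zkt t).measurable).pow_const 2).ennreal_ofReal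

lemma measurable_gamZ {R : ℝ} (t : ℝ) : Measurable fun k : KK d R => gam (Zk t k) :=
  measurable_gam.comp (continuous_Zkt t).measurable

lemma wt_le {R : ℝ} (t : ℝ) (k : KK d R) : wt t k ≤ 4 := by
  unfold wt
  have h := (abs_fstZ_le _).trans (norm_Zk t k)
  refine (ENNReal.ofReal_le_ofReal (q := 4) ?_).trans (by simp)
  rw [← sq_abs]
  nlinarith [abs_nonneg (fstZ d (Zk t k))]

lemma toReal_wt {R : ℝ} (t : ℝ) (k : KK d R) : (wt t k).toReal = (fstZ d (Zk t k)) ^ 2 :=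
  ENNReal.toReal_ofReal (by positivity)

lemma marg {Ω : Set (Euc d)} {ρ : ℝ → Measure (Euc d)} (h : Good Ω ρ)
    {R : ℝ} {V : XX d → ZZ d} {σ : Measure (KK d R)} [IsFiniteMeasure σ]
    (hLL : ∀ (a : XX d →ᵇ ℝ) (b : XX d →ᵇ ZZ d), ∫ k, LL a b k ∂σ =
        (∫ p, a p ∂(PP h)) + ∫ p, inner ℝ (b p) (V p) ∂(PP h))
    {t : ℝ} (ht : t ∈ Icc (0:ℝ) 1) :
    ρ t = (σ.withDensity (wt t)).map (fun k => gam (Zk t k)) := by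
  have := h.fin t
  have : IsFiniteMeasure (σ.withDensity (wt (d := d) (R := R) t)) := by
    refine isFiniteMeasure_withDensity ?_
    refine ((lintegral_mono (fun k => wt_le t k)).trans_lt ?_).ne
    simp [ENNReal.mul_lt_top_iff, measure_lt_top]
  have : IsFiniteMeasure ((σ.withDensity (wt t)).map (fun k => gam (Zk t k))) :=
    Measure.isFiniteMeasure_map _ _
  apply ext_of_forall_integral_eq_of_IsFiniteMeasure
  intro φ
  rw [marg_bcf h hLL φ ht, integral_map (measurable_gamZ t).aemeasurable
    φ.continuous.aestronglyMeasurable, integral_withDensity_eq_integral_toReal_smul (measurable_wt t)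
    (ae_of_all _ fun k => (wt_le t k).trans_lt (by simp))]
  simp only [toReal_wt, smul_eq_mul]

lemma marg_lint {ρt : Measure (Euc d)}
    {R : ℝ} {σ : Measure (KK d R)}
    {t : ℝ} (hm : ρt = (σ.withDensity (wt t)).map (fun k => gam (Zk t k)))
    {F : Euc d → ℝ≥0∞} (hF : Measurable F) :
    ∫⁻ x, F x ∂ρt = ∫⁻ k, wt t k * F (gam (Zk t k)) ∂σ := by
  rw [hm, lintegral_map hF (measurable_gamZ t)]
  exact lintegral_withDensity_eq_lintegral_mul _ (measurable_wt t) (hF.comp (measurable_gamZ t))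

lemma marg_int {ρt : Measure (Euc d)}
    {R : ℝ} {σ : Measure (KK d R)}
    {t : ℝ} (hm : ρt = (σ.withDensity (wt t)).map (fun k => gam (Zk t k)))
    {F : Euc d → ℝ} (hF : Continuous F) :
    ∫ x, F x ∂ρt = ∫ k, (fstZ d (Zk t k)) ^ 2 * F (gam (Zk t k)) ∂σ := by
  rw [hm, integral_map (measurable_gamZ t).aemeasurable
    hF.aestronglyMeasurable, integral_withDensity_eq_integral_toReal_smul (measurable_wt t)
    (ae_of_all _ fun k => (wt_le t k).trans_lt (by simp))]
  simp only [toReal_wt, smul_eq_mul]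

lemma cone_eq {R : ℝ} {z : ZZ d} (h : InCone R z) : z = fstZ d z • pZ (gam z) := by
  unfold InCone at h
  by_cases h0 : fstZ d z = 0
  · rw [h0, zero_smul]
    apply ZZ_ext
    · simpa using h0
    · rw [h0, mul_zero] at h
      simpa using h
  · apply ZZ_ext
    · simp
    · simp [gam, h0]

end

section

def nsq (b : XX d →ᵇ ZZ d) : XX d →ᵇ ℝ :=
  BoundedContinuousFunction.ofNormedAddCommGroup (fun p => ‖b p‖ ^ 2) (b.continuous.norm.pow 2) (‖b‖ ^ 2)
    (fun p => by
      rw [Real.norm_of_nonneg (by positivity)]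
      exact pow_le_pow_left₀ (norm_nonneg _) (b.norm_coe_le_norm p) 2)

lemma nsq_apply (b : XX d →ᵇ ZZ d) (p : XX d) : nsq b p = ‖b p‖ ^ 2 := rfl

lemma ii_xk2 {R : ℝ} (k : KK d R) : IntervalIntegrable (fun s => ‖xk k s‖ ^ 2) volume 0 1 :=
  intInt_of_nu (integrable_HH_sq _) ⟨le_rfl, zero_le_one⟩ ⟨zero_le_one, le_rfl⟩

lemma Zk_zero {R : ℝ} (k : KK d R) : Zk 0 k = xk k (-1) := by
  rw [Zk_def, clamp_of_mem (by simp), zt_eq_zc (integrable_HH _) (by simp)]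
  simp [zc]

lemma Zk_eq {R : ℝ} (k : KK d R) {t : ℝ} (ht : t ∈ Icc (0:ℝ) 1) :
    Zk t k = Zk 0 k + ∫ s in (0:ℝ)..t, xk k s := by
  rw [Zk_zero, Zk_def, clamp_of_mem ht, zt_eq_zc (integrable_HH _) ht]; rfl

lemma sq_expand_eq {R : ℝ} (b : XX d →ᵇ ZZ d) (k : KK d R) (s : ℝ) :
    ‖xk k s - bfun b k s‖ ^ 2 = ‖xk k s‖ ^ 2 + ((fstZ d (Zk s k)) ^ 2 * nsq b (s, gam (Zk s k)) +
      inner ℝ (bfun ((-2 : ℝ) • b) k s) (xk k s)) := by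
  rw [norm_sub_sq_real, nsq_apply]
  have e1 : bfun ((-2 : ℝ) • b) k s = (-2 : ℝ) • bfun b k s := by
    simp only [bfun, BoundedContinuousFunction.coe_smul]; rw [smul_comm]
  have e2 : ‖bfun b k s‖ ^ 2 = (fstZ d (Zk s k)) ^ 2 * ‖b (s, gam (Zk s k))‖ ^ 2 := by
    simp only [bfun]; rw [norm_smul, mul_pow, Real.norm_eq_abs, sq_abs]
  rw [e1, e2, real_inner_smul_left, real_inner_comm]
  ring

lemma ii_sq {R : ℝ} (b : XX d →ᵇ ZZ d) (k : KK d R) :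
    IntervalIntegrable (fun s => ‖xk k s - bfun b k s‖ ^ 2) volume 0 1 := by
  simp only [sq_expand_eq]
  exact (ii_xk2 k).add ((ii_aZ (nsq b).continuous (nsq b).norm_coe_le_norm k).add
    (ii_bZ ((-2 : ℝ) • b).continuous ((-2 : ℝ) • b).norm_coe_le_norm k))

lemma sq_expand {R : ℝ} (b : XX d →ᵇ ZZ d) (k : KK d R) :
    ∫ s in (0:ℝ)..1, ‖xk k s - bfun b k s‖ ^ 2 ≤
      1 - ‖Zk 0 k‖ ^ 2 + LL (nsq b) ((-2 : ℝ) • b) k := by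
  simp only [sq_expand_eq]
  have i1 := ii_aZ (nsq b).continuous (nsq b).norm_coe_le_norm k
  have i2 := ii_bZ ((-2 : ℝ) • b).continuous ((-2 : ℝ) • b).norm_coe_le_norm k
  rw [intervalIntegral.integral_add (ii_xk2 k) (i1.add i2), intervalIntegral.integral_add i1 i2]
  have h1 := norm_HH_sq (xk k)
  have h2 := norm_xk k
  rw [Zk_zero]
  unfold LL
  have : ‖xk k‖ ^ 2 ≤ 1 := by nlinarith [norm_nonneg (xk k)]
  have e : (∫ s in (0:ℝ)..1, ‖xk k s‖ ^ 2) ≤ 1 - ‖xk k (-1)‖ ^ 2 := by linarith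
  simp only [BoundedContinuousFunction.coe_smul] at *
  exact add_le_add e le_rfl

def Aq {R : ℝ} (V : XX d → ZZ d) (k : KK d R) : ℝ≥0∞ :=
  ∫⁻ s in Ioc (0:ℝ) 1, ENNReal.ofReal (‖xk k s - fstZ d (Zk s k) • V (s, gam (Zk s k))‖ ^ 2)

def DD {R : ℝ} (b : XX d →ᵇ ZZ d) (k : KK d R) : ℝ :=
  1 - ‖Zk 0 k‖ ^ 2 + LL (nsq b) ((-2 : ℝ) • b) k

lemma continuous_DD {R : ℝ} (b : XX d →ᵇ ZZ d) : Continuous (DD (R := R) b) :=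
  (continuous_const.sub ((continuous_Zkt 0).norm.pow 2)).add
    (continuous_LL (nsq b).continuous ((-2 : ℝ) • b).continuous (nsq b).norm_coe_le_norm
      ((-2 : ℝ) • b).norm_coe_le_norm)

def EE {R : ℝ} (V : XX d → ZZ d) (b : XX d →ᵇ ZZ d) (k : KK d R) : ℝ≥0∞ :=
  ∫⁻ s in Ioc (0:ℝ) 1, wt s k * ENNReal.ofReal (‖V (s, gam (Zk s k)) - b (s, gam (Zk s k))‖ ^ 2)

lemma measurable_EEi {R : ℝ} {V : XX d → ZZ d} (hV : Measurable V) (b : XX d →ᵇ ZZ d) :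
    Measurable fun p : ℝ × KK d R =>
      wt p.1 p.2 * ENNReal.ofReal (‖V (p.1, gam (Zk p.1 p.2)) - b (p.1, gam (Zk p.1 p.2))‖ ^ 2) := by
  have m1 : Measurable fun p : ℝ × KK d R => (p.1, gam (Zk p.1 p.2)) :=
    measurable_fst.prodMk (measurable_gam.comp measurable_ZkP)
  have m2 : Measurable fun p : ℝ × KK d R => wt p.1 p.2 := by
    unfold wt
    exact (((fstZ d).measurable.comp measurable_ZkP).pow_const 2).ennreal_ofReal
  exact m2.mul ((((hV.comp m1).sub (b.continuous.measurable.comp m1)).norm.pow_const 2).ennreal_ofReal)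

lemma Aq_le {R : ℝ} {V : XX d → ZZ d} (hV : Measurable V) (b : XX d →ᵇ ZZ d) (k : KK d R) :
    Aq V k ≤ 2 * ENNReal.ofReal (DD b k) + 2 * EE V b k := by
  have mE : Measurable fun s : ℝ => wt s k * ENNReal.ofReal (‖V (s, gam (Zk s k)) - b (s, gam (Zk s k))‖ ^ 2) :=
    (measurable_EEi hV b).comp (g := fun p : ℝ × KK d R =>
      wt p.1 p.2 * ENNReal.ofReal (‖V (p.1, gam (Zk p.1 p.2)) - b (p.1, gam (Zk p.1 p.2))‖ ^ 2))
      (f := fun s : ℝ => (s, k)) measurable_prodMk_right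
  have h1 : ∫⁻ s in Ioc (0:ℝ) 1, ENNReal.ofReal (‖xk k s - bfun b k s‖ ^ 2) ≤ ENNReal.ofReal (DD b k) := by
    rw [← ofReal_integral_eq_lintegral_ofReal, ← intervalIntegral.integral_of_le zero_le_one]
    · exact ENNReal.ofReal_le_ofReal (sq_expand b k)
    · exact (intervalIntegrable_iff_integrableOn_Ioc_of_le zero_le_one).1 (ii_sq b k)
    · exact ae_of_all _ fun _ => by positivity
  calc Aq V k ≤ ∫⁻ s in Ioc (0:ℝ) 1, (2 * ENNReal.ofReal (‖xk k s - bfun b k s‖ ^ 2) +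
        2 * (wt s k * ENNReal.ofReal (‖V (s, gam (Zk s k)) - b (s, gam (Zk s k))‖ ^ 2))) := by
        unfold Aq
        refine lintegral_mono fun s => ?_
        unfold wt
        rw [← ENNReal.ofReal_mul (by positivity)]
        have e2 : ∀ x : ℝ, 2 * ENNReal.ofReal x = ENNReal.ofReal (2 * x) := by
          intro x; rw [ENNReal.ofReal_mul (by norm_num)]; simp
        rw [e2, e2, ← ENNReal.ofReal_add (by positivity) (by positivity)]
        refine ENNReal.ofReal_le_ofReal ?_
        have e3 : xk k s - fstZ d (Zk s k) • V (s, gam (Zk s k)) =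
            (xk k s - bfun b k s) - fstZ d (Zk s k) • (V (s, gam (Zk s k)) - b (s, gam (Zk s k))) := by
          simp only [bfun, smul_sub]; abel
        have e4 : fstZ d (Zk s k) ^ 2 * ‖V (s, gam (Zk s k)) - b (s, gam (Zk s k))‖ ^ 2 =
            ‖fstZ d (Zk s k) • (V (s, gam (Zk s k)) - b (s, gam (Zk s k)))‖ ^ 2 := by
          rw [norm_smul, mul_pow, Real.norm_eq_abs, sq_abs]
        rw [e3, e4]
        have h5 := norm_sub_le (xk k s - bfun b k s)
          (fstZ d (Zk s k) • (V (s, gam (Zk s k)) - b (s, gam (Zk s k))))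
        have h6 := norm_nonneg ((xk k s - bfun b k s) -
          fstZ d (Zk s k) • (V (s, gam (Zk s k)) - b (s, gam (Zk s k))))
        nlinarith [sq_nonneg (‖xk k s - bfun b k s‖ -
          ‖fstZ d (Zk s k) • (V (s, gam (Zk s k)) - b (s, gam (Zk s k)))‖)]
    _ = 2 * (∫⁻ s in Ioc (0:ℝ) 1, ENNReal.ofReal (‖xk k s - bfun b k s‖ ^ 2)) + 2 * EE V b k := by
        rw [lintegral_add_right _ (mE.const_mul 2), lintegral_const_mul' _ _ (by simp),
          lintegral_const_mul' _ _ (by simp)]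
        rfl
    _ ≤ _ := by gcongr

lemma lint_EE {Ω : Set (Euc d)} {ρ : ℝ → Measure (Euc d)} (h : Good Ω ρ)
    {R : ℝ} {V : XX d → ZZ d} (hV : Measurable V) {σ : Measure (KK d R)} [IsFiniteMeasure σ]
    (hm : ∀ t ∈ Icc (0:ℝ) 1, ρ t = (σ.withDensity (wt t)).map (fun k => gam (Zk t k)))
    (b : XX d →ᵇ ZZ d) :
    ∫⁻ k, EE V b k ∂σ = ∫⁻ p, ENNReal.ofReal (‖V p - b p‖ ^ 2) ∂(PP h) := by
  have mF : Measurable fun p : XX d => ENNReal.ofReal (‖V p - b p‖ ^ 2) :=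
    ((hV.sub b.continuous.measurable).norm.pow_const 2).ennreal_ofReal
  rw [lintegral_PP h mF]
  unfold EE
  rw [lintegral_lintegral_swap, setLIntegral_congr Ioo_ae_eq_Ioc.symm]
  · refine setLIntegral_congr_fun measurableSet_Ioo fun t ht => ?_
    exact (marg_lint (hm t ⟨ht.1.le, ht.2.le⟩) (mF.comp measurable_prodMk_left)).symm
  · exact ((measurable_EEi hV b).comp (measurable_snd.prodMk measurable_fst)).aemeasurable

lemma lint_DD {Ω : Set (Euc d)} {ρ : ℝ → Measure (Euc d)} (h : Good Ω ρ)
    {R : ℝ} {V : XX d → ZZ d} (hV : MemLp V 2 (PP h)) {σ : Measure (KK d R)} [IsFiniteMeasure σ]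
    (hm : ∀ t ∈ Icc (0:ℝ) 1, ρ t = (σ.withDensity (wt t)).map (fun k => gam (Zk t k)))
    (hLL : ∀ (a : XX d →ᵇ ℝ) (b : XX d →ᵇ ZZ d), ∫ k, LL a b k ∂σ =
        (∫ p, a p ∂(PP h)) + ∫ p, inner ℝ (b p) (V p) ∂(PP h))
    (hmass : σ.real univ ≤ (∫ x, ‖pZ x‖ ^ 2 ∂(ρ 0)) + ∫ p, ‖V p‖ ^ 2 ∂(PP h))
    (b : XX d →ᵇ ZZ d) :
    ∫⁻ k, ENNReal.ofReal (DD b k) ∂σ ≤ ∫⁻ p, ENNReal.ofReal (‖V p - b p‖ ^ 2) ∂(PP h) := by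
  have hbL : MemLp b 2 (PP h) := MemLp.of_bound b.continuous.aestronglyMeasurable ‖b‖
    (ae_of_all _ b.norm_coe_le_norm)
  have hi : Integrable (fun p => ‖V p - b p‖ ^ 2) (PP h) := (hV.sub hbL).integrable_norm_pow (by norm_num)
  have hV2 : Integrable (fun p => ‖V p‖ ^ 2) (PP h) := hV.integrable_norm_pow (by norm_num)
  have hDi : Integrable (DD (R := R) b) σ :=
    (continuous_DD b).integrable_of_hasCompactSupport (HasCompactSupport.of_compactSpace _)
  have hDnn : ∀ k : KK d R, 0 ≤ DD b k := fun k =>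
    (intervalIntegral.integral_nonneg zero_le_one fun _ _ => by positivity).trans (sq_expand b k)
  rw [← ofReal_integral_eq_lintegral_ofReal hDi (ae_of_all _ hDnn),
    ← ofReal_integral_eq_lintegral_ofReal hi (ae_of_all _ fun _ => by positivity)]
  refine ENNReal.ofReal_le_ofReal ?_
  have iZ : Integrable (fun k : KK d R => ‖Zk 0 k‖ ^ 2) σ :=
    ((continuous_Zkt 0).norm.pow 2).integrable_of_hasCompactSupport (HasCompactSupport.of_compactSpace _)
  have iL : Integrable (fun k : KK d R => LL (nsq b) ((-2 : ℝ) • b) k) σ :=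
    (continuous_LL (nsq b).continuous ((-2 : ℝ) • b).continuous (nsq b).norm_coe_le_norm
      ((-2 : ℝ) • b).norm_coe_le_norm).integrable_of_hasCompactSupport (HasCompactSupport.of_compactSpace _)
  have i1 : Integrable (fun k : KK d R => 1 - ‖Zk 0 k‖ ^ 2) σ := (integrable_const _).sub iZ
  have e0 : ∫ k : KK d R, ‖Zk 0 k‖ ^ 2 ∂σ = ∫ x, ‖pZ x‖ ^ 2 ∂(ρ 0) := by
    have hc : Continuous fun x : Euc d => ‖pZ x‖ ^ 2 := continuous_pZ.norm.pow 2
    rw [marg_int (hm 0 (by simp)) hc]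
    congr 1; ext k
    conv_lhs => rw [cone_eq (cone_Zk 0 k)]
    rw [norm_smul, mul_pow, Real.norm_eq_abs, sq_abs]
  have e1 : ∫ k, DD b k ∂σ = σ.real univ - (∫ x, ‖pZ x‖ ^ 2 ∂(ρ 0)) +
      ((∫ p, nsq b p ∂(PP h)) + ∫ p, inner ℝ (((-2 : ℝ) • b) p) (V p) ∂(PP h)) := by
    rw [← hLL, ← e0]
    unfold DD
    rw [integral_add i1 iL, integral_sub (integrable_const _) iZ, integral_const, smul_eq_mul, mul_one]
    rfl
  have e2 : ∫ p, ‖V p - b p‖ ^ 2 ∂(PP h) = (∫ p, ‖V p‖ ^ 2 ∂(PP h)) +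
      ((∫ p, nsq b p ∂(PP h)) + ∫ p, inner ℝ (((-2 : ℝ) • b) p) (V p) ∂(PP h)) := by
    rw [← integral_add ((nsq b).integrable _) (integrable_bV hV _), ← integral_add hV2]
    · congr 1; ext p
      rw [norm_sub_sq_real, nsq_apply, BoundedContinuousFunction.coe_smul, real_inner_smul_left,
        real_inner_comm]
      ring
    · exact ((nsq b).integrable _).add (integrable_bV hV _)
  rw [e1, e2]
  linarith

lemma approx_b {P : Measure (XX d)} [IsFiniteMeasure P] {V : XX d → ZZ d} (hV : MemLp V 2 P)
    {ε : ℝ≥0∞} (hε : ε ≠ 0) : ∃ b : XX d →ᵇ ZZ d, ∫⁻ p, ENNReal.ofReal (‖V p - b p‖ ^ 2) ∂P ≤ ε ^ 2 := by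
  obtain ⟨b, hb, -⟩ := hV.exists_boundedContinuous_eLpNorm_sub_le (by simp) hε
  refine ⟨b, ?_⟩
  have := eLpNorm_nnreal_pow_eq_lintegral (f := V - ⇑b) (p := 2) (μ := P) (by norm_num)
  have e : ∫⁻ p, ENNReal.ofReal (‖V p - b p‖ ^ 2) ∂P = eLpNorm (V - ⇑b) 2 P ^ 2 := by
    have h2 : eLpNorm (V - ⇑b) 2 P ^ 2 = eLpNorm (V - ⇑b) ((2 : ℝ≥0) : ℝ≥0∞) P ^ (((2 : ℝ≥0) : ℝ)) := by
      norm_num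
    rw [h2, this]
    refine lintegral_congr fun p => ?_
    rw [← ofReal_norm, ENNReal.ofReal_rpow_of_nonneg (norm_nonneg _) (by norm_num)]
    norm_num
  rw [e]
  gcongr

/-- almost every path solves the lifted characteristic equation -/
theorem ae_Aq {Ω : Set (Euc d)} {ρ : ℝ → Measure (Euc d)} (h : Good Ω ρ)
    {R : ℝ} {V : XX d → ZZ d} (hVm : Measurable V) (hV : MemLp V 2 (PP h)) {σ : Measure (KK d R)}
    [IsFiniteMeasure σ]
    (hm : ∀ t ∈ Icc (0:ℝ) 1, ρ t = (σ.withDensity (wt t)).map (fun k => gam (Zk t k)))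
    (hLL : ∀ (a : XX d →ᵇ ℝ) (b : XX d →ᵇ ZZ d), ∫ k, LL a b k ∂σ =
        (∫ p, a p ∂(PP h)) + ∫ p, inner ℝ (b p) (V p) ∂(PP h))
    (hmass : σ.real univ ≤ (∫ x, ‖pZ x‖ ^ 2 ∂(ρ 0)) + ∫ p, ‖V p‖ ^ 2 ∂(PP h)) :
    ∀ᵐ k ∂σ, Aq V k = 0 := by
  have hex : ∀ n : ℕ, ∃ b : XX d →ᵇ ZZ d, ∫⁻ p, ENNReal.ofReal (‖V p - b p‖ ^ 2) ∂(PP h) ≤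
      ((n : ℝ≥0∞)⁻¹) ^ 2 := fun n => approx_b hV (by simp)
  choose b hb using hex
  have mE : ∀ n, Measurable fun k : KK d R => EE V (b n) k := fun n =>
    Measurable.lintegral_prod_right' ((measurable_EEi hVm (b n)).comp (measurable_snd.prodMk measurable_fst))
  have mD : ∀ n, Measurable fun k : KK d R => ENNReal.ofReal (DD (b n) k) := fun n =>
    (continuous_DD (b n)).measurable.ennreal_ofReal
  have hB : ∀ n, ∫⁻ k : KK d R, (2 * ENNReal.ofReal (DD (b n) k) + 2 * EE V (b n) k) ∂σ ≤
      4 * ((n : ℝ≥0∞)⁻¹) ^ 2 := by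
    intro n
    rw [lintegral_add_left ((mD n).const_mul 2), lintegral_const_mul _ (mD n),
      lintegral_const_mul _ (mE n), lint_EE h hVm hm]
    calc _ ≤ 2 * ((n : ℝ≥0∞)⁻¹) ^ 2 + 2 * ((n : ℝ≥0∞)⁻¹) ^ 2 := by
          gcongr
          · exact (lint_DD h hV hm hLL hmass (b n)).trans (hb n)
          · exact hb n
      _ = _ := by rw [← add_mul]; norm_num
  have hlim : Tendsto (fun n : ℕ => 4 * ((n : ℝ≥0∞)⁻¹) ^ 2) atTop (𝓝 0) := by
    have h1 := ENNReal.Tendsto.pow (n := 2) ENNReal.tendsto_inv_nat_nhds_zero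
    have h2 := ENNReal.Tendsto.const_mul (a := 4) h1 (Or.inr (by simp))
    simpa using h2
  have hfat := lintegral_liminf_le (u := atTop) (μ := σ) (f := fun n (k : KK d R) =>
    2 * ENNReal.ofReal (DD (b n) k) + 2 * EE V (b n) k) (fun n => ((mD n).const_mul 2).add ((mE n).const_mul 2))
  have hz : ∫⁻ k : KK d R, liminf (fun n => 2 * ENNReal.ofReal (DD (b n) k) + 2 * EE V (b n) k) atTop ∂σ = 0 := by
    refine le_antisymm (hfat.trans ?_) bot_le
    rw [← hlim.liminf_eq]
    exact liminf_le_liminf (Eventually.of_forall hB)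
  have hml : Measurable fun k : KK d R =>
      liminf (fun n => 2 * ENNReal.ofReal (DD (b n) k) + 2 * EE V (b n) k) atTop :=
    Measurable.liminf fun n => ((mD n).const_mul 2).add ((mE n).const_mul 2)
  rw [lintegral_eq_zero_iff hml] at hz
  filter_upwards [hz] with k hk
  refine le_antisymm ?_ bot_le
  have : Aq V k ≤ liminf (fun n => 2 * ENNReal.ofReal (DD (b n) k) + 2 * EE V (b n) k) atTop :=
    le_liminf_of_le (by isBoundedDefault) (Eventually.of_forall fun n => Aq_le hVm (b n) k)
  exact this.trans (le_of_eq hk)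

/-- almost every path stays in `Ω` -/
theorem ae_supp {Ω : Set (Euc d)} (hΩ : IsClosed Ω) {ρ : ℝ → Measure (Euc d)} (h : Good Ω ρ)
    {R : ℝ} {σ : Measure (KK d R)}
    (hm : ∀ t ∈ Icc (0:ℝ) 1, ρ t = (σ.withDensity (wt t)).map (fun k => gam (Zk t k))) :
    ∀ᵐ k ∂σ, ∀ t, fstZ d (Zk t k) ≠ 0 → gam (Zk t k) ∈ Ω := by
  have h1 : ∀ᵐ k ∂σ, ∀ q : ℚ, fstZ d (Zk q k) ≠ 0 → gam (Zk q k) ∈ Ω := by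
    rw [ae_all_iff]
    intro q
    have hc : ∀ k : KK d R, Zk (q : ℝ) k = Zk (clamp q) k := by
      intro k; rw [Zk_def, Zk_def, clamp_of_mem (clamp_mem _)]
    have h2 := h.supp (clamp q)
    have hind : Measurable (Ωᶜ.indicator (1 : Euc d → ℝ≥0∞)) :=
      measurable_one.indicator hΩ.measurableSet.compl
    have hmeas : Measurable fun k : KK d R => wt (clamp q) k * Ωᶜ.indicator 1 (gam (Zk (clamp q) k)) :=
      (measurable_wt _).mul (hind.comp (measurable_gamZ _))
    rw [← lintegral_indicator_one hΩ.measurableSet.compl, marg_lint (hm _ (clamp_mem q))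
      hind, lintegral_eq_zero_iff hmeas] at h2
    filter_upwards [h2] with k hk hr
    by_contra hn
    rw [hc] at hn hr
    simp [wt, hn] at hk
    exact hr hk
  filter_upwards [h1] with k hk t hr
  have hcz := continuous_Zks k
  have hr' : Continuous fun t => fstZ d (Zk t k) := (fstZ d).continuous.comp hcz
  by_contra hn
  have hg : ContinuousAt (fun t => gam (Zk t k)) t := by
    unfold gam
    exact (hr'.continuousAt.inv₀ hr).smul ((sndZ d).continuous.comp hcz).continuousAt
  have ev : ∀ᶠ s in 𝓝 t, gam (Zk s k) ∈ Ωᶜ ∧ fstZ d (Zk s k) ≠ 0 :=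
    (hg.eventually (hΩ.isOpen_compl.mem_nhds hn)).and (hr'.continuousAt.eventually_ne hr)
  obtain ⟨U, hU, hUo, htU⟩ := eventually_nhds_iff.1 ev
  obtain ⟨s, hsU, q, rfl⟩ := Rat.denseRange_cast.inter_open_nonempty U hUo ⟨t, htU⟩
  exact (hU _ hsU).1 (hk q (hU _ hsU).2)

end

section

lemma sq_AC {f f' : ℝ → ℝ} (hi : IntervalIntegrable f' volume 0 1)
    (hf : ∀ t ∈ Icc (0:ℝ) 1, f t = f 0 + ∫ s in (0:ℝ)..t, f' s) {t : ℝ} (ht : t ∈ Icc (0:ℝ) 1) :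
    f t ^ 2 = f 0 ^ 2 + ∫ s in (0:ℝ)..t, 2 * f s * f' s := by
  set F : ℝ → ℝ := fun x => f 0 + ∫ s in (0:ℝ)..x, f' s with hF
  have hsub : uIcc 0 t ⊆ uIcc (0:ℝ) 1 := by
    rw [uIcc_of_le ht.1, uIcc_of_le zero_le_one]; exact Icc_subset_Icc le_rfl ht.2
  have hac : AbsolutelyContinuousOnInterval F 0 1 :=
    AbsolutelyContinuousOnInterval.fun_add
      ((LipschitzWith.const (f 0)).lipschitzOnWith.absolutelyContinuousOnInterval)
      (hi.absolutelyContinuousOnInterval_intervalIntegral (by simp))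
  have hac' := hac.mono hsub
  have h1 := hac'.integral_deriv_mul_eq_sub hac'
  have h2 : ∫ x in (0:ℝ)..t, deriv F x * F x + F x * deriv F x = ∫ s in (0:ℝ)..t, 2 * f s * f' s := by
    apply intervalIntegral.integral_congr_ae
    filter_upwards [hi.ae_hasDerivAt_integral] with x hx hxt
    have hx1 : x ∈ uIcc (0:ℝ) 1 := hsub (uIoc_subset_uIcc hxt)
    have hd : HasDerivAt F (f' x) x := (hx hx1 0 (by simp)).const_add (f 0)
    rw [uIcc_of_le zero_le_one] at hx1
    rw [hd.deriv, hf x hx1]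
    simp only [hF]; ring
  rw [h2] at h1
  have h3 : F 0 = f 0 := by simp [hF]
  have h4 : F t = f t := (hf t ht).symm
  rw [h1, h3, h4]; ring

lemma fst_nonneg {R : ℝ} (hR : 1 ≤ R) {z : ZZ d} (h : InCone R z) : 0 ≤ fstZ d z := by
  have h1 : 0 ≤ R * fstZ d z := (norm_nonneg _).trans h
  exact nonneg_of_mul_nonneg_right h1 (by linarith)

lemma snd_zero {R : ℝ} {z : ZZ d} (h : InCone R z) (h0 : fstZ d z = 0) : sndZ d z = 0 := by
  have h1 : ‖sndZ d z‖ ≤ R * fstZ d z := h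
  rw [h0, mul_zero] at h1
  exact norm_le_zero_iff.1 h1

open Classical in
/-- position with a default value at the apex of the cone -/
def gamx (x0 : Euc d) (z : ZZ d) : Euc d := if fstZ d z = 0 then x0 else gam z

lemma fst_smul_gamx {R : ℝ} {z : ZZ d} (h : InCone R z) (x0 : Euc d) :
    fstZ d z • gamx x0 z = sndZ d z := by
  unfold gamx
  split_ifs with h0
  · rw [snd_zero h h0, h0, zero_smul]
  · rw [gam, smul_smul, mul_inv_cancel₀ h0, one_smul]

lemma ii_xk {R : ℝ} (k : KK d R) : IntervalIntegrable (fun s => xk k s) volume 0 1 :=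
  intInt_of_nu (integrable_HH _) ⟨le_rfl, zero_le_one⟩ ⟨zero_le_one, le_rfl⟩

lemma xk_of_Aq {R : ℝ} {V : XX d → ZZ d} (hV : Measurable V) {k : KK d R} (h : Aq V k = 0) :
    ∀ᵐ s, s ∈ Ioc (0:ℝ) 1 → xk k s = fstZ d (Zk s k) • V (s, gam (Zk s k)) := by
  unfold Aq at h
  have hz : Measurable fun s => Zk s k := (continuous_Zks k).measurable
  have hg : Measurable fun s => gam (Zk s k) := measurable_gam.comp hz
  have hm2 : Measurable fun s => fstZ d (Zk s k) • V (s, gam (Zk s k)) :=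
    ((fstZ d).measurable.comp hz).smul (hV.comp (measurable_id.prodMk hg))
  have hm1 : AEMeasurable (fun s => xk k s) (volume.restrict (Ioc (0:ℝ) 1)) :=
    ((intervalIntegrable_iff_integrableOn_Ioc_of_le zero_le_one).1 (ii_xk k)).aestronglyMeasurable.aemeasurable
  have hm : AEMeasurable (fun s => ENNReal.ofReal (‖xk k s - fstZ d (Zk s k) • V (s, gam (Zk s k))‖ ^ 2))
      (volume.restrict (Ioc (0:ℝ) 1)) :=
    ((hm1.sub hm2.aemeasurable).norm.pow_const 2).ennreal_ofReal
  rw [lintegral_eq_zero_iff' hm] at h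
  have h2 := (ae_restrict_iff' measurableSet_Ioc).1 h
  filter_upwards [h2] with s hs hs1
  have h3 := hs hs1
  simp only [Pi.zero_apply, ENNReal.ofReal_eq_zero] at h3
  have h4 : ‖xk k s - fstZ d (Zk s k) • V (s, gam (Zk s k))‖ = 0 := by
    have := sq_nonneg ‖xk k s - fstZ d (Zk s k) • V (s, gam (Zk s k))‖
    exact pow_eq_zero_iff (two_ne_zero) |>.1 (le_antisymm h3 this)
  exact sub_eq_zero.1 (norm_eq_zero.1 h4)

lemma ae_deriv_Zk {R : ℝ} (k : KK d R) :
    ∀ᵐ t, t ∈ Ioo (0:ℝ) 1 → HasDerivAt (fun s => Zk s k) (xk k t) t := by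
  filter_upwards [(ii_xk k).ae_hasDerivAt_integral] with t ht ht1
  have h1 := (ht (by rw [uIcc_of_le zero_le_one]; exact Ioo_subset_Icc_self ht1) 0 (by simp)).const_add (Zk 0 k)
  refine h1.congr_of_eventuallyEq ?_
  filter_upwards [isOpen_Ioo.mem_nhds ht1] with s hs
  exact Zk_eq k (Ioo_subset_Icc_self hs)

lemma AC2_fst {R : ℝ} (k : KK d R) : AC2 fun t => fstZ d (Zk t k) := by
  refine ⟨fun t => fstZ d (xk k t), ?_, ?_, ?_⟩
  · have h1 := (intervalIntegrable_iff_integrableOn_Icc_of_le zero_le_one).1 (ii_xk k)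
    exact (fstZ d).integrable_comp h1
  · have h1 := (intervalIntegrable_iff_integrableOn_Icc_of_le zero_le_one).1 (ii_xk k)
    have h2 := (intervalIntegrable_iff_integrableOn_Icc_of_le zero_le_one).1 (ii_xk2 k)
    refine Integrable.mono' h2 (((fstZ d).integrable_comp h1).aestronglyMeasurable.norm.pow 2) (ae_of_all _ fun t => ?_)
    rw [Real.norm_of_nonneg (by positivity)]
    exact pow_le_pow_left₀ (norm_nonneg _) (abs_fstZ_le _) 2
  · intro t ht
    have hii : IntervalIntegrable (fun s => xk k s) volume 0 t :=
      intInt_of_nu (integrable_HH _) ⟨le_rfl, zero_le_one⟩ ht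
    beta_reduce
    rw [Zk_eq k ht, map_add, ← ContinuousLinearMap.intervalIntegral_comp_comm _ hii]

lemma AC2_snd {R : ℝ} (k : KK d R) : AC2 fun t => sndZ d (Zk t k) := by
  refine ⟨fun t => sndZ d (xk k t), ?_, ?_, ?_⟩
  · have h1 := (intervalIntegrable_iff_integrableOn_Icc_of_le zero_le_one).1 (ii_xk k)
    exact (sndZ d).integrable_comp h1
  · have h1 := (intervalIntegrable_iff_integrableOn_Icc_of_le zero_le_one).1 (ii_xk k)
    have h2 := (intervalIntegrable_iff_integrableOn_Icc_of_le zero_le_one).1 (ii_xk2 k)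
    refine Integrable.mono' h2 (((sndZ d).integrable_comp h1).aestronglyMeasurable.norm.pow 2) (ae_of_all _ fun t => ?_)
    rw [Real.norm_of_nonneg (by positivity)]
    exact pow_le_pow_left₀ (norm_nonneg _) (norm_sndZ_le _) 2
  · intro t ht
    have hii : IntervalIntegrable (fun s => xk k s) volume 0 t :=
      intInt_of_nu (integrable_HH _) ⟨le_rfl, zero_le_one⟩ ht
    beta_reduce
    rw [Zk_eq k ht, map_add, ← ContinuousLinearMap.intervalIntegral_comp_comm _ hii]

lemma fst_le_two {R : ℝ} (t : ℝ) (k : KK d R) : |fstZ d (Zk t k)| ≤ 2 :=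
  (abs_fstZ_le _).trans (norm_Zk t k)

lemma AC2_fst_sq {R : ℝ} (k : KK d R) : AC2 fun t => fstZ d (Zk t k) ^ 2 := by
  obtain ⟨f', h1, h2, h3⟩ := AC2_fst k
  have hc : Continuous fun t => fstZ d (Zk t k) := (fstZ d).continuous.comp (continuous_Zks k)
  have hi : IntervalIntegrable f' volume 0 1 :=
    (intervalIntegrable_iff_integrableOn_Icc_of_le zero_le_one).2 h1
  have hm : AEStronglyMeasurable (fun t => 2 * fstZ d (Zk t k) * f' t) (volume.restrict (Icc (0:ℝ) 1)) :=
    (continuous_const.mul hc).aestronglyMeasurable.mul h1.aestronglyMeasurable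
  have hb : ∀ t, ‖2 * fstZ d (Zk t k) * f' t‖ ≤ 4 * ‖f' t‖ := by
    intro t
    have := fst_le_two t k
    rw [norm_mul, norm_mul, Real.norm_eq_abs, Real.norm_eq_abs, abs_two]
    exact mul_le_mul_of_nonneg_right (by linarith) (norm_nonneg _)
  refine ⟨fun t => 2 * fstZ d (Zk t k) * f' t, ?_, ?_, fun t ht => sq_AC hi h3 ht⟩
  · exact Integrable.mono' (h1.norm.const_mul 4) hm (ae_of_all _ hb)
  · refine Integrable.mono' (h2.const_mul 16) (hm.norm.pow 2) (ae_of_all _ fun t => ?_)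
    rw [Real.norm_of_nonneg (by positivity)]
    calc _ ≤ (4 * ‖f' t‖) ^ 2 := pow_le_pow_left₀ (norm_nonneg _) (hb t) 2
      _ = _ := by ring

/-- the characteristic system for good paths -/
theorem char_of_good {R : ℝ} (hR : 1 ≤ R) {v : XX d → Euc d} {g : XX d → ℝ} (hv : Measurable v)
    (hg : Measurable g) (x0 : Euc d) {k : KK d R} (hA : Aq (VV v g) k = 0) :
    AC2 (fun t => fstZ d (Zk t k) ^ 2) ∧
    AC2 (fun t => Real.sqrt (fstZ d (Zk t k) ^ 2)) ∧
    AC2 (fun t => Real.sqrt (fstZ d (Zk t k) ^ 2) • gamx x0 (Zk t k)) ∧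
    (∀ᵐ t ∂(volume.restrict {t | t ∈ Ioo (0:ℝ) 1 ∧ 0 < fstZ d (Zk t k) ^ 2}),
        HasDerivAt (fun t => gamx x0 (Zk t k)) (v (t, gamx x0 (Zk t k))) t) ∧
    (∀ᵐ t ∂(volume.restrict (Ioo (0:ℝ) 1)),
        HasDerivAt (fun t => fstZ d (Zk t k) ^ 2) (g (t, gamx x0 (Zk t k)) * fstZ d (Zk t k) ^ 2) t) := by
  have hs : ∀ t, Real.sqrt (fstZ d (Zk t k) ^ 2) = fstZ d (Zk t k) := fun t =>
    Real.sqrt_sq (fst_nonneg hR (cone_Zk t k))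
  have hc : Continuous fun t => fstZ d (Zk t k) := (fstZ d).continuous.comp (continuous_Zks k)
  refine ⟨AC2_fst_sq k, ?_, ?_, ?_, ?_⟩
  · simp only [hs]; exact AC2_fst k
  · simp only [hs, fst_smul_gamx (cone_Zk _ k)]; exact AC2_snd k
  · have hms : MeasurableSet {t | t ∈ Ioo (0:ℝ) 1 ∧ 0 < fstZ d (Zk t k) ^ 2} :=
      measurableSet_Ioo.inter (measurableSet_lt measurable_const (hc.measurable.pow_const 2))
    rw [ae_restrict_iff' hms]
    filter_upwards [xk_of_Aq (measurable_VV hv hg) hA, ae_deriv_Zk k] with t h1 h2 ht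
    have h3 := h1 (Ioo_subset_Ioc_self ht.1)
    have h4 := h2 ht.1
    rw [h3] at h4
    have hr : fstZ d (Zk t k) ≠ 0 := by
      intro h0; have := ht.2; rw [h0] at this; simp at this
    have hx : ∀ z : ZZ d, fstZ d z ≠ 0 → gamx x0 z = gam z := fun z hz => by simp [gamx, hz]
    have d1 : HasDerivAt (fun s => fstZ d (Zk s k)) _ t := (fstZ d).hasFDerivAt.comp_hasDerivAt t h4
    have d2 : HasDerivAt (fun s => sndZ d (Zk s k)) _ t := (sndZ d).hasFDerivAt.comp_hasDerivAt t h4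
    have d3 := (d1.inv hr).smul d2
    rw [hx _ hr]
    have d4 : HasDerivAt (fun t => gamx x0 (Zk t k)) _ t := d3.congr_of_eventuallyEq (by
      filter_upwards [hc.continuousAt.eventually_ne hr] with s hs
      rw [hx _ hs]; rfl)
    convert d4 using 1
    have hy : sndZ d (Zk t k) = fstZ d (Zk t k) • gam (Zk t k) := by
      rw [gam, smul_smul, mul_inv_cancel₀ hr, one_smul]
    simp only [VV, qf, map_smul, map_add, fstZ_pZ, sndZ_pZ, fstZ_jZ, sndZ_jZ, smul_eq_mul, add_zero, mul_one,
      Pi.inv_apply]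
    rw [hy]
    generalize fstZ d (Zk t k) = r at hr
    generalize gam (Zk t k) = x
    simp only [smul_add, smul_smul]
    have e1 : r⁻¹ * r = 1 := inv_mul_cancel₀ hr
    have e2 : r⁻¹ * (r * (g (t, x) / 2)) + -(r * (g (t, x) / 2)) / r ^ 2 * r = 0 := by
      field_simp; ring
    rw [e1, one_smul, add_right_comm, ← add_smul, e2, zero_smul, zero_add]
  · rw [ae_restrict_iff' measurableSet_Ioo]
    filter_upwards [xk_of_Aq (measurable_VV hv hg) hA, ae_deriv_Zk k] with t h1 h2 ht
    have h3 := h1 (Ioo_subset_Ioc_self ht)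
    have h4 := h2 ht
    rw [h3] at h4
    have d1 : HasDerivAt (fun s => fstZ d (Zk s k)) _ t := (fstZ d).hasFDerivAt.comp_hasDerivAt t h4
    have d2 := d1.pow 2
    refine HasDerivAt.congr_deriv (f := fun s => fstZ d (Zk s k) ^ 2) d2 ?_
    by_cases hr : fstZ d (Zk t k) = 0
    · simp [hr]
    · simp only [gamx, hr, if_false, VV, qf, map_smul, map_add, fstZ_pZ, fstZ_jZ, smul_eq_mul, add_zero, mul_one]
      push_cast; ring

end

section

/-- admissible test functions in the flat distance -/
def FT (φ : Euc d → ℝ) : Prop := Continuous φ ∧ (∀ x, |φ x| ≤ 1) ∧ LipschitzWith 1 φ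

lemma FT_zero : FT (fun _ : Euc d => (0:ℝ)) :=
  ⟨continuous_const, fun _ => by simp, LipschitzWith.const' 0⟩

lemma FT_one : FT (fun _ : Euc d => (1:ℝ)) :=
  ⟨continuous_const, fun _ => by simp, LipschitzWith.const' 1⟩

lemma FT_neg {φ : Euc d → ℝ} (h : FT φ) : FT (fun x => - φ x) :=
  ⟨h.1.neg, fun x => by rw [abs_neg]; exact h.2.1 x, by
    refine LipschitzWith.of_dist_le_mul fun x y => ?_
    have := h.2.2.dist_le_mul x y
    rwa [dist_neg_neg]⟩

lemma cone_int {a : ℝ} (ha : 0 ≤ a) (x : Euc d) (φ : Euc d → ℝ) :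
    ∫ y, φ y ∂(ENNReal.ofReal a • Measure.dirac x) = a * φ x := by
  rw [integral_smul_measure, integral_dirac, ENNReal.toReal_ofReal ha, smul_eq_mul]

variable {V : Set (Euc d)}

lemma SCurve.int_le (η : SCurve V) (t : ℝ) {φ : Euc d → ℝ} (hφ : FT φ) :
    |∫ x, φ x ∂(η.toFun t)| ≤ ∫ _, (1:ℝ) ∂(η.toFun t) := by
  obtain ⟨a, x, ha, -, h⟩ := η.cone t
  rw [h, cone_int ha, cone_int ha, abs_mul, abs_of_nonneg ha]
  exact mul_le_mul_of_nonneg_left (hφ.2.1 x) ha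

lemma SCurve.mass_bdd (η : SCurve V) : ∃ C : ℝ, ∀ t ∈ Icc (0:ℝ) 1, ∫ _, (1:ℝ) ∂(η.toFun t) ≤ C := by
  obtain ⟨C, hC⟩ := isCompact_Icc.exists_bound_of_continuousOn (s := Icc (0:ℝ) 1)
    (η.narrow (fun _ => 1) continuous_const).continuousOn
  exact ⟨C, fun t ht => (le_abs_self _).trans (hC t ht)⟩

lemma flat_bdd (η₁ η₂ : SCurve V) (t : ℝ) : ∀ r ∈ {r : ℝ | ∃ φ : Euc d → ℝ, Continuous φ ∧
      (∀ x, |φ x| ≤ 1) ∧ LipschitzWith 1 φ ∧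
        r = (∫ x, φ x ∂(η₁.toFun t)) - ∫ x, φ x ∂(η₂.toFun t)},
      r ≤ (∫ _, (1:ℝ) ∂(η₁.toFun t)) + ∫ _, (1:ℝ) ∂(η₂.toFun t) := by
  rintro r ⟨φ, h1, h2, h3, rfl⟩
  have a1 := abs_le.1 (η₁.int_le t ⟨h1, h2, h3⟩)
  have a2 := abs_le.1 (η₂.int_le t ⟨h1, h2, h3⟩)
  linarith [a1.2, a2.1]

lemma flat_le {η₁ η₂ : SCurve V} {t c : ℝ}
    (h : ∀ φ, FT φ → (∫ x, φ x ∂(η₁.toFun t)) - (∫ x, φ x ∂(η₂.toFun t)) ≤ c) :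
    flatDist (η₁.toFun t) (η₂.toFun t) ≤ c := by
  unfold flatDist
  refine csSup_le ⟨_, fun _ => 0, FT_zero.1, FT_zero.2.1, FT_zero.2.2, rfl⟩ ?_
  rintro r ⟨φ, h1, h2, h3, rfl⟩
  exact h φ ⟨h1, h2, h3⟩

lemma Ddist_le {η₁ η₂ : SCurve V} {c : ℝ}
    (h : ∀ t ∈ Icc (0:ℝ) 1, ∀ φ, FT φ → (∫ x, φ x ∂(η₁.toFun t)) - (∫ x, φ x ∂(η₂.toFun t)) ≤ c) :
    Ddist η₁ η₂ ≤ c := by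
  unfold Ddist
  refine csSup_le ⟨_, 0, by simp, rfl⟩ ?_
  rintro r ⟨t, ht, rfl⟩
  exact flat_le (h t ht)

lemma le_Ddist (η₁ η₂ : SCurve V) {t : ℝ} (ht : t ∈ Icc (0:ℝ) 1) {φ : Euc d → ℝ} (hφ : FT φ) :
    (∫ x, φ x ∂(η₁.toFun t)) - (∫ x, φ x ∂(η₂.toFun t)) ≤ Ddist η₁ η₂ := by
  obtain ⟨C₁, h₁⟩ := η₁.mass_bdd
  obtain ⟨C₂, h₂⟩ := η₂.mass_bdd
  have h3 : (∫ x, φ x ∂(η₁.toFun t)) - (∫ x, φ x ∂(η₂.toFun t)) ≤ flatDist (η₁.toFun t) (η₂.toFun t) :=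
    le_csSup ⟨_, flat_bdd η₁ η₂ t⟩ ⟨φ, hφ.1, hφ.2.1, hφ.2.2, rfl⟩
  refine h3.trans (le_csSup ⟨C₁ + C₂, ?_⟩ ⟨t, ht, rfl⟩)
  rintro r ⟨s, hs, rfl⟩
  refine flat_le fun ψ hψ => ?_
  exact (flat_bdd η₁ η₂ s _ ⟨ψ, hψ.1, hψ.2.1, hψ.2.2, rfl⟩).trans (add_le_add (h₁ s hs) (h₂ s hs))

lemma Ddist_self (η : SCurve V) : Ddist η η ≤ 0 := Ddist_le fun _ _ _ _ => by simp

lemma Ddist_triangle (η₁ η₂ η₃ : SCurve V) : Ddist η₁ η₃ ≤ Ddist η₁ η₂ + Ddist η₂ η₃ :=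
  Ddist_le fun t ht φ hφ => by
    have h1 := le_Ddist η₁ η₂ ht hφ
    have h2 := le_Ddist η₂ η₃ ht hφ
    linarith

lemma isOpen_ball (η₀ : SCurve V) {ε : ℝ} (hε : 0 < ε) : @IsOpen _ (Stop V) {η | Ddist η₀ η < ε} :=
  TopologicalSpace.isOpen_generateFrom_of_mem ⟨η₀, ε, hε, rfl⟩

lemma continuous_eval {t : ℝ} (ht : t ∈ Icc (0:ℝ) 1) {φ : Euc d → ℝ} (hφ : FT φ) :
    @Continuous _ _ (Stop V) _ (fun η : SCurve V => ∫ x, φ x ∂(η.toFun t)) := by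
  let := Stop V
  rw [continuous_iff_continuousAt]
  intro η
  rw [ContinuousAt, Metric.tendsto_nhds]
  intro ε hε
  have hmem : {η' | Ddist η η' < ε} ∈ 𝓝 η :=
    (isOpen_ball η hε).mem_nhds ((Ddist_self η).trans_lt hε)
  filter_upwards [hmem] with η' h'
  have h1 := le_Ddist η η' ht hφ
  have h2 := le_Ddist η η' ht (FT_neg hφ)
  simp only [integral_neg] at h2
  rw [Real.dist_eq, abs_lt]
  have h3 : Ddist η η' < ε := h'
  constructor <;> linarith

lemma cone_ext {μ ν : Measure (Euc d)} (hμ : μ ∈ coneSet V) (hν : ν ∈ coneSet V)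
    (h : ∀ φ, FT φ → ∫ x, φ x ∂μ = ∫ x, φ x ∂ν) : μ = ν := by
  obtain ⟨a, x, ha, -, rfl⟩ := hμ
  obtain ⟨b, y, hb, -, rfl⟩ := hν
  have h1 := h _ FT_one
  rw [cone_int ha, cone_int hb, mul_one, mul_one] at h1
  subst h1
  rcases eq_or_ne a 0 with rfl | h0
  · simp
  have hF : FT (fun z : Euc d => min 1 (dist z x)) := by
    refine ⟨by fun_prop, fun z => ?_, ?_⟩
    · rw [abs_of_nonneg (le_min zero_le_one dist_nonneg)]; exact min_le_left _ _
    · exact (LipschitzWith.dist_left x).const_min 1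
  have h2 := h _ hF
  rw [cone_int ha, cone_int ha] at h2
  have h3 := mul_left_cancel₀ h0 h2
  simp only [dist_self] at h3
  have h4 : dist y x = 0 := by
    rcases min_choice 1 (dist y x) with h | h
    · rw [h] at h3; norm_num at h3
    · rw [h] at h3; rw [← h3]; simp
  rw [dist_eq_zero.1 h4]

lemma SCurve.ext' {η₁ η₂ : SCurve V} (h : ∀ t ∈ Icc (0:ℝ) 1, η₁.toFun t = η₂.toFun t) : η₁ = η₂ := by
  have : η₁.toFun = η₂.toFun := by
    ext1 t
    rw [η₁.clamped, η₂.clamped, h _ (clamp_mem t)]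
  cases η₁; cases η₂; simp only at this; subst this; rfl

lemma t2_Stop : @T2Space _ (Stop V) := by
  let := Stop V
  refine ⟨fun η₁ η₂ hne => ?_⟩
  have : ∃ t ∈ Icc (0:ℝ) 1, ∃ φ, FT φ ∧ ∫ x, φ x ∂(η₁.toFun t) ≠ ∫ x, φ x ∂(η₂.toFun t) := by
    by_contra! hcon
    exact hne (SCurve.ext' fun t ht => cone_ext (η₁.cone t) (η₂.cone t) (hcon t ht))
  obtain ⟨t, ht, φ, hφ, h⟩ := this
  obtain ⟨U, W, hU, hW, h1, h2, hd⟩ := t2_separation h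
  have hc := continuous_eval (V := V) ht hφ
  exact ⟨_, _, hU.preimage hc, hW.preimage hc, h1, h2, hd.preimage _⟩

instance borel_S : @BorelSpace (SCurve V) (Stop V) _ := @BorelSpace.mk _ (Stop V) _ rfl

lemma measurable_toFun {t : ℝ} (ht : t ∈ Icc (0:ℝ) 1) : Measurable fun η : SCurve V => η.toFun t := by
  let := Stop V
  refine measurable_measure_of_lip _ (fun η => ?_) fun φ h1 h2 h3 => ?_
  · obtain ⟨a, x, ha, -, h⟩ := η.cone t
    rw [h]
    exact Measure.smul_finite _ ENNReal.ofReal_ne_top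
  · exact (continuous_eval ht ⟨h1, h2, h3⟩).measurable

end

section

/-- the weighted Dirac mass of a cone point -/
def mz (x0 : Euc d) (z : ZZ d) : Measure (Euc d) :=
  ENNReal.ofReal (fstZ d z ^ 2) • Measure.dirac (gamx x0 z)

lemma int_mz (x0 : Euc d) (z : ZZ d) (φ : Euc d → ℝ) :
    ∫ x, φ x ∂(mz x0 z) = fstZ d z ^ 2 * φ (gam z) := by
  rw [mz, cone_int (by positivity)]
  unfold gamx
  split_ifs with h
  · simp [h]
  · rfl

lemma lint_mz (x0 : Euc d) (z : ZZ d) {s : Set (Euc d)} (hs : MeasurableSet s) :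
    mz x0 z s = ENNReal.ofReal (fstZ d z ^ 2) * s.indicator 1 (gam z) := by
  rw [mz, Measure.smul_apply, Measure.dirac_apply' _ hs, smul_eq_mul]
  unfold gamx
  split_ifs with h
  · simp [h]
  · rfl

lemma norm_gam_le {R : ℝ} (hR : 1 ≤ R) {z : ZZ d} (h : InCone R z) : ‖gam z‖ ≤ R := by
  have h1 : ‖sndZ d z‖ ≤ R * fstZ d z := h
  have h0 := fst_nonneg hR h
  rw [gam, norm_smul, norm_inv, Real.norm_of_nonneg h0]
  rcases h0.eq_or_lt with h2 | h2
  · rw [← h2]; simp; linarith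
  · rw [inv_mul_le_iff₀ h2]; linarith

lemma mz_lip {R : ℝ} (hR : 1 ≤ R) {z z' : ZZ d} (h : InCone R z) (h' : InCone R z')
    (hz : |fstZ d z| ≤ 2) (hz' : |fstZ d z'| ≤ 2) {φ : Euc d → ℝ} (hφ : FT φ) :
    fstZ d z ^ 2 * φ (gam z) - fstZ d z' ^ 2 * φ (gam z') ≤ (6 + 2 * R) * ‖z - z'‖ := by
  have a1 : |fstZ d z - fstZ d z'| ≤ ‖z - z'‖ := by
    rw [← map_sub]; exact abs_fstZ_le _
  have a2 : ‖sndZ d z - sndZ d z'‖ ≤ ‖z - z'‖ := by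
    rw [← map_sub]; exact norm_sndZ_le _
  have r0 := fst_nonneg hR h
  have r0' := fst_nonneg hR h'
  have hg' := norm_gam_le hR h'
  have hy : fstZ d z • gam z = sndZ d z := by
    have := congrArg (sndZ d) (cone_eq h); simpa using this.symm
  have hy' : fstZ d z' • gam z' = sndZ d z' := by
    have := congrArg (sndZ d) (cone_eq h'); simpa using this.symm
  have b1 : fstZ d z * ‖gam z - gam z'‖ ≤ (1 + R) * ‖z - z'‖ := by
    have e : fstZ d z • (gam z - gam z') = (sndZ d z - sndZ d z') - (fstZ d z - fstZ d z') • gam z' := by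
      rw [smul_sub, sub_smul, hy, hy']; abel
    have : fstZ d z * ‖gam z - gam z'‖ = ‖fstZ d z • (gam z - gam z')‖ := by
      rw [norm_smul, Real.norm_of_nonneg r0]
    rw [this, e]
    refine (norm_sub_le _ _).trans ?_
    rw [norm_smul, Real.norm_eq_abs]
    have := mul_le_mul a1 hg' (norm_nonneg _) (norm_nonneg _)
    linarith
  have b2 : φ (gam z) - φ (gam z') ≤ ‖gam z - gam z'‖ := by
    have := hφ.2.2.dist_le_mul (gam z) (gam z')
    rw [Real.dist_eq, dist_eq_norm, NNReal.coe_one, one_mul] at this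
    exact (le_abs_self _).trans this
  have b3 : fstZ d z ^ 2 * (φ (gam z) - φ (gam z')) ≤ 2 * ((1 + R) * ‖z - z'‖) := by
    calc _ ≤ fstZ d z ^ 2 * ‖gam z - gam z'‖ := by gcongr
      _ = fstZ d z * (fstZ d z * ‖gam z - gam z'‖) := by ring
      _ ≤ 2 * ((1 + R) * ‖z - z'‖) := mul_le_mul ((le_abs_self _).trans hz) b1
          (mul_nonneg r0 (norm_nonneg _)) (by norm_num)
  have b4 : (fstZ d z ^ 2 - fstZ d z' ^ 2) * φ (gam z') ≤ 4 * ‖z - z'‖ := by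
    refine (le_abs_self _).trans ?_
    rw [abs_mul, sq_sub_sq, abs_mul]
    have c1 : |fstZ d z + fstZ d z'| ≤ 4 := (abs_add_le _ _).trans (by linarith)
    calc |fstZ d z + fstZ d z'| * |fstZ d z - fstZ d z'| * |φ (gam z')|
        ≤ 4 * ‖z - z'‖ * 1 := by
          gcongr
          exact hφ.2.1 _
      _ = _ := by ring
  nlinarith

/-- paths that stay in `Ω` -/
def KO (Ω : Set (Euc d)) (R : ℝ) : Set (KK d R) := {k | ∀ t, fstZ d (Zk t k) ≠ 0 → gam (Zk t k) ∈ Ω}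

lemma isClosed_KO {Ω : Set (Euc d)} (hΩ : IsClosed Ω) (R : ℝ) : IsClosed (KO Ω R) := by
  have : KO Ω R = ⋂ t, {k : KK d R | fstZ d (Zk t k) ≠ 0 → gam (Zk t k) ∈ Ω} := by
    ext k; simp [KO]
  rw [this]
  refine isClosed_iInter fun t => ?_
  rw [← isOpen_compl_iff, isOpen_iff_mem_nhds]
  intro k hk
  simp only [mem_compl_iff, mem_setOf_eq, Classical.not_imp] at hk
  obtain ⟨hr, hn⟩ := hk
  have hr' : Continuous fun k : KK d R => fstZ d (Zk t k) := (fstZ d).continuous.comp (continuous_Zkt t)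
  have hg : ContinuousAt (fun k : KK d R => gam (Zk t k)) k := by
    unfold gam
    exact (hr'.continuousAt.inv₀ hr).smul ((sndZ d).continuous.comp (continuous_Zkt t)).continuousAt
  filter_upwards [hg.eventually (hΩ.isOpen_compl.mem_nhds hn), hr'.continuousAt.eventually_ne hr] with k' h1 h2
  simp only [mem_compl_iff, mem_setOf_eq, Classical.not_imp]
  exact ⟨h2, h1⟩

lemma narrow_mz {R : ℝ} (hR : 1 ≤ R) (x0 : Euc d) (k : KK d R) {φ : Euc d → ℝ} (hφ : Continuous φ) :
    Continuous fun t => ∫ x, φ x ∂(mz x0 (Zk t k)) := by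
  simp only [int_mz]
  obtain ⟨M, hM⟩ := (isCompact_closedBall (0 : Euc d) R).exists_bound_of_continuousOn hφ.continuousOn
  have hM0 : 0 ≤ M := (norm_nonneg _).trans (hM 0 (by simp; linarith))
  have hc : Continuous fun p : XX d => max (-M) (min M (φ p.2)) := by fun_prop
  have hb : ∀ p : XX d, |max (-M) (min M (φ p.2))| ≤ M := fun p =>
    abs_le.2 ⟨le_max_left _ _, max_le (by linarith) (min_le_left _ _)⟩
  have h1 := Continuous.comp (g := fun p : ℝ × KK d R =>
    (fstZ d (Zk p.1 p.2)) ^ 2 * (fun p : XX d => max (-M) (min M (φ p.2))) (p.1, gam (Zk p.1 p.2)))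
        (f := fun s : ℝ => (s, k)) (continuous_aZ (R := R) hc hb) (by fun_prop)
  refine h1.congr fun t => ?_
  have h2 := abs_le.1 (hM (gam (Zk t k)) (by
    rw [mem_closedBall_zero_iff]; exact norm_gam_le hR (cone_Zk t k)))
  simp only [Function.comp]
  rw [min_eq_right h2.2, max_eq_right h2.1]

lemma Zk_clamp {R : ℝ} (t : ℝ) (k : KK d R) : Zk t k = Zk (clamp t) k := by
  rw [Zk_def, Zk_def, clamp_of_mem (clamp_mem _)]

/-- the curve associated with a path -/
def PhiK {Ω : Set (Euc d)} {R : ℝ} (hR : 1 ≤ R) {x0 : Euc d} (hx0 : x0 ∈ Ω) (k : KO Ω R) : SCurve Ω where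
  toFun t := mz x0 (Zk t k.1)
  clamped t := by rw [Zk_clamp]
  cone t := by
    refine ⟨fstZ d (Zk t k.1) ^ 2, gamx x0 (Zk t k.1), by positivity, ?_, rfl⟩
    unfold gamx
    split_ifs with h
    · exact hx0
    · exact k.2 t h
  narrow φ hφ := narrow_mz hR x0 k.1 hφ

lemma unif_Zk {R : ℝ} (k : KK d R) {ε : ℝ} (hε : 0 < ε) :
    ∀ᶠ k' in 𝓝 k, ∀ t ∈ Icc (0:ℝ) 1, ‖Zk t k - Zk t k'‖ < ε := by
  have c1 : Continuous fun p : KK d R × ℝ => Zk p.2 k :=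
    Continuous.comp (g := fun t : ℝ => Zk t k) (f := fun p : KK d R × ℝ => p.2) (continuous_Zks k)
      continuous_snd
  have c2 : Continuous fun p : KK d R × ℝ => Zk p.2 p.1 :=
    Continuous.comp (g := fun p : ℝ × KK d R => Zk p.1 p.2) (f := fun p : KK d R × ℝ => (p.2, p.1))
        continuous_Zk (continuous_snd.prodMk continuous_fst)
  have hc : Continuous fun p : KK d R × ℝ => ‖Zk p.2 k - Zk p.2 p.1‖ := (c1.sub c2).norm
  refine isCompact_Icc.eventually_forall_of_forall_eventually
    (P := fun (k' : KK d R) (t : ℝ) => ‖Zk t k - Zk t k'‖ < ε) fun t ht => ?_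
  have h0 : ‖Zk t k - Zk t k‖ < ε := by rw [sub_self, norm_zero]; exact hε
  have ho : IsOpen {p : KK d R × ℝ | ‖Zk p.2 k - Zk p.2 p.1‖ < ε} := isOpen_lt hc continuous_const
  exact ho.mem_nhds (x := (k, t)) h0

lemma continuous_PhiK {Ω : Set (Euc d)} {R : ℝ} (hR : 1 ≤ R) {x0 : Euc d} (hx0 : x0 ∈ Ω) :
    @Continuous _ _ _ (Stop Ω) (PhiK hR hx0) := by
  refine continuous_generateFrom_iff.2 ?_
  rintro s ⟨η₀, ε, hε, rfl⟩
  rw [isOpen_iff_mem_nhds]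
  intro k hk
  have hk' : Ddist η₀ (PhiK hR hx0 k) < ε := hk
  set δ := (ε - Ddist η₀ (PhiK hR hx0 k)) / (2 * (6 + 2 * R)) with hδ
  have hδ0 : 0 < δ := div_pos (by linarith) (by linarith)
  have h1 : ∀ᶠ k' : KO Ω R in 𝓝 k, ∀ t ∈ Icc (0:ℝ) 1, ‖Zk t k.1 - Zk t k'.1‖ < δ :=
    continuous_subtype_val.continuousAt.eventually (unif_Zk k.1 hδ0)
  filter_upwards [h1] with k' hk2
  have h2 : Ddist (PhiK hR hx0 k) (PhiK hR hx0 k') ≤ (6 + 2 * R) * δ := by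
    refine Ddist_le fun t ht φ hφ => ?_
    change (∫ x, φ x ∂(mz x0 (Zk t k.1))) - (∫ x, φ x ∂(mz x0 (Zk t k'.1))) ≤ _
    rw [int_mz, int_mz]
    refine (mz_lip hR (cone_Zk t k.1) (cone_Zk t k'.1) (fst_le_two _ _) (fst_le_two _ _) hφ).trans ?_
    exact mul_le_mul_of_nonneg_left (hk2 t ht).le (by linarith)
  have h3 := Ddist_triangle η₀ (PhiK hR hx0 k) (PhiK hR hx0 k')
  have h4 : (6 + 2 * R) * δ = (ε - Ddist η₀ (PhiK hR hx0 k)) / 2 := by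
    rw [hδ]; field_simp
  change Ddist η₀ (PhiK hR hx0 k') < ε
  linarith

end

section

lemma memHvg_PhiK {Ω : Set (Euc d)} {R : ℝ} (hR : 1 ≤ R) {x0 : Euc d} (hx0 : x0 ∈ Ω)
    {v : XX d → Euc d} {g : XX d → ℝ} (hv : Measurable v) (hg : Measurable g) (k : KO Ω R)
    (hA : Aq (VV v g) k.1 = 0) : MemHvg Ω v g (PhiK hR hx0 k) := by
  obtain ⟨h1, h2, h3, h4, h5⟩ := char_of_good hR hv hg x0 hA
  refine ⟨fun t => gamx x0 (Zk t k.1), fun t => fstZ d (Zk t k.1) ^ 2, ?_, h1, h2, h3, h4, h5⟩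
  intro t ht
  refine ⟨by positivity, ?_, rfl⟩
  change gamx x0 (Zk t k.1) ∈ Ω
  unfold gamx
  split_ifs with h
  · exact hx0
  · exact k.2 t h

theorem assemble {Ω : Set (Euc d)} (hΩ : IsClosed Ω) {R : ℝ} (hR : 1 ≤ R) {x0 : Euc d} (hx0 : x0 ∈ Ω)
    {v : XX d → Euc d} {g : XX d → ℝ} (hv : Measurable v) (hg : Measurable g)
    {ρ : ℝ → Measure (Euc d)} {σ : Measure (KK d R)} [IsFiniteMeasure σ] [σ.Regular]
    (hm : ∀ t ∈ Icc (0:ℝ) 1, ρ t = (σ.withDensity (wt t)).map (fun k => gam (Zk t k)))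
    (hA : ∀ᵐ k ∂σ, Aq (VV v g) k = 0)
    (hS : ∀ᵐ k ∂σ, ∀ t, fstZ d (Zk t k) ≠ 0 → gam (Zk t k) ∈ Ω) :
    ∃ σ' : Measure (SCurve Ω), IsFiniteMeasure σ' ∧
      σ' {η | ¬ MemHvg Ω v g η} = 0 ∧
      (∫⁻ η, supMass η ∂σ') < ⊤ ∧
      (∀ t ∈ Icc (0:ℝ) 1, ∀ s : Set (Euc d), MeasurableSet s →
        ρ t s = ∫⁻ η, η.toFun t s ∂σ') ∧
      (∀ t ∈ Icc (0:ℝ) 1, ∀ φ : Euc d → ℝ, Continuous φ →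
        (∫ x, φ x ∂(ρ t)) = ∫ η, (∫ x, φ x ∂(η.toFun t)) ∂σ') := by
  let _ : TopologicalSpace (SCurve Ω) := Stop Ω
  have hT2 : T2Space (SCurve Ω) := t2_Stop
  have hcl := isClosed_KO hΩ R
  have hmK : MeasurableSet (KO Ω R) := hcl.measurableSet
  have hKO : ∀ᵐ k ∂σ, k ∈ KO Ω R := hS
  have hcΦ : Continuous (PhiK (Ω := Ω) hR hx0) := continuous_PhiK hR hx0
  have hmΦ : Measurable (PhiK (Ω := Ω) hR hx0) := hcΦ.measurable
  set τ : Measure (KO Ω R) := σ.comap Subtype.val with hτ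
  have hmap : τ.map Subtype.val = σ := by
    rw [hτ, map_comap_subtype_coe hmK, Measure.restrict_eq_self_of_ae_mem hKO]
  have hfin : IsFiniteMeasure τ := by
    refine ⟨?_⟩
    have : τ univ = τ.map Subtype.val univ := by
      rw [Measure.map_apply measurable_subtype_coe MeasurableSet.univ]; simp
    rw [this, hmap]; exact measure_lt_top _ _
  have hl : ∀ f : KK d R → ℝ≥0∞, Measurable f → ∫⁻ k, f k.1 ∂τ = ∫⁻ k, f k ∂σ := by
    intro f hf
    conv_rhs => rw [← hmap]
    rw [lintegral_map hf measurable_subtype_coe]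
  have hi : ∀ f : KK d R → ℝ, ∫ k, f k.1 ∂τ = ∫ k, f k ∂σ := by
    intro f
    conv_rhs => rw [← hmap]
    rw [(MeasurableEmbedding.subtype_coe hmK).integral_map]
  refine ⟨τ.map (PhiK hR hx0), inferInstance, ?_, ?_, ?_, ?_⟩
  · -- null set
    obtain ⟨N, hNsub, hNm, hN0⟩ := exists_measurable_superset_of_null (ae_iff.1 (hA.and hKO))
    have hex : ∀ n : ℕ, ∃ F ⊆ Nᶜ, IsCompact F ∧ σ (Nᶜ \ F) < ((n : ℝ≥0∞) + 1)⁻¹ := fun n =>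
      hNm.compl.exists_isCompact_sdiff_lt (measure_ne_top _ _) (by simp)
    choose F hF1 hF2 hF3 using hex
    have hgood : ∀ k ∈ Nᶜ, Aq (VV v g) k = 0 ∧ k ∈ KO Ω R := by
      intro k hk
      by_contra hcon
      exact hk (hNsub hcon)
    set S : Set (SCurve Ω) := ⋃ n, Set.image (PhiK hR hx0) (Set.preimage Subtype.val (F n)) with hSdef
    have hSm : MeasurableSet S := by
      refine MeasurableSet.iUnion fun n => ?_
      exact ((hcl.isClosedEmbedding_subtypeVal.isCompact_preimage (hF2 n)).image hcΦ).isClosed.measurableSet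
    have hsub : {η | ¬ MemHvg Ω v g η} ⊆ Sᶜ := by
      intro η hη hηS
      obtain ⟨n, k, hk, rfl⟩ := mem_iUnion.1 hηS
      exact hη (memHvg_PhiK hR hx0 hv hg k (hgood _ (hF1 n hk)).1)
    refine measure_mono_null hsub ?_
    rw [Measure.map_apply hmΦ hSm.compl]
    have hsub2 : PhiK hR hx0 ⁻¹' Sᶜ ⊆ Subtype.val ⁻¹' (⋃ n, F n)ᶜ := by
      intro k hk hkF
      obtain ⟨n, hn⟩ := mem_iUnion.1 hkF
      exact hk (mem_iUnion.2 ⟨n, k, hn, rfl⟩)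
    refine measure_mono_null hsub2 ?_
    rw [← Measure.map_apply measurable_subtype_coe
      (MeasurableSet.iUnion fun n => (hF2 n).isClosed.measurableSet).compl, hmap]
    have hsub3 : (⋃ n, F n)ᶜ ⊆ N ∪ ⋂ n, (Nᶜ \ F n) := by
      intro k hk
      by_cases hkN : k ∈ N
      · exact Or.inl hkN
      · exact Or.inr (mem_iInter.2 fun n => ⟨hkN, fun h => hk (mem_iUnion.2 ⟨n, h⟩)⟩)
    refine measure_mono_null hsub3 (measure_union_null hN0 ?_)
    refine le_antisymm ?_ bot_le
    have hlim : Tendsto (fun n : ℕ => ((n : ℝ≥0∞) + 1)⁻¹) atTop (𝓝 0) := by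
      have := (tendsto_add_atTop_iff_nat 1).2 ENNReal.tendsto_inv_nat_nhds_zero
      simpa using this
    exact ge_of_tendsto' hlim fun n => (measure_mono (iInter_subset _ n)).trans (hF3 n).le
  · refine (lintegral_map_le _ _).trans_lt ?_
    have hb : ∀ k : KO Ω R, supMass (PhiK hR hx0 k) ≤ 4 := by
      intro k
      refine iSup₂_le fun t _ => ?_
      change mz x0 (Zk t k.1) univ ≤ 4
      rw [lint_mz _ _ MeasurableSet.univ]
      have hw := wt_le t k.1
      unfold wt at hw
      rw [indicator_univ, Pi.one_apply, mul_one]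
      exact hw
    refine (lintegral_mono hb).trans_lt ?_
    rw [lintegral_const]
    exact ENNReal.mul_lt_top (by simp) (measure_lt_top _ _)
  · intro t ht s hs
    have hms : Measurable fun η : SCurve Ω => η.toFun t s :=
      (Measure.measurable_coe hs).comp (measurable_toFun ht)
    rw [lintegral_map hms hmΦ]
    have hind : Measurable (s.indicator (1 : Euc d → ℝ≥0∞)) := measurable_one.indicator hs
    have e : ∀ k : KO Ω R, (PhiK hR hx0 k).toFun t s = wt t k.1 * s.indicator 1 (gam (Zk t k.1)) :=
      fun k => lint_mz x0 _ hs
    simp only [e]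
    rw [hl (fun k => wt t k * s.indicator 1 (gam (Zk t k)))
      ((measurable_wt _).mul (hind.comp (measurable_gamZ _))), ← marg_lint (hm t ht) hind,
      lintegral_indicator_one hs]
  · intro t ht φ hφ
    have hms : Measurable fun η : SCurve Ω => ∫ x, φ x ∂(η.toFun t) := by
      have hInt : ∀ η : SCurve Ω, Integrable φ (η.toFun t) := by
        intro η
        obtain ⟨a, x, ha, -, h⟩ := η.cone t
        rw [h]
        exact (integrable_dirac (by simp)).smul_measure ENNReal.ofReal_ne_top
      have e : (fun η : SCurve Ω => ∫ x, φ x ∂(η.toFun t)) = fun η : SCurve Ω =>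
          (∫⁻ x, ENNReal.ofReal (φ x) ∂(η.toFun t)).toReal -
          (∫⁻ x, ENNReal.ofReal (-φ x) ∂(η.toFun t)).toReal := by
        funext η
        exact integral_eq_lintegral_pos_part_sub_lintegral_neg_part (hInt η)
      rw [e]
      have hm1 : Measurable fun x => ENNReal.ofReal (φ x) := hφ.measurable.ennreal_ofReal
      have hm2 : Measurable fun x => ENNReal.ofReal (-φ x) := hφ.measurable.neg.ennreal_ofReal
      exact (((Measure.measurable_lintegral hm1).comp (measurable_toFun ht)).ennreal_toReal).sub
        (((Measure.measurable_lintegral hm2).comp (measurable_toFun ht)).ennreal_toReal)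
    rw [integral_map hmΦ.aemeasurable hms.aestronglyMeasurable]
    have e : ∀ k : KO Ω R, ∫ x, φ x ∂((PhiK hR hx0 k).toFun t) =
      fstZ d (Zk t k.1) ^ 2 * φ (gam (Zk t k.1)) := fun k => int_mz x0 _ φ
    simp only [e]
    rw [hi (fun k => fstZ d (Zk t k) ^ 2 * φ (gam (Zk t k))), marg_int (hm t ht) hφ]

end

/-- **Superposition principle (direct part).**
Every finite-energy narrowly continuous positive solution of the inhomogeneous
continuity equation `∂ₜ ρ + div (v ρ) = g ρ` on `X_Ω` is represented by a bounded
positive Borel measure `σ ∈ M⁺₁(𝒮_Ω)` concentrated on `H_Ω^{v,g}`, via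
`∫ φ dρ_t = ∫_{𝒮_Ω} h(t) φ(γ(t)) dσ(γ,h)` for all `φ ∈ C(Ω)` and `t ∈ [0,1]`. -/
theorem superposition_direct (d : ℕ) (hd : 1 ≤ d) (Ω : Set (Euc d))
    (hΩ : IsClosureOfBoundedDomain Ω)
    (v : XX d → Euc d) (g : XX d → ℝ) (hv : Measurable v) (hg : Measurable g)
    (ρ : ℝ → Measure (Euc d)) (hρ : NarrowCurve Ω ρ)
    (hCE : SolvesCE ρ v g) (hE : EnergyVG ρ v g < ⊤) :
    ∃ σ : Measure (SCurve Ω), IsFiniteMeasure σ ∧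
      σ {η | ¬ MemHvg Ω v g η} = 0 ∧
      (∫⁻ η, supMass η ∂σ) < ⊤ ∧
      (∀ t ∈ Icc (0:ℝ) 1, ∀ s : Set (Euc d), MeasurableSet s →
        ρ t s = ∫⁻ η, η.toFun t s ∂σ) ∧
      (∀ t ∈ Icc (0:ℝ) 1, ∀ φ : Euc d → ℝ, Continuous φ →
        (∫ x, φ x ∂(ρ t)) = ∫ η, (∫ x, φ x ∂(η.toFun t)) ∂σ) := by
  obtain ⟨U, hUo, ⟨x0, hx0U⟩, -, hUb, rfl⟩ := hΩ
  have hcpt : IsCompact (closure U) := hUb.isCompact_closure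
  have hx0 : x0 ∈ closure U := subset_closure hx0U
  obtain ⟨C, hC⟩ := hcpt.isBounded.exists_norm_le
  have hC0 : 0 ≤ C := (norm_nonneg _).trans (hC x0 hx0)
  have hR : (1:ℝ) ≤ C + 1 := by linarith
  have hΩR : ∀ x ∈ closure U, ‖x‖ ≤ C + 1 - 1 := fun x hx => by
    rw [add_sub_cancel_right]; exact hC x hx
  have h := good_of_narrow hρ
  have hcl : ∀ t ∈ Ioo (0:ℝ) 1, clamp t = t := fun t ht => clamp_of_mem (Ioo_subset_Icc_self ht)
  have hEm : Measurable fun p : XX d => ENNReal.ofReal (‖v p‖ ^ 2 + g p ^ 2) :=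
    ((hv.norm.pow_const 2).add (hg.pow_const 2)).ennreal_ofReal
  have hE' : ∫⁻ p, ENNReal.ofReal (‖v p‖ ^ 2 + g p ^ 2) ∂(PP h) < ⊤ := by
    rw [lintegral_PP h hEm]
    refine lt_of_eq_of_lt ?_ hE
    refine setLIntegral_congr_fun measurableSet_Ioo fun t ht => ?_
    simp only [hcl t ht]
  have hv2 : Integrable (fun p => ‖v p‖ ^ 2) (PP h) := by
    refine ⟨(hv.norm.pow_const 2).aestronglyMeasurable, ?_⟩
    rw [hasFiniteIntegral_iff_ofReal (Eventually.of_forall fun p => by positivity)]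
    refine (lintegral_mono fun p => ?_).trans_lt hE'
    exact ENNReal.ofReal_le_ofReal (by have := sq_nonneg (g p); linarith)
  have hg2 : Integrable (fun p => g p ^ 2) (PP h) := by
    refine ⟨(hg.pow_const 2).aestronglyMeasurable, ?_⟩
    rw [hasFiniteIntegral_iff_ofReal (Eventually.of_forall fun p => by positivity)]
    refine (lintegral_mono fun p => ?_).trans_lt hE'
    exact ENNReal.ofReal_le_ofReal (by have := sq_nonneg ‖v p‖; linarith)
  have hCEP : CEP h v g := by
    intro φ hφ
    rw [integral_PP h (integrable_test h hv hg hv2 hg2 hφ.1 hφ.2.1)]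
    refine Eq.trans ?_ (hCE φ hφ)
    refine setIntegral_congr_fun measurableSet_Ioo fun t ht => ?_
    simp only [hcl t ht]
  obtain ⟨σ, hσf, hσr, hLL, hmass⟩ := exists_sigma hcpt h hR hΩR hv hg hv2 hg2 hCEP
  have hm := fun t (ht : t ∈ Icc (0:ℝ) 1) => marg h hLL ht
  have hA := ae_Aq h (measurable_VV hv hg) (memLp_VV hcpt h hR hΩR hv hg hv2 hg2) hm hLL hmass
  have hS := ae_supp isClosed_closure h hm
  obtain ⟨σ', h1, h2, h3, h4, h5⟩ := assemble isClosed_closure hR hx0 hv hg hm hA hS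
  refine ⟨σ', h1, h2, h3, fun t ht s hs => ?_, fun t ht φ hφ => ?_⟩
  · rw [← h4 t ht s hs]
    simp only [clamp_of_mem ht]
  · rw [← h5 t ht φ hφ]
    simp only [clamp_of_mem ht]

end Paper
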